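/- arXiv:2602.15943 — 6 statements merged into one kernel-verified Lean document; each statement's English description precedes it below -/
import Mathlib

section
/- For every real ν > 0 and every real x > 0, the two classical integral representations of the modified Bessel function of the second kind agree: (√π / Γ(ν + 1/2)) · (x/2)^ν · ∫₁^∞ e^{−x t} (t² − 1)^{ν − 1/2} dt = (2^ν x^ν Γ(ν + 1/2) / √π) · ∫₀^∞ cos(t) / (t² + x²)^{ν + 1/2} dt. -/
open MeasureTheory Set

/-- The cosine transform of a Gaussian on the half-line. -/
theorem integral_cos_mul_exp_neg_mul_sq_Ioi {s : ℝ} (hs : 0 < s) :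
    ∫ t in Ioi (0:ℝ), Real.cos t * Real.exp (-(s * t ^ 2)) =
      √(Real.pi / s) / 2 * Real.exp (-(1 / (4 * s))) := by
  have h := fourierIntegral_gaussian (b := (s : ℂ)) (by simpa using hs) 1
  have hint : Integrable (fun x : ℝ => Complex.exp (Complex.I * 1 * ↑x) *
      Complex.exp (-(s : ℂ) * ↑x ^ 2)) := by
    have hg : Integrable (fun x : ℝ => Complex.exp (-(s : ℂ) * ↑x ^ 2)) :=
      integrable_cexp_neg_mul_sq (by simpa using hs)
    refine hg.bdd_mul (c := 1) (by fun_prop) (Filter.Eventually.of_forall fun x => ?_)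
    rw [mul_one, mul_comm, Complex.norm_exp_ofReal_mul_I]
  have hre := congrArg Complex.re h
  rw [← RCLike.re_eq_complex_re, ← integral_re hint] at hre
  have hL : ∀ x : ℝ, RCLike.re (Complex.exp (Complex.I * 1 * ↑x) *
      Complex.exp (-(s : ℂ) * ↑x ^ 2)) = Real.cos |x| * Real.exp (-(s * |x| ^ 2)) := by
    intro x
    have h1 : Complex.exp (-(s : ℂ) * ↑x ^ 2) = ((Real.exp (-(s * x ^ 2)) : ℝ) : ℂ) := by
      push_cast; ring_nf
    rw [h1, RCLike.re_eq_complex_re, Complex.re_mul_ofReal, mul_one, mul_comm Complex.I,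
      Complex.exp_ofReal_mul_I_re, Real.cos_abs, sq_abs]
  have hR : ((Real.pi : ℂ) / s) ^ (1 / 2 : ℂ) * Complex.exp (-1 ^ 2 / (4 * s)) =
      ((√(Real.pi / s) * Real.exp (-(1 / (4 * s))) : ℝ) : ℂ) := by
    rw [Real.sqrt_eq_rpow, Complex.ofReal_mul, Complex.ofReal_cpow (by positivity)]
    push_cast
    congr 2
    ring
  simp_rw [hL] at hre
  rw [hR, RCLike.re_eq_complex_re, Complex.ofReal_re,
    integral_comp_abs (f := fun x => Real.cos x * Real.exp (-(s * x ^ 2)))] at hre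
  linarith

/-- The Cauchy–Schlömilch substitution applied to a Gaussian. -/
theorem integral_exp_neg_sq_sub_div_Ioi {a b : ℝ} (ha : 0 < a) (hb : 0 < b) :
    ∫ v in Ioi (0:ℝ), Real.exp (-(a * v - b / v) ^ 2) = √Real.pi / (2 * a) := by
  set g : ℝ → ℝ := fun y => Real.exp (-1 * y ^ 2) with hg
  set φ : ℝ → ℝ := fun v => a * v - b / v with hφ
  have hd : ∀ v ∈ Ioi (0:ℝ), HasDerivWithinAt φ (a + b / v ^ 2) (Ioi 0) v := by
    intro v hv
    have hv' : v ≠ 0 := ne_of_gt hv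
    have h1 := ((hasDerivAt_id v).const_mul a).sub ((hasDerivAt_inv hv').const_mul b)
    refine (h1.congr_deriv ?_).hasDerivWithinAt
    field_simp
    ring
  have hmono : StrictMonoOn φ (Ioi 0) := by
    intro u hu v hv huv
    have h1 : b / v < b / u := div_lt_div_of_pos_left hb hu huv
    have h2 : a * u < a * v := by gcongr
    simp only [hφ]
    linarith
  have himg : φ '' Ioi 0 = univ := by
    refine eq_univ_of_forall fun y => ?_
    have hlt : |y| < √(y ^ 2 + 4 * a * b) := by
      rw [← Real.sqrt_sq_eq_abs]
      exact Real.sqrt_lt_sqrt (sq_nonneg y) (by nlinarith [mul_pos ha hb])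
    have hsq : √(y ^ 2 + 4 * a * b) ^ 2 = y ^ 2 + 4 * a * b := Real.sq_sqrt (by positivity)
    have hpos : 0 < y + √(y ^ 2 + 4 * a * b) := by linarith [neg_abs_le y]
    generalize √(y ^ 2 + 4 * a * b) = r at hsq hpos
    refine ⟨(y + r) / (2 * a), mem_Ioi.2 (by positivity), ?_⟩
    simp only [hφ]
    field_simp
    linear_combination hsq
  have hI := integral_image_eq_integral_abs_deriv_smul measurableSet_Ioi hd hmono.injOn g
  have hint := (integrableOn_image_iff_integrableOn_abs_deriv_smul measurableSet_Ioi hd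
    hmono.injOn g).1 (by
      rw [himg, integrableOn_univ]
      exact integrable_exp_neg_mul_sq one_pos)
  rw [himg, setIntegral_univ, hg, integral_gaussian, div_one] at hI
  have habs : ∀ v : ℝ, |a + b / v ^ 2| = a + b / v ^ 2 := fun v => abs_of_nonneg (by positivity)
  simp only [habs, smul_eq_mul] at hI hint
  have hmeas : Measurable (fun v => g (φ v)) := by
    simp only [hg, hφ]
    fun_prop
  have hint1 : IntegrableOn (fun v => a * g (φ v)) (Ioi 0) := by
    refine hint.mono' (by fun_prop) (Filter.Eventually.of_forall fun v => ?_)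
    have : 0 < g (φ v) := Real.exp_pos _
    rw [Real.norm_of_nonneg (by positivity)]
    gcongr
    have : 0 ≤ b / v ^ 2 := by positivity
    linarith
  have hint2 : IntegrableOn (fun v => b / v ^ 2 * g (φ v)) (Ioi 0) := by
    refine (hint.sub hint1).congr (Filter.Eventually.of_forall fun v => ?_)
    simp only [Pi.sub_apply]
    ring
  have hsplit : √Real.pi = (∫ v in Ioi (0:ℝ), a * g (φ v)) +
      ∫ v in Ioi (0:ℝ), b / v ^ 2 * g (φ v) := by
    rw [← integral_add hint1 hint2, hI]
    exact integral_congr_ae (Filter.Eventually.of_forall fun v => by simp only [hg]; ring)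
  have hψd : ∀ v ∈ Ioi (0:ℝ),
      HasDerivWithinAt (fun v => b / (a * v)) (-(b / (a * v ^ 2))) (Ioi 0) v := by
    intro v hv
    have hv' : v ≠ 0 := ne_of_gt hv
    have h1 := (hasDerivAt_inv hv').const_mul (b / a)
    refine ((h1.congr_deriv ?_).congr_of_eventuallyEq ?_).hasDerivWithinAt
    · field_simp
    · exact Filter.Eventually.of_forall fun v => by simp only []; field_simp
  have hψinj : InjOn (fun v => b / (a * v)) (Ioi (0:ℝ)) := by
    intro u hu v hv h
    have hu' : u ≠ 0 := ne_of_gt hu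
    have hv' : v ≠ 0 := ne_of_gt hv
    simp only [] at h
    field_simp at h
    exact h.symm
  have hψimg : (fun v => b / (a * v)) '' Ioi (0:ℝ) = Ioi 0 := by
    ext y
    constructor
    · rintro ⟨v, hv, rfl⟩
      have : 0 < v := hv
      exact mem_Ioi.2 (by positivity)
    · intro hy
      have hy' : 0 < y := hy
      exact ⟨b / (a * y), mem_Ioi.2 (by positivity), by field_simp⟩
  have hsymm : ∫ v in Ioi (0:ℝ), a * g (φ v) = ∫ v in Ioi (0:ℝ), b / v ^ 2 * g (φ v) := by
    have h := integral_image_eq_integral_abs_deriv_smul measurableSet_Ioi hψd hψinj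
      (fun v => a * g (φ v))
    rw [hψimg] at h
    rw [h]
    refine setIntegral_congr_fun measurableSet_Ioi fun v hv => ?_
    have hv' : 0 < v := hv
    have h1 : φ (b / (a * v)) = -φ v := by
      simp only [hφ]
      field_simp
      ring
    simp only [h1, smul_eq_mul, abs_neg]
    rw [abs_of_nonneg (by positivity), hg]
    simp only [neg_sq]
    field_simp
  rw [← hsymm, integral_const_mul] at hsplit
  have hfin : ∫ v in Ioi (0:ℝ), Real.exp (-(a * v - b / v) ^ 2) = ∫ v in Ioi (0:ℝ), g (φ v) := by
    simp [hg, hφ]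
  rw [hfin, hsplit]
  field_simp
  ring

/-- The Laplace-type representation of `exp (-x * t)` as a mixture of Gaussians in `t`. -/
theorem exp_neg_mul_eq_integral_Ioi {x t : ℝ} (hx : 0 < x) (ht : 0 < t) :
    Real.exp (-x * t) = t / √Real.pi *
      ∫ v in Ioi (0:ℝ), Real.exp (-(v ^ 2 / 4 * t ^ 2)) * Real.exp (-(x ^ 2 / v ^ 2)) := by
  have h := integral_exp_neg_sq_sub_div_Ioi (half_pos ht) hx
  have h2 : ∫ v in Ioi (0:ℝ), Real.exp (-(v ^ 2 / 4 * t ^ 2)) * Real.exp (-(x ^ 2 / v ^ 2)) =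
      Real.exp (-x * t) * ∫ v in Ioi (0:ℝ), Real.exp (-(t / 2 * v - x / v) ^ 2) := by
    rw [← integral_const_mul]
    refine setIntegral_congr_fun measurableSet_Ioi fun v hv => ?_
    have hv' : v ≠ 0 := ne_of_gt hv
    simp only [← Real.exp_add]
    congr 1
    field_simp
    ring
  have hpi : √Real.pi ≠ 0 := by positivity
  rw [h2, h]
  field_simp

theorem integrableOn_and_integral_rpow_sq_sub_one {p c : ℝ} (hp : 0 < p) (hc : 0 < c) :
    IntegrableOn (fun t => t * (t ^ 2 - 1) ^ (p - 1) * Real.exp (-(c * t ^ 2))) (Ioi (1:ℝ)) ∧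
    ∫ t in Ioi (1:ℝ), t * (t ^ 2 - 1) ^ (p - 1) * Real.exp (-(c * t ^ 2)) =
      Real.exp (-c) / 2 * ((1 / c) ^ p * Real.Gamma p) := by
  set g : ℝ → ℝ := fun w => w ^ (p - 1) * Real.exp (-(c * w)) with hg
  have hd : ∀ t ∈ Ioi (1:ℝ), HasDerivWithinAt (fun t : ℝ => t ^ 2 - 1) (2 * t) (Ioi 1) t := by
    intro t _
    simpa using ((hasDerivAt_pow 2 t).sub_const 1).hasDerivWithinAt
  have hinj : InjOn (fun t : ℝ => t ^ 2 - 1) (Ioi 1) := by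
    intro u hu v hv h
    have hu' : (1:ℝ) < u := hu
    have hv' : (1:ℝ) < v := hv
    simp only [] at h
    nlinarith
  have himg : (fun t : ℝ => t ^ 2 - 1) '' Ioi 1 = Ioi 0 := by
    ext y
    constructor
    · rintro ⟨t, ht, rfl⟩
      have : (1:ℝ) < t := ht
      exact mem_Ioi.2 (by nlinarith)
    · intro hy
      have hy' : 0 < y := hy
      refine ⟨√(y + 1), mem_Ioi.2 ?_, ?_⟩
      · exact Real.lt_sqrt_of_sq_lt (by linarith)
      · simp only [Real.sq_sqrt (by positivity : 0 ≤ y + 1)]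
        ring
  have hgint : IntegrableOn g (Ioi 0) := by
    simpa [hg] using integrableOn_rpow_mul_exp_neg_mul_rpow (s := p - 1) (by linarith) one_pos hc
  have hI := integral_image_eq_integral_abs_deriv_smul measurableSet_Ioi hd hinj g
  have hint := integrableOn_image_iff_integrableOn_abs_deriv_smul measurableSet_Ioi hd hinj g
  rw [himg] at hI hint
  have hcongr : EqOn (fun t => t * (t ^ 2 - 1) ^ (p - 1) * Real.exp (-(c * t ^ 2)))
      (fun t => Real.exp (-c) / 2 * (|2 * t| • g (t ^ 2 - 1))) (Ioi 1) := by
    intro t ht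
    have ht' : (1:ℝ) < t := ht
    have he : Real.exp (-(c * t ^ 2)) = Real.exp (-c) * Real.exp (-(c * (t ^ 2 - 1))) := by
      rw [← Real.exp_add]
      ring_nf
    simp only [hg, smul_eq_mul]
    rw [he, abs_of_pos (by linarith)]
    ring
  refine ⟨?_, ?_⟩
  · exact IntegrableOn.congr_fun ((hint.1 hgint).const_mul _) hcongr.symm measurableSet_Ioi
  · rw [setIntegral_congr_fun measurableSet_Ioi hcongr, integral_const_mul, ← hI, hg,
      Real.integral_rpow_mul_exp_neg_mul_Ioi hp hc]

theorem rpow_neg_two_substitution {ν x v : ℝ} (hv : 0 < v) :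
    (|(-2:ℝ)| * v ^ ((-2:ℝ) - 1)) • ((v ^ (-2:ℝ)) ^ (ν - 1) *
      Real.exp (-(x ^ 2 * v ^ (-2:ℝ))) * Real.exp (-(1 / (4 * v ^ (-2:ℝ))))) =
    2 * (v ^ (-(2 * ν + 1)) * (Real.exp (-(x ^ 2 / v ^ 2)) * Real.exp (-(v ^ 2 / 4)))) := by
  have h1 : v ^ (-2:ℝ) = 1 / v ^ 2 := by
    rw [Real.rpow_neg hv.le, one_div]
    norm_cast
  have h2 : v ^ ((-2:ℝ) - 1) * (v ^ (-2:ℝ)) ^ (ν - 1) = v ^ (-(2 * ν + 1)) := by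
    rw [← Real.rpow_mul hv.le, ← Real.rpow_add hv]
    ring_nf
  have h3 : Real.exp (-(x ^ 2 * v ^ (-2:ℝ))) = Real.exp (-(x ^ 2 / v ^ 2)) := by
    rw [h1, mul_one_div]
  have h4 : Real.exp (-(1 / (4 * v ^ (-2:ℝ)))) = Real.exp (-(v ^ 2 / 4)) := by
    rw [h1]
    congr 2
    field_simp
  rw [h3, h4, ← h2, abs_neg, abs_two, smul_eq_mul]
  ring

theorem integrableOn_rpow_mul_exp_mul_exp {ν x : ℝ} (hν : 0 < ν) (hx : 0 < x) :
    IntegrableOn (fun s : ℝ => s ^ (ν - 1) * Real.exp (-(x ^ 2 * s)) *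
      Real.exp (-(1 / (4 * s)))) (Ioi 0) := by
  have h : IntegrableOn (fun s : ℝ => s ^ (ν - 1) * Real.exp (-(x ^ 2 * s))) (Ioi 0) := by
    simpa using integrableOn_rpow_mul_exp_neg_mul_rpow (s := ν - 1) (by linarith) one_pos
      (sq_pos_of_pos hx)
  refine h.mono' (by fun_prop) ?_
  refine (ae_restrict_mem measurableSet_Ioi).mono fun s hs => ?_
  have hs' : 0 < s := hs
  rw [Real.norm_of_nonneg (by positivity)]
  refine mul_le_of_le_one_right (by positivity) (Real.exp_le_one_iff.2 ?_)
  have : 0 ≤ 1 / (4 * s) := by positivity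
  linarith

theorem integrableOn_rpow_neg_mul_exp_mul_exp {ν x : ℝ} (hν : 0 < ν) (hx : 0 < x) :
    IntegrableOn (fun v : ℝ => v ^ (-(2 * ν + 1)) *
      (Real.exp (-(x ^ 2 / v ^ 2)) * Real.exp (-(v ^ 2 / 4)))) (Ioi 0) := by
  have h := (integrableOn_Ioi_comp_rpow_iff _ (p := -2) (by norm_num)).2
    (integrableOn_rpow_mul_exp_mul_exp hν hx)
  have h2 := IntegrableOn.congr_fun h (fun v hv => rpow_neg_two_substitution hv) measurableSet_Ioi
  refine (h2.const_mul (1 / 2)).congr (Filter.Eventually.of_forall fun v => ?_)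
  simp only []
  ring

theorem integral_rpow_mul_exp_mul_exp (ν x : ℝ) :
    ∫ s in Ioi (0:ℝ), s ^ (ν - 1) * Real.exp (-(x ^ 2 * s)) * Real.exp (-(1 / (4 * s))) =
    2 * ∫ v in Ioi (0:ℝ), v ^ (-(2 * ν + 1)) *
      (Real.exp (-(x ^ 2 / v ^ 2)) * Real.exp (-(v ^ 2 / 4))) := by
  rw [← integral_comp_rpow_Ioi _ (p := -2) (by norm_num), ← integral_const_mul]
  exact setIntegral_congr_fun measurableSet_Ioi fun v hv => rpow_neg_two_substitution hv

theorem integral_exp_mul_rpow_sq_sub_one {ν x : ℝ} (hν : 0 < ν) (hx : 0 < x) :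
    ∫ t in Ioi (1:ℝ), Real.exp (-x * t) * (t ^ 2 - 1) ^ (ν - 1 / 2) =
      Real.Gamma (ν + 1 / 2) * 4 ^ (ν + 1 / 2) / (2 * √Real.pi) *
        ∫ v in Ioi (0:ℝ), v ^ (-(2 * ν + 1)) *
          (Real.exp (-(x ^ 2 / v ^ 2)) * Real.exp (-(v ^ 2 / 4))) := by
  set F : ℝ → ℝ → ℝ := fun v t => Real.exp (-(x ^ 2 / v ^ 2)) *
    (t * (t ^ 2 - 1) ^ (ν + 1 / 2 - 1) * Real.exp (-(v ^ 2 / 4 * t ^ 2))) with hF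
  have hinner : ∀ v ∈ Ioi (0:ℝ), ∫ t in Ioi (1:ℝ), F v t =
      Real.Gamma (ν + 1 / 2) * 4 ^ (ν + 1 / 2) / 2 * (v ^ (-(2 * ν + 1)) *
          (Real.exp (-(x ^ 2 / v ^ 2)) * Real.exp (-(v ^ 2 / 4)))) := by
    intro v hv
    have hv' : 0 < v := hv
    simp only [hF]
    rw [integral_const_mul, (integrableOn_and_integral_rpow_sq_sub_one (p := ν + 1 / 2)
      (by linarith) (by positivity : 0 < v ^ 2 / 4)).2]
    have h1 : (1 / (v ^ 2 / 4)) ^ (ν + 1 / 2) = 4 ^ (ν + 1 / 2) * v ^ (-(2 * ν + 1)) := by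
      rw [one_div_div, Real.div_rpow (by norm_num) (by positivity), ← Real.rpow_natCast v 2,
        ← Real.rpow_mul hv'.le, Real.rpow_neg hv'.le, div_eq_mul_inv]
      push_cast
      ring_nf
    rw [h1]
    ring
  have hFint : Integrable (Function.uncurry F)
      ((volume.restrict (Ioi 0)).prod (volume.restrict (Ioi 1))) := by
    refine (integrable_prod_iff (Measurable.aestronglyMeasurable ?_)).2 ⟨?_, ?_⟩
    · simp only [hF, Function.uncurry_def]
      fun_prop
    · refine (ae_restrict_mem measurableSet_Ioi).mono fun v hv => ?_
      have hv' : 0 < v := hv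
      exact (integrableOn_and_integral_rpow_sq_sub_one (p := ν + 1 / 2)
        (by linarith) (by positivity : 0 < v ^ 2 / 4)).1.const_mul (Real.exp (-(x ^ 2 / v ^ 2)))
    · refine IntegrableOn.congr_fun ((integrableOn_rpow_neg_mul_exp_mul_exp hν hx).const_mul
        (Real.Gamma (ν + 1 / 2) * 4 ^ (ν + 1 / 2) / 2)) (fun v hv => ?_) measurableSet_Ioi
      rw [← hinner v hv]
      refine setIntegral_congr_fun measurableSet_Ioi fun t ht => ?_
      have ht' : (1:ℝ) < t := ht
      have h1 : 0 ≤ t ^ 2 - 1 := by nlinarith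
      have h2 : 0 ≤ F v t := by
        simp only [hF]
        positivity
      exact (Real.norm_of_nonneg h2).symm
  have hswap := integral_integral_swap hFint
  rw [setIntegral_congr_fun measurableSet_Ioi hinner, integral_const_mul] at hswap
  have hL : ∀ t ∈ Ioi (1:ℝ), Real.exp (-x * t) * (t ^ 2 - 1) ^ (ν - 1 / 2) =
      1 / √Real.pi * ∫ v in Ioi (0:ℝ), F v t := by
    intro t ht
    have ht' : (0:ℝ) < t := zero_lt_one.trans ht
    rw [exp_neg_mul_eq_integral_Ioi hx ht', show ν - 1 / 2 = ν + 1 / 2 - 1 by ring]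
    have h1 : ∫ v in Ioi (0:ℝ), F v t = t * (t ^ 2 - 1) ^ (ν + 1 / 2 - 1) *
        ∫ v in Ioi (0:ℝ), Real.exp (-(v ^ 2 / 4 * t ^ 2)) * Real.exp (-(x ^ 2 / v ^ 2)) := by
      rw [← integral_const_mul]
      refine integral_congr_ae (Filter.Eventually.of_forall fun v => ?_)
      simp only [hF]
      ring
    rw [h1]
    ring
  rw [setIntegral_congr_fun measurableSet_Ioi hL, integral_const_mul, ← hswap]
  have hpi : √Real.pi ≠ 0 := by positivity
  field_simp

theorem integral_cos_div_rpow_sq_add_sq {ν x : ℝ} (hν : 0 < ν) (hx : 0 < x) :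
    Real.Gamma (ν + 1 / 2) * ∫ t in Ioi (0:ℝ), Real.cos t / (t ^ 2 + x ^ 2) ^ (ν + 1 / 2) =
      √Real.pi * ∫ v in Ioi (0:ℝ), v ^ (-(2 * ν + 1)) *
          (Real.exp (-(x ^ 2 / v ^ 2)) * Real.exp (-(v ^ 2 / 4))) := by
  set G : ℝ → ℝ → ℝ := fun s t => s ^ (ν + 1 / 2 - 1) * Real.exp (-(x ^ 2 * s)) *
    Real.exp (-(s * t ^ 2)) with hG
  have hpow : ∀ s : ℝ, 0 < s → s ^ (ν + 1 / 2 - 1) * √(Real.pi / s) = √Real.pi * s ^ (ν - 1) := by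
    intro s hs
    rw [Real.sqrt_div Real.pi_pos.le, Real.sqrt_eq_rpow s,
      show ν + 1 / 2 - 1 = (ν - 1) + 1 / 2 by ring, Real.rpow_add hs]
    have : s ^ (1 / 2 : ℝ) ≠ 0 := by positivity
    field_simp
  have hGint : Integrable (Function.uncurry G)
      ((volume.restrict (Ioi 0)).prod (volume.restrict (Ioi 0))) := by
    refine (integrable_prod_iff (Measurable.aestronglyMeasurable ?_)).2 ⟨?_, ?_⟩
    · simp only [hG, Function.uncurry_def]
      fun_prop
    · refine (ae_restrict_mem measurableSet_Ioi).mono fun s hs => ?_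
      simpa [hG] using ((integrable_exp_neg_mul_sq hs).integrableOn (s := Ioi 0)).const_mul
        (s ^ (ν + 1 / 2 - 1) * Real.exp (-(x ^ 2 * s)))
    · have h : IntegrableOn (fun s : ℝ => s ^ (ν - 1) * Real.exp (-(x ^ 2 * s))) (Ioi 0) := by
        simpa using integrableOn_rpow_mul_exp_neg_mul_rpow (s := ν - 1) (by linarith) one_pos
          (sq_pos_of_pos hx)
      refine IntegrableOn.congr_fun (h.const_mul (√Real.pi / 2)) (fun s hs => ?_) measurableSet_Ioi
      have hs' : 0 < s := hs
      have h1 : ∀ t, ‖Function.uncurry G (s, t)‖ =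
          s ^ (ν + 1 / 2 - 1) * Real.exp (-(x ^ 2 * s)) * Real.exp (-s * t ^ 2) := by
        intro t
        rw [Function.uncurry_apply_pair, Real.norm_of_nonneg (by simp only [hG]; positivity)]
        simp only [hG, neg_mul]
      simp only [h1]
      rw [integral_const_mul, integral_gaussian_Ioi]
      linear_combination (-Real.exp (-(x ^ 2 * s)) / 2) * hpow s hs'
  have hFint : Integrable (Function.uncurry fun s t => Real.cos t * G s t)
      ((volume.restrict (Ioi 0)).prod (volume.restrict (Ioi 0))) := by
    refine hGint.bdd_mul (f := fun z : ℝ × ℝ => Real.cos z.2) (c := 1)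
      (Measurable.aestronglyMeasurable (by fun_prop)) (Filter.Eventually.of_forall fun z => ?_)
    exact Real.abs_cos_le_one _
  have hswap := integral_integral_swap hFint
  have hs : ∀ s ∈ Ioi (0:ℝ), ∫ t in Ioi (0:ℝ), Real.cos t * G s t =
      √Real.pi / 2 * (s ^ (ν - 1) * Real.exp (-(x ^ 2 * s)) * Real.exp (-(1 / (4 * s)))) := by
    intro s hs
    have h1 : ∫ t in Ioi (0:ℝ), Real.cos t * G s t = s ^ (ν + 1 / 2 - 1) *
        Real.exp (-(x ^ 2 * s)) * ∫ t in Ioi (0:ℝ), Real.cos t * Real.exp (-(s * t ^ 2)) := by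
      rw [← integral_const_mul]
      refine integral_congr_ae (Filter.Eventually.of_forall fun t => ?_)
      simp only [hG]
      ring
    rw [h1, integral_cos_mul_exp_neg_mul_sq_Ioi hs]
    linear_combination
      (Real.exp (-(x ^ 2 * s)) * Real.exp (-(1 / (4 * s))) / 2) * hpow s hs
  have ht : ∀ t ∈ Ioi (0:ℝ), ∫ s in Ioi (0:ℝ), Real.cos t * G s t =
      Real.Gamma (ν + 1 / 2) * (Real.cos t / (t ^ 2 + x ^ 2) ^ (ν + 1 / 2)) := by
    intro t _
    have hpos : 0 < t ^ 2 + x ^ 2 := by positivity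
    have h1 : ∀ s, G s t = s ^ (ν + 1 / 2 - 1) * Real.exp (-((t ^ 2 + x ^ 2) * s)) := by
      intro s
      simp only [hG]
      rw [mul_assoc, ← Real.exp_add]
      ring_nf
    simp only [h1]
    rw [integral_const_mul, Real.integral_rpow_mul_exp_neg_mul_Ioi (by linarith) hpos,
      Real.div_rpow zero_le_one hpos.le, Real.one_rpow]
    ring
  rw [setIntegral_congr_fun measurableSet_Ioi hs, setIntegral_congr_fun measurableSet_Ioi ht,
    integral_const_mul, integral_const_mul, integral_rpow_mul_exp_mul_exp] at hswap
  rw [← hswap]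
  ring

/-- For every real ν > 0 and every real x > 0, the two classical integral
representations of the modified Bessel function of the second kind agree. -/
theorem bessel_integral_representations_agree (ν x : ℝ) (hν : 0 < ν) (hx : 0 < x) :
    (Real.sqrt Real.pi / Real.Gamma (ν + 1/2)) * (x/2) ^ ν *
      (∫ t in Set.Ioi (1:ℝ), Real.exp (-x * t) * (t^2 - 1) ^ (ν - 1/2)) =
    (2 ^ ν * x ^ ν * Real.Gamma (ν + 1/2) / Real.sqrt Real.pi) *
      (∫ t in Set.Ioi (0:ℝ), Real.cos t / (t^2 + x^2) ^ (ν + 1/2)) := by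
  have hΓ : Real.Gamma (ν + 1 / 2) ≠ 0 := (Real.Gamma_pos_of_pos (by linarith)).ne'
  have hpi : √Real.pi ≠ 0 := by positivity
  have h4 : (4:ℝ) ^ (ν + 1 / 2) = 2 * 2 ^ ν * 2 ^ ν := by
    rw [show (4:ℝ) = 2 ^ (2:ℝ) by norm_num, ← Real.rpow_mul two_pos.le,
      show (2:ℝ) * (ν + 1 / 2) = 1 + ν + ν by ring, Real.rpow_add two_pos,
      Real.rpow_add two_pos, Real.rpow_one]
  have h2 : (2:ℝ) ^ ν ≠ 0 := by positivity
  rw [mul_div_right_comm _ (Real.Gamma _), mul_assoc _ (Real.Gamma _),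
    integral_cos_div_rpow_sq_add_sq hν hx, integral_exp_mul_rpow_sq_sub_one hν hx, h4,
    Real.div_rpow hx.le two_pos.le]
  field_simp
end

section
/- Let ν > 0 be a real number with 2ν not an integer, and let x > 0. Then the exponentially weighted power series T₁(x) := (2^ν x^ν cos(νπ) e^{−x} / √π) · Σ_{n≥0} Γ(ν + 1/2 + n) Γ(−2ν − n) (−2x)^n / n! converges and equals −(π / (2 sin(νπ))) · I_ν(x), where I_ν(x) := Σ_{k≥0} (x/2)^{2k+ν} / (k! Γ(k + ν + 1)) is the modified Bessel function of the first kind. -/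
/-- The coefficient of `x ^ (2 * k)` in the entire function `(x / 2) ^ (-ν) * I_ν(x)`. -/
noncomputable def besselICoeff (ν : ℝ) (k : ℕ) : ℝ :=
  1 / (4 ^ k * k.factorial * Real.Gamma (k + ν + 1))

theorem besselICoeff_pos {ν : ℝ} (hν : 0 < ν) (k : ℕ) : 0 < besselICoeff ν k := by
  have : 0 < Real.Gamma (k + ν + 1) := Real.Gamma_pos_of_pos (by positivity)
  unfold besselICoeff
  positivity

theorem besselICoeff_succ {ν : ℝ} (hν : 0 < ν) (k : ℕ) :
    4 * (k + 1) * (k + 1 + ν) * besselICoeff ν (k + 1) = besselICoeff ν k := by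
  have hpos : (0 : ℝ) < k + ν + 1 := by positivity
  have hG : 0 < Real.Gamma (k + ν + 1) := Real.Gamma_pos_of_pos hpos
  have hrec : Real.Gamma (((k + 1 : ℕ) : ℝ) + ν + 1) = (k + ν + 1) * Real.Gamma (k + ν + 1) := by
    rw [← Real.Gamma_add_one hpos.ne']
    congr 1
    push_cast
    ring
  unfold besselICoeff
  rw [hrec, Nat.factorial_succ, pow_succ]
  push_cast
  field_simp
  ring

theorem besselICoeff_le {ν : ℝ} (hν : 0 < ν) (k : ℕ) :
    besselICoeff ν k ≤ besselICoeff ν 0 / k.factorial := by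
  induction k with
  | zero => simp
  | succ k ih =>
    have hc := besselICoeff_pos hν (k + 1)
    have hrec := besselICoeff_succ hν k
    have hk : (0 : ℝ) ≤ k := k.cast_nonneg
    have hle : ((k : ℝ) + 1) * besselICoeff ν (k + 1) ≤ besselICoeff ν k := by
      rw [← hrec]
      refine mul_le_mul_of_nonneg_right ?_ hc.le
      nlinarith [mul_nonneg hk hk, mul_nonneg hk hν.le]
    rw [Nat.factorial_succ, le_div_iff₀ (by positivity)]
    rw [le_div_iff₀ (by positivity)] at ih
    push_cast
    calc besselICoeff ν (k + 1) * (((k : ℝ) + 1) * k.factorial)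
        = ((k : ℝ) + 1) * besselICoeff ν (k + 1) * k.factorial := by ring
      _ ≤ besselICoeff ν k * k.factorial := by gcongr
      _ ≤ besselICoeff ν 0 := ih

theorem summable_besselICoeff_mul_pow {ν : ℝ} (hν : 0 < ν) (x : ℝ) :
    Summable fun k : ℕ => besselICoeff ν k * x ^ (2 * k) := by
  refine Summable.of_nonneg_of_le (fun k => ?_) (fun k => ?_)
    ((Real.summable_pow_div_factorial (x ^ 2)).mul_left (besselICoeff ν 0))
  · have := besselICoeff_pos hν k
    rw [pow_mul]
    positivity
  · rw [pow_mul, mul_div_assoc', mul_comm (besselICoeff ν 0), mul_div_assoc, mul_comm]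
    exact mul_le_mul_of_nonneg_left (besselICoeff_le hν k) (by positivity)

/-- The power series `∑ k, besselICoeff ν k * X ^ (2 * k)`. -/
noncomputable def besselIPowerSeries (ν : ℝ) : PowerSeries ℝ :=
  PowerSeries.mk fun n => if Even n then besselICoeff ν (n / 2) else 0

theorem coeff_besselIPowerSeries_two_mul (ν : ℝ) (k : ℕ) :
    PowerSeries.coeff (2 * k) (besselIPowerSeries ν) = besselICoeff ν k := by
  simp [besselIPowerSeries]

theorem coeff_besselIPowerSeries_of_not_even (ν : ℝ) {n : ℕ} (hn : ¬Even n) :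
    PowerSeries.coeff n (besselIPowerSeries ν) = 0 := by
  simp [besselIPowerSeries, hn]

theorem coeff_besselIPowerSeries_add_two {ν : ℝ} (hν : 0 < ν) (n : ℕ) :
    ((n : ℝ) + 2) * (n + 2 + 2 * ν) * PowerSeries.coeff (n + 2) (besselIPowerSeries ν) =
      PowerSeries.coeff n (besselIPowerSeries ν) := by
  by_cases hn : Even n
  · obtain ⟨k, rfl⟩ := hn.exists_two_nsmul
    rw [smul_eq_mul, show 2 * k + 2 = 2 * (k + 1) by ring, coeff_besselIPowerSeries_two_mul,
      coeff_besselIPowerSeries_two_mul, ← besselICoeff_succ hν k]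
    push_cast
    ring
  · rw [coeff_besselIPowerSeries_of_not_even ν hn,
      coeff_besselIPowerSeries_of_not_even ν (by simpa [Nat.even_add] using hn), mul_zero]

open PowerSeries in
theorem besselIPowerSeries_ode {ν : ℝ} (hν : 0 < ν) :
    X * d⁄dX ℝ (d⁄dX ℝ (besselIPowerSeries ν)) + C (2 * ν + 1) * d⁄dX ℝ (besselIPowerSeries ν) =
      X * besselIPowerSeries ν := by
  ext n
  rcases n with _ | n
  · have h1 : coeff 1 (besselIPowerSeries ν) = 0 :=
      coeff_besselIPowerSeries_of_not_even ν (by decide)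
    rw [map_add, coeff_zero_X_mul, coeff_zero_X_mul, coeff_C_mul, coeff_derivative, h1]
    simp
  · rw [map_add, coeff_succ_X_mul, coeff_succ_X_mul, coeff_C_mul, coeff_derivative,
      coeff_derivative, ← coeff_besselIPowerSeries_add_two hν n]
    push_cast
    ring

open PowerSeries in
/-- Multiplying by `exp` turns the Bessel equation into the Kummer equation. -/
theorem besselIPowerSeries_mul_exp_ode {ν : ℝ} (hν : 0 < ν) :
    X * d⁄dX ℝ (d⁄dX ℝ (besselIPowerSeries ν * exp ℝ)) +
        C (2 * ν + 1) * d⁄dX ℝ (besselIPowerSeries ν * exp ℝ) =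
      C 2 * (X * d⁄dX ℝ (besselIPowerSeries ν * exp ℝ)) +
        C (2 * ν + 1) * (besselIPowerSeries ν * exp ℝ) := by
  have hexp : d⁄dX ℝ (exp ℝ) = exp ℝ := by
    ext n
    rw [coeff_derivative, coeff_exp, coeff_exp, Nat.factorial_succ]
    simp
    field_simp
  have h2 : (C (2 : ℝ) : PowerSeries ℝ) = 2 := map_ofNat C 2
  simp only [Derivation.leibniz, map_add, smul_eq_mul, hexp, h2]
  simp only [← map_add]
  linear_combination exp ℝ * besselIPowerSeries_ode hν

open PowerSeries in
theorem coeff_besselIPowerSeries_mul_exp_succ {ν : ℝ} (hν : 0 < ν) (n : ℕ) :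
    ((n : ℝ) + 1) * (n + 2 * ν + 1) * coeff (n + 1) (besselIPowerSeries ν * exp ℝ) =
      (2 * n + 2 * ν + 1) * coeff n (besselIPowerSeries ν * exp ℝ) := by
  have h := congrArg (coeff n) (besselIPowerSeries_mul_exp_ode hν)
  rw [LinearMap.map_add, LinearMap.map_add, coeff_C_mul, coeff_C_mul, coeff_C_mul, coeff_derivative] at h
  rcases n with _ | n
  · rw [coeff_zero_X_mul, coeff_zero_X_mul] at h
    push_cast at h ⊢
    linear_combination h
  · rw [coeff_succ_X_mul, coeff_succ_X_mul, coeff_derivative, coeff_derivative,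
      coeff_derivative] at h
    push_cast at h ⊢
    linear_combination h

open PowerSeries in
theorem Gamma_div_Gamma_eq_coeff {ν : ℝ} (hν : 0 < ν) (n : ℕ) :
    Real.Gamma (ν + 1 / 2 + n) / Real.Gamma (2 * ν + 1 + n) * 2 ^ n / n.factorial =
      2 ^ (-(2 * ν)) * Real.sqrt Real.pi * coeff n (besselIPowerSeries ν * exp ℝ) := by
  induction n with
  | zero =>
    have hG1 : 0 < Real.Gamma (ν + 1) := Real.Gamma_pos_of_pos (by positivity)
    have hG2 : 0 < Real.Gamma (2 * ν + 1) := Real.Gamma_pos_of_pos (by positivity)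
    have hdup := Real.Gamma_mul_Gamma_add_half (ν + 1 / 2)
    rw [show ν + 1 / 2 + 1 / 2 = ν + 1 by ring, show 2 * (ν + 1 / 2) = 2 * ν + 1 by ring,
      show 1 - (2 * ν + 1) = -(2 * ν) by ring] at hdup
    have hc : coeff 0 (besselIPowerSeries ν * exp ℝ) = 1 / Real.Gamma (ν + 1) := by
      simp [coeff_mul, besselIPowerSeries, besselICoeff]
    rw [hc]
    simp only [Nat.cast_zero, add_zero, pow_zero, mul_one, Nat.factorial_zero, Nat.cast_one,
      div_one]
    rw [div_eq_iff hG2.ne', mul_one_div, div_mul_eq_mul_div, eq_div_iff hG1.ne']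
    linear_combination hdup
  | succ n ih =>
    have ha : (0 : ℝ) < ν + 1 / 2 + n := by positivity
    have hb : (0 : ℝ) < 2 * ν + 1 + n := by positivity
    have hG2 : 0 < Real.Gamma (2 * ν + 1 + n) := Real.Gamma_pos_of_pos hb
    have hrec := coeff_besselIPowerSeries_mul_exp_succ hν n
    have hne : ((n : ℝ) + 1) * (n + 2 * ν + 1) ≠ 0 := by positivity
    have hstep : Real.Gamma (ν + 1 / 2 + (n + 1 : ℕ)) / Real.Gamma (2 * ν + 1 + (n + 1 : ℕ)) *
          2 ^ (n + 1) / (n + 1).factorial * (((n : ℝ) + 1) * (n + 2 * ν + 1)) =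
        (2 * n + 2 * ν + 1) *
          (Real.Gamma (ν + 1 / 2 + n) / Real.Gamma (2 * ν + 1 + n) * 2 ^ n / n.factorial) := by
      push_cast
      rw [← add_assoc, ← add_assoc, Real.Gamma_add_one ha.ne', Real.Gamma_add_one hb.ne',
        Nat.factorial_succ, pow_succ]
      push_cast
      field_simp
      ring
    apply mul_right_cancel₀ hne
    rw [hstep, ih]
    linear_combination (-(2 ^ (-(2 * ν)) * Real.sqrt Real.pi)) * hrec

theorem hasSum_coeff_besselIPowerSeries {ν : ℝ} (hν : 0 < ν) (x : ℝ) :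
    HasSum (fun n => PowerSeries.coeff n (besselIPowerSeries ν) * x ^ n)
      (∑' k, besselICoeff ν k * x ^ (2 * k)) := by
  have hinj : Function.Injective fun k : ℕ => 2 * k := fun a b h => by simpa using h
  rw [← hinj.hasSum_iff]
  · simpa only [Function.comp_def, coeff_besselIPowerSeries_two_mul] using
      (summable_besselICoeff_mul_pow hν x).hasSum
  · intro n hn
    rw [coeff_besselIPowerSeries_of_not_even, zero_mul]
    rintro ⟨k, rfl⟩
    exact hn ⟨k, two_mul k⟩

theorem hasSum_coeff_besselIPowerSeries_mul_exp {ν : ℝ} (hν : 0 < ν) (x : ℝ) :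
    HasSum (fun n => PowerSeries.coeff n (besselIPowerSeries ν * PowerSeries.exp ℝ) * x ^ n)
      ((∑' k, besselICoeff ν k * x ^ (2 * k)) * Real.exp x) := by
  have hf := hasSum_coeff_besselIPowerSeries hν x
  have hfn := hf.summable.norm
  have hgn : Summable fun n : ℕ => ‖x ^ n / (n.factorial : ℝ)‖ :=
    (Real.summable_pow_div_factorial x).norm
  have hexp : Real.exp x = ∑' n : ℕ, x ^ n / (n.factorial : ℝ) := by
    rw [Real.exp_eq_exp_ℝ, NormedSpace.exp_eq_tsum_div]
  have hterm : (fun n => PowerSeries.coeff n (besselIPowerSeries ν * PowerSeries.exp ℝ) * x ^ n) =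
      fun n => ∑ p ∈ Finset.HasAntidiagonal.antidiagonal n,
        PowerSeries.coeff p.1 (besselIPowerSeries ν) * x ^ p.1 *
          (x ^ p.2 / (p.2.factorial : ℝ)) := by
    funext n
    rw [PowerSeries.coeff_mul, Finset.sum_mul]
    refine Finset.sum_congr rfl fun p hp => ?_
    rw [← Finset.HasAntidiagonal.mem_antidiagonal.mp hp, PowerSeries.coeff_exp, pow_add]
    simp
    ring
  rw [hterm, ← hf.tsum_eq, hexp, tsum_mul_tsum_eq_tsum_sum_antidiagonal_of_summable_norm hfn hgn]
  exact (summable_norm_sum_mul_antidiagonal_of_summable_norm hfn hgn).of_norm.hasSum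

theorem Gamma_neg_two_mul_sub {ν : ℝ} (hν : 0 < ν) (n : ℕ) :
    Real.Gamma (-2 * ν - n) =
      -(Real.pi / Real.sin (2 * (ν * Real.pi))) * (-1) ^ n / Real.Gamma (2 * ν + 1 + n) := by
  have hG : 0 < Real.Gamma (2 * ν + 1 + n) := Real.Gamma_pos_of_pos (by positivity)
  have hrefl := Real.Gamma_mul_Gamma_one_sub (2 * ν + 1 + n)
  have hsin : Real.sin (Real.pi * (2 * ν + 1 + n)) =
      -((-1) ^ n * Real.sin (2 * (ν * Real.pi))) := by
    rw [show Real.pi * (2 * ν + 1 + n) = 2 * (ν * Real.pi) + ((n + 1 : ℕ) : ℝ) * Real.pi by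
      push_cast; ring, Real.sin_add_nat_mul_pi, pow_succ]
    ring
  rw [show 1 - (2 * ν + 1 + n) = -2 * ν - n by ring, hsin] at hrefl
  rw [eq_div_iff hG.ne', mul_comm, hrefl]
  rcases neg_one_pow_eq_or ℝ n with h | h <;> rw [h] <;> simp [div_neg]

theorem sin_two_mul_mul_pi_ne_zero {ν : ℝ} (h2ν : ∀ m : ℤ, 2 * ν ≠ (m : ℝ)) :
    Real.sin (2 * (ν * Real.pi)) ≠ 0 := by
  rw [Real.sin_ne_zero_iff]
  intro m hm
  apply h2ν m
  apply mul_right_cancel₀ Real.pi_ne_zero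
  linarith

/-- For ν > 0 with 2ν not an integer and x > 0, the exponentially weighted
power series T₁(x) converges and equals −(π / (2 sin(νπ))) · I_ν(x), where I_ν is the
modified Bessel function of the first kind given by its everywhere-convergent series. -/
theorem T1_eq_bessel_I (ν x : ℝ) (hν : 0 < ν) (h2ν : ∀ m : ℤ, 2 * ν ≠ (m : ℝ))
    (hx : 0 < x) :
    Summable (fun n : ℕ =>
      Real.Gamma (ν + 1/2 + n) * Real.Gamma (-2*ν - n) * (-2*x)^n / n.factorial) ∧
    (2 ^ ν * x ^ ν * Real.cos (ν * Real.pi) * Real.exp (-x) / Real.sqrt Real.pi) *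
      (∑' n : ℕ,
        Real.Gamma (ν + 1/2 + n) * Real.Gamma (-2*ν - n) * (-2*x)^n / n.factorial) =
    -(Real.pi / (2 * Real.sin (ν * Real.pi))) *
      (∑' k : ℕ, (x/2) ^ (2*(k:ℝ) + ν) / (k.factorial * Real.Gamma (k + ν + 1))) := by
  have hsum : HasSum (fun n : ℕ =>
      Real.Gamma (ν + 1/2 + n) * Real.Gamma (-2*ν - n) * (-2*x)^n / n.factorial)
      (-(Real.pi / Real.sin (2 * (ν * Real.pi))) * (2 ^ (-(2 * ν)) * Real.sqrt Real.pi) *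
        ((∑' k, besselICoeff ν k * x ^ (2 * k)) * Real.exp x)) := by
    refine ((hasSum_coeff_besselIPowerSeries_mul_exp hν x).mul_left
      (-(Real.pi / Real.sin (2 * (ν * Real.pi))) *
        (2 ^ (-(2 * ν)) * Real.sqrt Real.pi))).congr_fun fun n => ?_
    have hsq : ((-1 : ℝ) ^ n) * (-1) ^ n = 1 := by rw [← mul_pow]; simp
    have hpow : (-2 * x) ^ n = (-1) ^ n * 2 ^ n * x ^ n := by
      rw [← mul_pow, ← mul_pow]; ring
    rw [Gamma_neg_two_mul_sub hν, hpow]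
    linear_combination (-(Real.pi / Real.sin (2 * (ν * Real.pi))) * x ^ n) *
        Gamma_div_Gamma_eq_coeff hν n -
      (Real.Gamma (ν + 1 / 2 + n) / Real.Gamma (2 * ν + 1 + n) * 2 ^ n / n.factorial) *
        (Real.pi / Real.sin (2 * (ν * Real.pi))) * x ^ n * hsq
  refine ⟨hsum.summable, ?_⟩
  have hI : ∀ k : ℕ, (x/2) ^ (2*(k:ℝ) + ν) / (k.factorial * Real.Gamma (k + ν + 1)) =
      (x / 2) ^ ν * (besselICoeff ν k * x ^ (2 * k)) := by
    intro k
    have h4 : (2 : ℝ) ^ (2 * k) = 4 ^ k := by rw [pow_mul]; norm_num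
    rw [Real.rpow_add (by positivity), show 2 * (k : ℝ) = ((2 * k : ℕ) : ℝ) by push_cast; ring,
      Real.rpow_natCast, div_pow, h4, besselICoeff]
    field_simp
  have hsin2 := sin_two_mul_mul_pi_ne_zero h2ν
  rw [Real.sin_two_mul] at hsin2
  have hcos : Real.cos (ν * Real.pi) ≠ 0 := right_ne_zero_of_mul hsin2
  have hsin : Real.sin (ν * Real.pi) ≠ 0 := right_ne_zero_of_mul (left_ne_zero_of_mul hsin2)
  have hpi : Real.sqrt Real.pi ≠ 0 := (Real.sqrt_pos.mpr Real.pi_pos).ne'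
  have h2 : (0 : ℝ) < 2 ^ ν := by positivity
  rw [hsum.tsum_eq, tsum_congr hI, tsum_mul_left, Real.sin_two_mul,
    Real.div_rpow hx.le zero_le_two, Real.rpow_neg zero_le_two, two_mul ν,
    Real.rpow_add two_pos, Real.exp_neg]
  have hexp := Real.exp_ne_zero x
  field_simp
end

section
/- Let ν > 0 be a real number with 2ν not an integer, and let x > 0. Then K_ν(x) = (cos(νπ) e^{−x} / √π) · [ 2^ν x^ν Σ_{n≥0} Γ(ν + 1/2 + n) Γ(−2ν − n) (−2x)^n / n! + 2^{−ν} x^{−ν} Σ_{n≥0} Γ(−ν + 1/2 + n) Γ(2ν − n) (−2x)^n / n! ], where both series converge absolutely. -/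
/-- The modified Bessel function of the second kind, for ν > −1/2 and x > 0, defined by
K_ν(x) = (√π / Γ(ν + 1/2)) (x/2)^ν ∫₁^∞ e^{−x t} (t² − 1)^{ν − 1/2} dt. -/
noncomputable def besselK (ν x : ℝ) : ℝ :=
  (Real.sqrt Real.pi / Real.Gamma (ν + 1/2)) * (x/2) ^ ν *
    ∫ t in Set.Ioi (1:ℝ), Real.exp (-x * t) * (t^2 - 1) ^ (ν - 1/2)

namespace Kummer

open Set Filter Topology MeasureTheory

/-- The coefficients of the Gamma-normalised Kummer series, proportional to `(a)ₙ / ((b)ₙ n!)`. -/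
noncomputable def coeff (a b : ℝ) (n : ℕ) : ℝ :=
  Real.Gamma (a + n) * Real.Gamma (1 - b - n) * (-1) ^ n / n.factorial

/-- The Kummer function `₁F₁(a; b; z)`, multiplied by `Γ(a) Γ(1 - b)`. -/
noncomputable def series (a b z : ℝ) : ℝ := ∑' n : ℕ, coeff a b n * z ^ n

lemma coeff_succ_shift (a b : ℝ) (n : ℕ) :
    (n + 1) * coeff a b (n + 1) = -coeff (a + 1) (b + 1) n := by
  have hn : (n.factorial : ℝ) ≠ 0 := by positivity
  have hn1 : (n + 1 : ℝ) ≠ 0 := by positivity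
  have h1 : a + ((n + 1 : ℕ) : ℝ) = a + 1 + n := by push_cast; ring
  have h2 : 1 - b - ((n + 1 : ℕ) : ℝ) = 1 - (b + 1) - n := by push_cast; ring
  unfold coeff
  rw [h1, h2, Nat.factorial_succ]
  push_cast
  field_simp
  ring

lemma coeff_succ {a b : ℝ} {n : ℕ} (ha : a + n ≠ 0) (hb : b + n ≠ 0) :
    (n + 1) * (b + n) * coeff a b (n + 1) = (a + n) * coeff a b n := by
  have hn : (n.factorial : ℝ) ≠ 0 := by positivity
  have hn1 : (n + 1 : ℝ) ≠ 0 := by positivity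
  have h1 : Real.Gamma (a + ((n + 1 : ℕ) : ℝ)) = (a + n) * Real.Gamma (a + n) := by
    rw [← Real.Gamma_add_one ha]; push_cast; ring_nf
  have h2 : Real.Gamma (1 - b - n) = -(b + n) * Real.Gamma (1 - b - ((n + 1 : ℕ) : ℝ)) := by
    have := Real.Gamma_add_one (s := 1 - b - ((n + 1 : ℕ) : ℝ))
      (by push_cast; intro h; apply hb; linarith)
    rw [show 1 - b - (n : ℝ) = 1 - b - ((n + 1 : ℕ) : ℝ) + 1 by push_cast; ring, this]
    push_cast; ring
  unfold coeff
  rw [h1, h2, Nat.factorial_succ]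
  push_cast
  field_simp
  ring

lemma summable_coeff {a b : ℝ} (ha : ∀ n : ℕ, a + n ≠ 0) (hb : ∀ n : ℕ, b + n ≠ 0) (z : ℝ) :
    Summable fun n => coeff a b n * z ^ n := by
  have hratio : ∀ n : ℕ, coeff a b (n + 1) * z ^ (n + 1) =
      (a + n) / (b + n) * (z / (n + 1)) * (coeff a b n * z ^ n) := by
    intro n
    have := coeff_succ (ha n) (hb n)
    have hn1 : (n + 1 : ℝ) ≠ 0 := by positivity
    have hbn := hb n
    field_simp
    rw [pow_succ]
    linear_combination (z ^ n * z) * this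
  have hlim : Tendsto (fun n : ℕ => (a + n) / (b + n) * (z / (n + 1))) atTop (𝓝 0) := by
    have h1 : Tendsto (fun n : ℕ => (a + 1 * n) / (b + 1 * n)) atTop (𝓝 (1 / 1)) :=
      tendsto_add_mul_div_add_mul_atTop_nhds a b 1 one_ne_zero
    have h2 : Tendsto (fun n : ℕ => z / ((n : ℝ) + 1)) atTop (𝓝 0) :=
      tendsto_const_nhds.div_atTop
        (tendsto_atTop_add_const_right _ _ tendsto_natCast_atTop_atTop)
    simpa using h1.mul h2
  refine summable_of_ratio_norm_eventually_le (r := 1 / 2) (by norm_num) ?_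
  have : ∀ᶠ n : ℕ in atTop, ‖(a + n) / (b + n) * (z / (n + 1))‖ < 1 / 2 := by
    have := hlim.norm
    rw [norm_zero] at this
    exact this.eventually_lt_const (by norm_num)
  filter_upwards [this] with n hn
  rw [hratio n, norm_mul]
  gcongr

lemma hasDerivAt_tsum_pow {c : ℕ → ℝ} (hc : ∀ r : ℝ, Summable fun n => c n * r ^ n) (z : ℝ) :
    HasDerivAt (fun z => ∑' n, c n * z ^ n) (∑' n : ℕ, (n + 1) * c (n + 1) * z ^ n) z := by
  set R : ℝ := |z| + 1 with hR
  have hR1 : 1 ≤ R := by simp [hR]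
  have hu : Summable fun n : ℕ => |c n * (2 * R) ^ n| := (hc (2 * R)).abs
  have hbd : ∀ (n : ℕ) (y : ℝ), y ∈ Metric.ball (0 : ℝ) R →
      ‖c n * (n * y ^ (n - 1))‖ ≤ |c n * (2 * R) ^ n| := by
    intro n y hy
    rw [mem_ball_zero_iff, Real.norm_eq_abs] at hy
    rw [Real.norm_eq_abs, abs_mul, abs_mul, abs_mul, abs_pow, mul_pow, abs_mul, Nat.abs_cast,
      abs_of_pos (by positivity : (0 : ℝ) < 2 ^ n), abs_of_pos (by positivity : 0 < R ^ n)]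
    have h1 : (n : ℝ) ≤ 2 ^ n := by exact_mod_cast Nat.lt_two_pow_self.le
    have h2 : |y| ^ (n - 1) ≤ R ^ n :=
      (pow_le_pow_left₀ (abs_nonneg _) hy.le _).trans (pow_le_pow_right₀ hR1 (Nat.sub_le _ _))
    gcongr
  have hz : z ∈ Metric.ball (0 : ℝ) R := by
    rw [mem_ball_zero_iff, Real.norm_eq_abs]; linarith
  have key := hasDerivAt_tsum_of_isPreconnected (g := fun n y => c n * y ^ n)
    (g' := fun (n : ℕ) y => c n * (n * y ^ (n - 1))) hu Metric.isOpen_ball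
    (convex_ball (0 : ℝ) R).isPreconnected (fun n y _ => (hasDerivAt_pow n y).const_mul _) hbd hz
    (hc z) hz
  have hs : Summable fun n : ℕ => c n * (n * z ^ (n - 1)) :=
    Summable.of_norm_bounded hu fun n => hbd n z hz
  suffices h : ∑' n : ℕ, (n + 1) * c (n + 1) * z ^ n = ∑' n : ℕ, c n * (n * z ^ (n - 1)) by
    rw [h]
    exact key
  rw [hs.tsum_eq_zero_add, Nat.cast_zero, zero_mul, mul_zero, zero_add]
  refine tsum_congr fun n => ?_
  rw [Nat.add_sub_cancel]
  push_cast
  ring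

/-- Multiplying a power series by the variable shifts its coefficients. -/
lemma mul_hasSum_pow {c d : ℕ → ℝ} {z S : ℝ} (h : HasSum (fun n => c n * z ^ n) S)
    (h0 : d 0 = 0) (hd : ∀ n, d (n + 1) = c n) : HasSum (fun n => d n * z ^ n) (z * S) := by
  rw [← hasSum_nat_add_iff' 1]
  simp only [Finset.range_one, Finset.sum_singleton, h0, zero_mul, sub_zero]
  exact (h.mul_left z).congr_fun fun n => by rw [hd, pow_succ]; ring

lemma add_one_ne {a : ℝ} (ha : ∀ n : ℕ, a + n ≠ 0) (n : ℕ) : a + 1 + n ≠ 0 := by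
  have := ha (n + 1)
  push_cast at this
  rwa [add_assoc, add_comm (1 : ℝ)]

lemma hasSum_series {a b : ℝ} (ha : ∀ n : ℕ, a + n ≠ 0) (hb : ∀ n : ℕ, b + n ≠ 0) (z : ℝ) :
    HasSum (fun n => coeff a b n * z ^ n) (series a b z) :=
  (summable_coeff ha hb z).hasSum

lemma hasDerivAt_series {a b : ℝ} (ha : ∀ n : ℕ, a + n ≠ 0) (hb : ∀ n : ℕ, b + n ≠ 0) (z : ℝ) :
    HasDerivAt (series a b) (-series (a + 1) (b + 1) z) z := by
  have key := hasDerivAt_tsum_pow (summable_coeff ha hb) z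
  simp only [coeff_succ_shift, neg_mul, tsum_neg] at key
  exact key

lemma series_zero (a b : ℝ) : series a b 0 = Real.Gamma a * Real.Gamma (1 - b) := by
  rw [series, tsum_eq_single 0]
  · simp [coeff]
  · intro n hn
    simp [hn]

/-- Kummer's differential equation, in contiguous form. -/
lemma series_ode {a b : ℝ} (ha : ∀ n : ℕ, a + n ≠ 0) (hb : ∀ n : ℕ, b + n ≠ 0) (z : ℝ) :
    z * series (a + 1 + 1) (b + 1 + 1) z - (b - z) * series (a + 1) (b + 1) z
      - a * series a b z = 0 := by
  have h0 := hasSum_series ha hb z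
  have h1 := hasSum_series (add_one_ne ha) (add_one_ne hb) z
  have h2 := hasSum_series (add_one_ne (add_one_ne ha)) (add_one_ne (add_one_ne hb)) z
  have k1 := mul_hasSum_pow (d := fun n => -(n * coeff a b n)) h1 (by simp)
    (fun n => by push_cast; rw [coeff_succ_shift]; ring)
  have k2 := mul_hasSum_pow (d := fun n => -(n * coeff (a + 1) (b + 1) n)) h2 (by simp)
    (fun n => by push_cast; rw [coeff_succ_shift]; ring)
  have key := ((k2.sub (h1.mul_left b)).add k1).sub (h0.mul_left a)
  have : HasSum (fun _ : ℕ => (0 : ℝ)) _ := key.congr_fun fun n => by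
    have e1 := coeff_succ_shift a b n
    have e2 := coeff_succ (ha n) (hb n)
    linear_combination (-z ^ n) * e2 + (z ^ n * (b + n)) * e1
  have := this.unique hasSum_zero
  linear_combination this

lemma coeff_mul_coeff_zero_pos {a b : ℝ} (ha : 0 < a) (hb : 0 < b) (hb0 : coeff a b 0 ≠ 0)
    (n : ℕ) : 0 < coeff a b 0 * coeff a b n := by
  induction n with
  | zero => exact mul_self_pos.mpr hb0
  | succ n ih =>
    have h := coeff_succ (a := a) (b := b) (n := n) (by positivity) (by positivity)
    have h1 : (0 : ℝ) < (n + 1) * (b + n) := by positivity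
    have h2 : 0 < a + n := by positivity
    have : ((n + 1) * (b + n)) * (coeff a b 0 * coeff a b (n + 1)) =
        (a + n) * (coeff a b 0 * coeff a b n) := by linear_combination coeff a b 0 * h
    exact pos_of_mul_pos_right (this ▸ mul_pos h2 ih) h1.le

lemma series_ne_zero {a b z : ℝ} (ha : 0 < a) (hb : 0 < b) (hz : 0 < z) (hb0 : coeff a b 0 ≠ 0) :
    series a b z ≠ 0 := by
  have h := (hasSum_series (a := a) (b := b) (fun n => by positivity) (fun n => by positivity)
    z).mul_left (coeff a b 0)
  have hpos : ∀ n, 0 < coeff a b 0 * (coeff a b n * z ^ n) := fun n => by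
    rw [← mul_assoc]
    exact mul_pos (coeff_mul_coeff_zero_pos ha hb hb0 n) (by positivity)
  have := h.summable.tsum_pos (fun n => (hpos n).le) 0 (hpos 0)
  rw [h.tsum_eq] at this
  exact right_ne_zero_of_mul this.ne'

/-- The integral `Γ(p) U(p, p + q, z)` of Tricomi's confluent hypergeometric function. -/
noncomputable def tricomiIntegral (p q z : ℝ) : ℝ :=
  ∫ u in Ioi (0 : ℝ), Real.exp (-z * u) * u ^ (p - 1) * (1 + u) ^ (q - 1)

lemma exists_one_add_rpow_le (q : ℝ) {ε : ℝ} (hε : 0 < ε) :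
    ∃ C, 0 < C ∧ ∀ u, 0 ≤ u → (1 + u) ^ q ≤ C * Real.exp (ε * u) := by
  obtain ⟨m, hm⟩ := exists_nat_ge q
  refine ⟨m.factorial / ε ^ m * Real.exp ε, by positivity, fun u hu => ?_⟩
  have h1 : (1 + u) ^ q ≤ (1 + u) ^ m := by
    rw [← Real.rpow_natCast]
    exact Real.rpow_le_rpow_of_exponent_le (by linarith) hm
  have h2 := Real.pow_div_factorial_le_exp (ε * (1 + u)) (by positivity) m
  rw [mul_pow, div_le_iff₀ (by positivity), mul_add, mul_one, Real.exp_add] at h2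
  refine h1.trans ?_
  rw [div_mul_eq_mul_div, div_mul_eq_mul_div, le_div_iff₀ (by positivity)]
  linarith

lemma measurable_tricomi (p q z : ℝ) :
    Measurable fun u : ℝ => Real.exp (-z * u) * u ^ (p - 1) * (1 + u) ^ (q - 1) := by
  fun_prop

lemma integrableOn_tricomi {p z : ℝ} (q : ℝ) (hp : 0 < p) (hz : 0 < z) :
    IntegrableOn (fun u : ℝ => Real.exp (-z * u) * u ^ (p - 1) * (1 + u) ^ (q - 1)) (Ioi 0) := by
  obtain ⟨C, hC, hb⟩ := exists_one_add_rpow_le (q - 1) (half_pos hz)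
  have h := (integrableOn_rpow_mul_exp_neg_mul_rpow (s := p - 1) (p := 1) (b := z / 2)
    (by linarith) one_pos (half_pos hz)).const_mul C
  refine Integrable.mono' h (measurable_tricomi p q z).aestronglyMeasurable ?_
  refine (ae_restrict_iff' measurableSet_Ioi).mpr (.of_forall fun u (hu : 0 < u) => ?_)
  rw [Real.norm_of_nonneg (by positivity), Real.rpow_one]
  calc Real.exp (-z * u) * u ^ (p - 1) * (1 + u) ^ (q - 1)
      ≤ Real.exp (-z * u) * u ^ (p - 1) * (C * Real.exp (z / 2 * u)) := by
        gcongr; exact hb u hu.le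
    _ = C * (u ^ (p - 1) * (Real.exp (-z * u) * Real.exp (z / 2 * u))) := by ring
    _ = _ := by rw [← Real.exp_add]; ring_nf

lemma hasDerivAt_tricomiIntegral {p z : ℝ} (q : ℝ) (hp : 0 < p) (hz : 0 < z) :
    HasDerivAt (tricomiIntegral p q) (-tricomiIntegral (p + 1) q z) z := by
  have key := (hasDerivAt_integral_of_dominated_loc_of_deriv_le
    (μ := volume.restrict (Ioi (0 : ℝ))) (s := Ioi (z / 2)) (x₀ := z)
    (F := fun z u => Real.exp (-z * u) * u ^ (p - 1) * (1 + u) ^ (q - 1))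
    (F' := fun z u => -(Real.exp (-z * u) * u ^ (p + 1 - 1) * (1 + u) ^ (q - 1)))
    (bound := fun u => Real.exp (-(z / 2) * u) * u ^ (p + 1 - 1) * (1 + u) ^ (q - 1))
    (Ioi_mem_nhds (by linarith))
    (.of_forall fun y => (measurable_tricomi p q y).aestronglyMeasurable)
    (integrableOn_tricomi q hp hz) (measurable_tricomi (p + 1) q z).neg.aestronglyMeasurable
    ?_ (integrableOn_tricomi q (by linarith) (by linarith)) ?_).2
  · rw [integral_neg] at key
    exact key
  · refine (ae_restrict_iff' measurableSet_Ioi).mpr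
      (.of_forall fun u (hu : 0 < u) y (hy : z / 2 < y) => ?_)
    rw [norm_neg, Real.norm_of_nonneg (by positivity)]
    gcongr
  · refine (ae_restrict_iff' measurableSet_Ioi).mpr
      (.of_forall fun u (hu : 0 < u) y (hy : z / 2 < y) => ?_)
    have h1 : HasDerivAt (fun y : ℝ => Real.exp (-y * u)) (Real.exp (-y * u) * (-1 * u)) y :=
      ((hasDerivAt_neg y).mul_const u).exp
    have h2 : u ^ (p + 1 - 1) = u ^ (p - 1) * u := by
      rw [← Real.rpow_add_one hu.ne']; ring_nf
    refine ((h1.mul_const (u ^ (p - 1))).mul_const ((1 + u) ^ (q - 1))).congr_deriv ?_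
    rw [h2]
    ring

lemma tricomiIntegral_add_one_right {p z : ℝ} (q : ℝ) (hp : 0 < p) (hz : 0 < z) :
    tricomiIntegral p (q + 1) z = tricomiIntegral p q z + tricomiIntegral (p + 1) q z := by
  unfold tricomiIntegral
  rw [← integral_add (integrableOn_tricomi q hp hz)
    (integrableOn_tricomi q (by linarith) hz)]
  refine setIntegral_congr_fun measurableSet_Ioi fun u (hu : 0 < u) => ?_
  have h1 : u ^ (p + 1 - 1) = u ^ (p - 1) * u := by
    rw [← Real.rpow_add_one hu.ne']; ring_nf
  have h2 : (1 + u) ^ (q + 1 - 1) = (1 + u) ^ (q - 1) * (1 + u) := by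
    rw [← Real.rpow_add_one (by positivity)]; ring_nf
  simp only [h1, h2]
  ring

/-- Integration by parts. -/
lemma mul_tricomiIntegral {p z : ℝ} (q : ℝ) (hp : 0 < p) (hz : 0 < z) :
    z * tricomiIntegral (p + 1) (q + 1) z =
      p * tricomiIntegral p (q + 1) z + q * tricomiIntegral (p + 1) q z := by
  set f : ℝ → ℝ := fun u => Real.exp (-z * u) * u ^ p * (1 + u) ^ q with hf
  have i1 := (integrableOn_tricomi (q + 1) (by linarith : 0 < p + 1) hz).const_mul (-z)
  have i2 := (integrableOn_tricomi (q + 1) hp hz).const_mul p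
  have i3 := (integrableOn_tricomi q (by linarith : 0 < p + 1) hz).const_mul q
  have hcont : ContinuousWithinAt f (Ici 0) 0 := by
    refine ContinuousAt.continuousWithinAt ?_
    refine ContinuousAt.mul (ContinuousAt.mul (by fun_prop) ?_) ?_
    · exact Real.continuousAt_rpow_const _ _ (Or.inr hp.le)
    · exact ContinuousAt.rpow_const (by fun_prop) (Or.inl (by norm_num))
  have hlim : Tendsto f atTop (𝓝 0) := by
    obtain ⟨C, hC, hb⟩ := exists_one_add_rpow_le q (half_pos hz)
    have h := (tendsto_rpow_mul_exp_neg_mul_atTop_nhds_zero p (z / 2) (half_pos hz)).const_mul C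
    rw [mul_zero] at h
    refine squeeze_zero' ?_ ?_ h
    · filter_upwards [eventually_gt_atTop 0] with u hu
      positivity
    · filter_upwards [eventually_gt_atTop 0] with u hu
      calc Real.exp (-z * u) * u ^ p * (1 + u) ^ q
          ≤ Real.exp (-z * u) * u ^ p * (C * Real.exp (z / 2 * u)) := by
            gcongr; exact hb u hu.le
        _ = C * (u ^ p * (Real.exp (-z * u) * Real.exp (z / 2 * u))) := by ring
        _ = _ := by rw [← Real.exp_add]; ring_nf
  have key := integral_Ioi_of_hasDerivAt_of_tendsto hcont (fun u (hu : 0 < u) => ?_)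
    ((i1.add i2).add i3) hlim
  · rw [integral_add' (i1.add i2) i3, integral_add' i1 i2, integral_const_mul,
      integral_const_mul, integral_const_mul] at key
    have h0 : f 0 = 0 := by simp [hf, Real.zero_rpow hp.ne']
    rw [h0] at key
    unfold tricomiIntegral
    linarith
  · have h1 : HasDerivAt (fun u : ℝ => Real.exp (-z * u)) (Real.exp (-z * u) * (-z * 1)) u :=
      ((hasDerivAt_id u).const_mul (-z)).exp
    have h2 : HasDerivAt (fun u : ℝ => u ^ p) (p * u ^ (p - 1)) u :=
      Real.hasDerivAt_rpow_const (Or.inl hu.ne')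
    have h3 : HasDerivAt (fun u : ℝ => (1 + u) ^ q) (1 * q * (1 + u) ^ (q - 1)) u :=
      ((hasDerivAt_id u).const_add 1).rpow_const (Or.inl (by simp; positivity))
    refine ((h1.mul h2).mul h3).congr_deriv ?_
    simp only [Pi.add_apply, Pi.mul_apply, add_sub_cancel_right]
    ring

/-- Confluent form of the differential equation satisfied by `tricomiIntegral a a`. -/
lemma tricomiIntegral_ode {a z : ℝ} (ha : 0 < a) (hz : 0 < z) :
    z * tricomiIntegral (a + 1 + 1) a z + (2 * a - z) * -tricomiIntegral (a + 1) a z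
      - a * tricomiIntegral a a z = 0 := by
  have h1 := mul_tricomiIntegral a ha hz
  have h2 := tricomiIntegral_add_one_right a ha hz
  have h3 := tricomiIntegral_add_one_right a (by linarith : 0 < a + 1) hz
  rw [h2, h3] at h1
  linarith

lemma tricomiIntegral_sub_one {a z : ℝ} (ha : 0 < a) (hz : 0 < z) :
    z * -tricomiIntegral (a + 1) a z + (2 * a - 1) * tricomiIntegral a a z =
      (a - 1) * tricomiIntegral a (a - 1) z := by
  have h1 := mul_tricomiIntegral (a - 1) ha hz
  have h2 := tricomiIntegral_add_one_right (a - 1) ha hz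
  rw [sub_add_cancel] at h1 h2
  linear_combination (-1 : ℝ) * h1 + (a - 1) * h2

lemma tendsto_rpow_mul_tricomiIntegral {p q : ℝ} (hq : q ≤ 1) (hpq : 1 < p + q) :
    Tendsto (fun z => z ^ (p + q - 1) * tricomiIntegral p q z) (𝓝[>] 0)
      (𝓝 (Real.Gamma (p + q - 1))) := by
  have hscale : ∀ z : ℝ, 0 < z → ∫ s in Ioi (0 : ℝ),
      Real.exp (-s) * s ^ (p - 1) * (z + s) ^ (q - 1) =
        z ^ (p + q - 1) * tricomiIntegral p q z := by
    intro z hz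
    have := integral_comp_mul_left_Ioi'
      (fun s : ℝ => Real.exp (-s) * s ^ (p - 1) * (z + s) ^ (q - 1)) 0 hz
    rw [mul_zero] at this
    rw [← this, tricomiIntegral, smul_eq_mul, ← integral_const_mul, ← integral_const_mul]
    refine setIntegral_congr_fun measurableSet_Ioi fun u (hu : 0 < u) => ?_
    have h1 : z + z * u = z * (1 + u) := by ring
    have h2 : z ^ (p + q - 1) = z * z ^ (p - 1) * z ^ (q - 1) := by
      rw [← Real.rpow_one_add' hz.le (by linarith), ← Real.rpow_add hz]
      ring_nf
    simp only [h1]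
    rw [Real.mul_rpow hz.le hu.le, Real.mul_rpow hz.le (by positivity), h2]
    ring_nf
  rw [Real.Gamma_eq_integral (by linarith)]
  have hint := Real.GammaIntegral_convergent (s := p + q - 1) (by linarith)
  have key : Tendsto (fun z : ℝ => ∫ s in Ioi (0 : ℝ),
      Real.exp (-s) * s ^ (p - 1) * (z + s) ^ (q - 1)) (𝓝[>] 0)
      (𝓝 (∫ s in Ioi (0 : ℝ), Real.exp (-s) * s ^ (p + q - 1 - 1))) := by
    have hmul : ∀ s : ℝ, 0 < s → s ^ (p + q - 1 - 1) = s ^ (p - 1) * s ^ (q - 1) := by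
      intro s hs
      rw [← Real.rpow_add hs]
      ring_nf
    refine tendsto_integral_filter_of_dominated_convergence _
      (.of_forall fun z => ?_) ?_ hint ?_
    · exact Measurable.aestronglyMeasurable (by fun_prop)
    · filter_upwards [self_mem_nhdsWithin] with z (hz : 0 < z)
      refine (ae_restrict_iff' measurableSet_Ioi).mpr (.of_forall fun s (hs : 0 < s) => ?_)
      rw [Real.norm_of_nonneg (by positivity), hmul s hs, ← mul_assoc]
      gcongr ?_ * ?_
      exact Real.rpow_le_rpow_of_nonpos hs (by linarith) (by linarith)
    · refine (ae_restrict_iff' measurableSet_Ioi).mpr (.of_forall fun s (hs : 0 < s) => ?_)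
      rw [hmul s hs, ← mul_assoc]
      refine Tendsto.const_mul _ (tendsto_nhdsWithin_of_tendsto_nhds ?_)
      have : ContinuousAt (fun z : ℝ => (z + s) ^ (q - 1)) 0 :=
        ContinuousAt.rpow_const (by fun_prop) (Or.inl (by simpa using hs.ne'))
      simpa [ContinuousAt] using this
  refine key.congr' ?_
  filter_upwards [self_mem_nhdsWithin] with z hz
  exact hscale z hz

lemma image_div_one_add_Ioi : (fun u : ℝ => u / (1 + u)) '' Ioi 0 = Ioo 0 1 := by
  ext y
  constructor
  · rintro ⟨u, hu : 0 < u, rfl⟩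
    exact ⟨by positivity, (div_lt_one (by positivity)).mpr (by linarith)⟩
  · rintro ⟨h0, h1⟩
    have : 0 < 1 - y := by linarith
    refine ⟨y / (1 - y), div_pos h0 this, ?_⟩
    field_simp
    ring

lemma integral_rpow_mul_one_sub_rpow {s t : ℝ} (hs : 0 < s) (ht : 0 < t) :
    IntegrableOn (fun y : ℝ => y ^ (s - 1) * (1 - y) ^ (t - 1)) (Ioo 0 1) ∧
    ∫ y in Ioo (0 : ℝ) 1, y ^ (s - 1) * (1 - y) ^ (t - 1) =
      Real.Gamma s * Real.Gamma t / Real.Gamma (s + t) := by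
  have hcongr : ∀ y ∈ Ioc (0 : ℝ) 1, (y : ℂ) ^ ((s : ℂ) - 1) * (1 - (y : ℂ)) ^ ((t : ℂ) - 1) =
      ((y ^ (s - 1) * (1 - y) ^ (t - 1) : ℝ) : ℂ) := by
    intro y hy
    rw [Complex.ofReal_mul, Complex.ofReal_cpow hy.1.le, Complex.ofReal_cpow (by linarith [hy.2])]
    push_cast
    rfl
  have hc := Complex.betaIntegral_convergent (u := s) (v := t) (by simpa) (by simpa)
  rw [intervalIntegrable_iff_integrableOn_Ioc_of_le zero_le_one] at hc
  have hr : IntegrableOn (fun y : ℝ => y ^ (s - 1) * (1 - y) ^ (t - 1)) (Ioc 0 1) := by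
    have := (hc.congr_fun hcongr measurableSet_Ioc).re
    rw [IntegrableOn]
    simpa using this
  refine ⟨hr.mono_set Ioo_subset_Ioc_self, ?_⟩
  have hv := Complex.betaIntegral_eq_Gamma_mul_div s t (by simpa) (by simpa)
  rw [Complex.betaIntegral, intervalIntegral.integral_of_le zero_le_one,
    setIntegral_congr_fun measurableSet_Ioc hcongr, integral_complex_ofReal,
    ← Complex.ofReal_add, Complex.Gamma_ofReal, Complex.Gamma_ofReal, Complex.Gamma_ofReal] at hv
  rw [← integral_Ioc_eq_integral_Ioo]
  exact_mod_cast hv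

/-- The Beta integral over the half-line. -/
lemma integral_rpow_mul_one_add_rpow {p q : ℝ} (hp : 0 < p) (hpq : p + q < 1) :
    IntegrableOn (fun u : ℝ => u ^ (p - 1) * (1 + u) ^ (q - 1)) (Ioi 0) ∧
    ∫ u in Ioi (0 : ℝ), u ^ (p - 1) * (1 + u) ^ (q - 1) =
      Real.Gamma p * Real.Gamma (1 - p - q) / Real.Gamma (1 - q) := by
  obtain ⟨hi, hv⟩ := integral_rpow_mul_one_sub_rpow hp (by linarith : 0 < 1 - p - q)
  have hder : ∀ u ∈ Ioi (0 : ℝ),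
      HasDerivWithinAt (fun u : ℝ => u / (1 + u)) (1 / (1 + u) ^ 2) (Ioi 0) u := by
    intro u (hu : 0 < u)
    have := (hasDerivAt_id u).div ((hasDerivAt_id u).const_add 1) (by simp; positivity)
    refine HasDerivAt.hasDerivWithinAt ?_
    refine this.congr_deriv ?_
    simp
  have hinj : InjOn (fun u : ℝ => u / (1 + u)) (Ioi 0) := by
    intro u (hu : 0 < u) v (hv : 0 < v) h
    have h' : u / (1 + u) = v / (1 + v) := h
    rw [div_eq_div_iff (by positivity) (by positivity)] at h'
    linarith
  have hcongr : ∀ u ∈ Ioi (0 : ℝ), |1 / (1 + u) ^ 2| •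
      ((u / (1 + u)) ^ (p - 1) * (1 - u / (1 + u)) ^ (1 - p - q - 1)) =
        u ^ (p - 1) * (1 + u) ^ (q - 1) := by
    intro u (hu : 0 < u)
    have h1 : (0 : ℝ) < 1 + u := by positivity
    have h2 : 1 - u / (1 + u) = (1 + u)⁻¹ := by field_simp; ring
    have h3 : (1 + u) ^ (q - 1) =
        (1 + u) ^ (-2 : ℝ) * (1 + u) ^ (-(p - 1)) * (1 + u) ^ (-(1 - p - q - 1)) := by
      rw [← Real.rpow_add h1, ← Real.rpow_add h1]
      ring_nf
    rw [h2, abs_of_pos (by positivity), smul_eq_mul, Real.div_rpow hu.le h1.le,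
      Real.inv_rpow h1.le, h3, Real.rpow_neg h1.le, Real.rpow_neg h1.le, Real.rpow_neg h1.le,
      Real.rpow_two]
    ring
  rw [← image_div_one_add_Ioi] at hi hv
  rw [integrableOn_image_iff_integrableOn_abs_deriv_smul measurableSet_Ioi hder hinj] at hi
  rw [integral_image_eq_integral_abs_deriv_smul measurableSet_Ioi hder hinj,
    setIntegral_congr_fun measurableSet_Ioi hcongr] at hv
  refine ⟨hi.congr_fun hcongr measurableSet_Ioi, ?_⟩
  rw [hv]
  ring_nf

lemma tendsto_tricomiIntegral {p q : ℝ} (hp : 0 < p) (hpq : p + q < 1) :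
    Tendsto (tricomiIntegral p q) (𝓝[>] 0)
      (𝓝 (Real.Gamma p * Real.Gamma (1 - p - q) / Real.Gamma (1 - q))) := by
  obtain ⟨hi, hv⟩ := integral_rpow_mul_one_add_rpow hp hpq
  rw [← hv]
  refine tendsto_integral_filter_of_dominated_convergence _
    (.of_forall fun z => (measurable_tricomi p q z).aestronglyMeasurable) ?_ hi ?_
  · filter_upwards [self_mem_nhdsWithin] with z (hz : 0 < z)
    refine (ae_restrict_iff' measurableSet_Ioi).mpr (.of_forall fun u (hu : 0 < u) => ?_)
    rw [Real.norm_of_nonneg (by positivity), mul_assoc]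
    refine mul_le_of_le_one_left (by positivity) (Real.exp_le_one_iff.mpr ?_)
    nlinarith
  · refine .of_forall fun u => tendsto_nhdsWithin_of_tendsto_nhds ?_
    have : ContinuousAt
        (fun z : ℝ => Real.exp (-z * u) * u ^ (p - 1) * (1 + u) ^ (q - 1)) 0 := by fun_prop
    simpa [ContinuousAt] using this

lemma eq_of_hasDerivAt_zero {f : ℝ → ℝ} {l : ℝ} (hf : ∀ z, 0 < z → HasDerivAt f 0 z)
    (hl : Tendsto f (𝓝[>] 0) (𝓝 l)) {z : ℝ} (hz : 0 < z) : f z = l := by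
  refine tendsto_nhds_unique (tendsto_const_nhds.congr' ?_) hl
  filter_upwards [self_mem_nhdsWithin] with y hy
  exact isOpen_Ioi.is_const_of_deriv_eq_zero isPreconnected_Ioi
    (fun y hy => (hf y hy).differentiableAt.differentiableWithinAt)
    (fun y hy => (hf y hy).deriv) hz hy

lemma tendsto_rpow_nhdsGT_zero {s : ℝ} (hs : 0 < s) :
    Tendsto (fun z : ℝ => z ^ s) (𝓝[>] 0) (𝓝 0) := by
  have := Real.continuousAt_rpow_const 0 s (Or.inr hs.le)
  rw [ContinuousAt, Real.zero_rpow hs.ne'] at this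
  exact tendsto_nhdsWithin_of_tendsto_nhds this

/-- A solution of Kummer's equation with parameters `(a, 2 * a)` on the half-line vanishes if its
expansion at the origin has no leading coefficients. -/
lemma eq_zero_of_ode {a : ℝ} (ha : 0 < a) (h2a : ∀ m : ℤ, 2 * a ≠ m) {D D₁ D₂ : ℝ → ℝ}
    (hD : ∀ z, 0 < z → HasDerivAt D (D₁ z) z) (hD₁ : ∀ z, 0 < z → HasDerivAt D₁ (D₂ z) z)
    (hode : ∀ z, 0 < z → z * D₂ z + (2 * a - z) * D₁ z - a * D z = 0)
    (hl₁ : Tendsto (fun z => z ^ (2 * a) * D₁ z) (𝓝[>] 0) (𝓝 0))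
    (hl : Tendsto (fun z => z * D₁ z + (2 * a - 1) * D z) (𝓝[>] 0) (𝓝 0)) {z : ℝ} (hz : 0 < z) :
    D z = 0 := by
  have ha0 : ∀ n : ℕ, a + n ≠ 0 := fun n => by positivity
  have hb0 : ∀ n : ℕ, 2 * a + n ≠ 0 := fun n => by positivity
  have hc : 2 * a - 1 ≠ 0 := fun h => h2a 1 (by push_cast; linarith)
  have hM0 : series a (2 * a) 0 ≠ 0 := by
    rw [series_zero]
    refine mul_ne_zero (Real.Gamma_pos_of_pos ha).ne' (Real.Gamma_ne_zero fun m h => ?_)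
    exact h2a (1 + m) (by push_cast; linarith)
  have hcoeff : coeff a (2 * a) 0 ≠ 0 := by
    rw [series_zero] at hM0
    simpa [coeff] using hM0
  have hM : ∀ z, HasDerivAt (series a (2 * a)) (-series (a + 1) (2 * a + 1) z) z :=
    hasDerivAt_series ha0 hb0
  have hM₁ : ∀ z, HasDerivAt (series (a + 1) (2 * a + 1))
      (-series (a + 1 + 1) (2 * a + 1 + 1) z) z :=
    hasDerivAt_series (add_one_ne ha0) (add_one_ne hb0)
  have tz : Tendsto (fun z : ℝ => z) (𝓝[>] 0) (𝓝 0) :=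
    tendsto_nhdsWithin_of_tendsto_nhds tendsto_id
  have tM : Tendsto (series a (2 * a)) (𝓝[>] 0) (𝓝 (series a (2 * a) 0)) :=
    tendsto_nhdsWithin_of_tendsto_nhds (hM 0).continuousAt
  have tM₁ : Tendsto (series (a + 1) (2 * a + 1)) (𝓝[>] 0)
      (𝓝 (series (a + 1) (2 * a + 1) 0)) :=
    tendsto_nhdsWithin_of_tendsto_nhds (hM₁ 0).continuousAt
  have hW : ∀ z, 0 < z →
      D z * -series (a + 1) (2 * a + 1) z - D₁ z * series a (2 * a) z = 0 := by
    have tD : Tendsto (fun z => z ^ (2 * a) * D z) (𝓝[>] 0) (𝓝 0) := by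
      have h := (((tendsto_rpow_nhdsGT_zero (by linarith : 0 < 2 * a)).mul hl).sub
        (tz.mul hl₁)).div_const (2 * a - 1)
      simp only [mul_zero, sub_zero, zero_div] at h
      refine h.congr fun z => ?_
      field_simp
      ring
    have hder : ∀ z, 0 < z → HasDerivAt (fun z => z ^ (2 * a) * Real.exp (-z) *
        (D z * -series (a + 1) (2 * a + 1) z - D₁ z * series a (2 * a) z)) 0 z := by
      intro z hz
      have h1 : HasDerivAt (fun z : ℝ => z ^ (2 * a)) (2 * a * z ^ (2 * a - 1)) z :=
        Real.hasDerivAt_rpow_const (Or.inl hz.ne')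
      have h2 : HasDerivAt (fun z : ℝ => Real.exp (-z)) (Real.exp (-z) * -1) z :=
        (hasDerivAt_neg z).exp
      have h3 := ((hD z hz).mul (hM₁ z).neg).sub ((hD₁ z hz).mul (hM z))
      refine ((h1.mul h2).mul h3).congr_deriv ?_
      have h4 : z ^ (2 * a) = z ^ (2 * a - 1) * z := by
        rw [← Real.rpow_add_one hz.ne']; ring_nf
      have o1 := hode z hz
      have o2 := series_ode ha0 hb0 z
      simp only [Pi.mul_apply, Pi.sub_apply, Pi.neg_apply, h4]
      linear_combination (z ^ (2 * a - 1) * Real.exp (-z) * D z) * o2 -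
        (z ^ (2 * a - 1) * Real.exp (-z) * series a (2 * a) z) * o1
    have tW : Tendsto (fun z => z ^ (2 * a) * Real.exp (-z) *
        (D z * -series (a + 1) (2 * a + 1) z - D₁ z * series a (2 * a) z)) (𝓝[>] 0) (𝓝 0) := by
      have te : Tendsto (fun z : ℝ => Real.exp (-z)) (𝓝[>] 0) (𝓝 (Real.exp (-0))) :=
        tendsto_nhdsWithin_of_tendsto_nhds (by fun_prop : Continuous _).continuousAt
      have h := te.mul ((tD.mul tM₁.neg).sub (hl₁.mul tM))
      simp only [zero_mul, sub_zero, mul_zero] at h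
      exact h.congr fun z => by ring
    intro z hz
    have := eq_of_hasDerivAt_zero hder tW hz
    have hne : z ^ (2 * a) * Real.exp (-z) ≠ 0 := by positivity
    exact (mul_eq_zero.mp this).resolve_left hne
  have hMne : ∀ z, 0 < z → series a (2 * a) z ≠ 0 := fun z hz =>
    series_ne_zero ha (by linarith) hz hcoeff
  have hquot : ∀ z, 0 < z → HasDerivAt (fun z => D z / series a (2 * a) z) 0 z := by
    intro z hz
    refine ((hD z hz).div (hM z) (hMne z hz)).congr_deriv ?_
    rw [div_eq_zero_iff]
    left
    linear_combination -hW z hz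
  have tquot : Tendsto (fun z => D z / series a (2 * a) z) (𝓝[>] 0) (𝓝 0) := by
    have tden := (tz.mul tM₁).neg.add (tM.const_mul (2 * a - 1))
    have hne : -(0 * series (a + 1) (2 * a + 1) 0) + (2 * a - 1) * series a (2 * a) 0 ≠ 0 := by
      rw [zero_mul, neg_zero, zero_add]
      exact mul_ne_zero hc hM0
    have h := hl.div tden hne
    rw [zero_div] at h
    refine h.congr' ?_
    filter_upwards [self_mem_nhdsWithin, tden.eventually_ne hne] with z (hz : 0 < z) hz'
    have hMz := hMne z hz
    simp only [Pi.div_apply]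
    rw [div_eq_div_iff hz' hMz]
    linear_combination -z * hW z hz
  have := eq_of_hasDerivAt_zero hquot tquot hz
  exact (div_eq_zero_iff.mp this).resolve_right (hMne z hz)

/-- First derivative of the second Frobenius solution. -/
lemma hasDerivAt_rpow_mul_series {a : ℝ} (h2a : ∀ m : ℤ, 2 * a ≠ m) {z : ℝ} (hz : 0 < z) :
    HasDerivAt (fun z => z ^ (1 - 2 * a) * series (1 - a) (2 - 2 * a) z)
      (z ^ (-2 * a) * ((1 - 2 * a) * series (1 - a) (2 - 2 * a) z -
        z * series (1 - a + 1) (2 - 2 * a + 1) z)) z := by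
  have ha' : ∀ n : ℕ, 1 - a + n ≠ 0 := fun n h => h2a (2 + 2 * n) (by push_cast; linarith)
  have hb' : ∀ n : ℕ, 2 - 2 * a + n ≠ 0 := fun n h => h2a (2 + n) (by push_cast; linarith)
  have h1 : HasDerivAt (fun z : ℝ => z ^ (1 - 2 * a))
      ((1 - 2 * a) * z ^ (1 - 2 * a - 1)) z :=
    Real.hasDerivAt_rpow_const (Or.inl hz.ne')
  refine (h1.mul (hasDerivAt_series ha' hb' z)).congr_deriv ?_
  have e1 : z ^ (1 - 2 * a) = z ^ (-2 * a) * z := by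
    rw [← Real.rpow_add_one hz.ne']; ring_nf
  have e2 : 1 - 2 * a - 1 = -2 * a := by ring
  rw [e1, e2]
  ring

/-- Second derivative of the second Frobenius solution. -/
lemma hasDerivAt_rpow_mul_series_deriv {a : ℝ} (h2a : ∀ m : ℤ, 2 * a ≠ m) {z : ℝ} (hz : 0 < z) :
    HasDerivAt (fun z => z ^ (-2 * a) * ((1 - 2 * a) * series (1 - a) (2 - 2 * a) z -
        z * series (1 - a + 1) (2 - 2 * a + 1) z))
      (z ^ (-2 * a - 1) * (-2 * a * (1 - 2 * a) * series (1 - a) (2 - 2 * a) z -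
        2 * (1 - 2 * a) * z * series (1 - a + 1) (2 - 2 * a + 1) z +
        z ^ 2 * series (1 - a + 1 + 1) (2 - 2 * a + 1 + 1) z)) z := by
  have ha' : ∀ n : ℕ, 1 - a + n ≠ 0 := fun n h => h2a (2 + 2 * n) (by push_cast; linarith)
  have hb' : ∀ n : ℕ, 2 - 2 * a + n ≠ 0 := fun n h => h2a (2 + n) (by push_cast; linarith)
  have h1 : HasDerivAt (fun z : ℝ => z ^ (-2 * a)) (-2 * a * z ^ (-2 * a - 1)) z :=
    Real.hasDerivAt_rpow_const (Or.inl hz.ne')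
  refine (h1.mul (((hasDerivAt_series ha' hb' z).const_mul (1 - 2 * a)).sub
    ((hasDerivAt_id z).mul
      (hasDerivAt_series (add_one_ne ha') (add_one_ne hb') z)))).congr_deriv ?_
  have e1 : z ^ (-2 * a) = z ^ (-2 * a - 1) * z := by
    rw [← Real.rpow_add_one hz.ne']; ring_nf
  simp only [Pi.sub_apply, Pi.mul_apply, id, e1]
  ring

/-- The combination of Frobenius solutions representing `tricomiIntegral a a`. -/
noncomputable def connection (a z : ℝ) : ℝ :=
  (series a (2 * a) z + z ^ (1 - 2 * a) * series (1 - a) (2 - 2 * a) z) / Real.Gamma (1 - a)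

/-- The first derivative of `connection a`. -/
noncomputable def connectionDeriv (a z : ℝ) : ℝ :=
  (-series (a + 1) (2 * a + 1) z + z ^ (-2 * a) * ((1 - 2 * a) * series (1 - a) (2 - 2 * a) z -
    z * series (1 - a + 1) (2 - 2 * a + 1) z)) / Real.Gamma (1 - a)

/-- The second derivative of `connection a`. -/
noncomputable def connectionDeriv₂ (a z : ℝ) : ℝ :=
  (series (a + 1 + 1) (2 * a + 1 + 1) z +
    z ^ (-2 * a - 1) * (-2 * a * (1 - 2 * a) * series (1 - a) (2 - 2 * a) z -
        2 * (1 - 2 * a) * z * series (1 - a + 1) (2 - 2 * a + 1) z +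
        z ^ 2 * series (1 - a + 1 + 1) (2 - 2 * a + 1 + 1) z)) / Real.Gamma (1 - a)

lemma hasDerivAt_connection {a : ℝ} (ha : 0 < a) (h2a : ∀ m : ℤ, 2 * a ≠ m) {z : ℝ}
    (hz : 0 < z) : HasDerivAt (connection a) (connectionDeriv a z) z :=
  ((hasDerivAt_series (fun n => by positivity) (fun n => by positivity) z).add
    (hasDerivAt_rpow_mul_series h2a hz)).div_const _

lemma hasDerivAt_connectionDeriv {a : ℝ} (ha : 0 < a) (h2a : ∀ m : ℤ, 2 * a ≠ m) {z : ℝ}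
    (hz : 0 < z) : HasDerivAt (connectionDeriv a) (connectionDeriv₂ a z) z := by
  have h := (hasDerivAt_series (a := a + 1) (b := 2 * a + 1) (fun n => by positivity)
    (fun n => by positivity) z).neg
  rw [neg_neg] at h
  exact (h.add (hasDerivAt_rpow_mul_series_deriv h2a hz)).div_const _

lemma connection_ode {a : ℝ} (ha : 0 < a) (h2a : ∀ m : ℤ, 2 * a ≠ m) {z : ℝ} (hz : 0 < z) :
    z * connectionDeriv₂ a z + (2 * a - z) * connectionDeriv a z - a * connection a z = 0 := by
  have ha' : ∀ n : ℕ, 1 - a + n ≠ 0 := fun n h => h2a (2 + 2 * n) (by push_cast; linarith)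
  have hb' : ∀ n : ℕ, 2 - 2 * a + n ≠ 0 := fun n h => h2a (2 + n) (by push_cast; linarith)
  have o1 := series_ode (a := a) (b := 2 * a) (fun n => by positivity) (fun n => by positivity) z
  have o2 := series_ode ha' hb' z
  have e1 : z ^ (-2 * a) = z ^ (-2 * a - 1) * z := by
    rw [← Real.rpow_add_one hz.ne']; ring_nf
  have e2 : z ^ (1 - 2 * a) = z ^ (-2 * a - 1) * z * z := by
    rw [← e1, ← Real.rpow_add_one hz.ne']; ring_nf
  unfold connection connectionDeriv connectionDeriv₂
  rw [e1, e2]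
  linear_combination (1 / Real.Gamma (1 - a)) * o1 +
    (z ^ (-2 * a - 1) * z ^ 2 / Real.Gamma (1 - a)) * o2

lemma tricomiIntegral_eq_connection_of_lt_one {a : ℝ} (ha : 0 < a) (ha1 : a < 1)
    (h2a : ∀ m : ℤ, 2 * a ≠ m) {z : ℝ} (hz : 0 < z) :
    tricomiIntegral a a z = connection a z := by
  have ha' : ∀ n : ℕ, 1 - a + n ≠ 0 := fun n h => h2a (2 + 2 * n) (by push_cast; linarith)
  have hb' : ∀ n : ℕ, 2 - 2 * a + n ≠ 0 := fun n h => h2a (2 + n) (by push_cast; linarith)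
  have hΓ : Real.Gamma (1 - a) ≠ 0 := (Real.Gamma_pos_of_pos (by linarith)).ne'
  have hc : 2 * a - 1 ≠ 0 := fun h => h2a 1 (by push_cast; linarith)
  have tz : Tendsto (fun z : ℝ => z) (𝓝[>] 0) (𝓝 0) :=
    tendsto_nhdsWithin_of_tendsto_nhds tendsto_id
  have cont : ∀ {a b : ℝ}, (∀ n : ℕ, a + n ≠ 0) → (∀ n : ℕ, b + n ≠ 0) →
      Tendsto (series a b) (𝓝[>] 0) (𝓝 (series a b 0)) := fun ha hb =>
    tendsto_nhdsWithin_of_tendsto_nhds (hasDerivAt_series ha hb 0).continuousAt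
  have tM := cont (a := a) (b := 2 * a) (fun n => by positivity) (fun n => by positivity)
  have tM₁ := cont (a := a + 1) (b := 2 * a + 1) (fun n => by positivity) (fun n => by positivity)
  have tN := cont ha' hb'
  have tN₁ := cont (add_one_ne ha') (add_one_ne hb')
  rw [← sub_eq_zero]
  refine eq_zero_of_ode ha h2a (D := fun z => tricomiIntegral a a z - connection a z)
    (D₁ := fun z => -tricomiIntegral (a + 1) a z - connectionDeriv a z)
    (D₂ := fun z => tricomiIntegral (a + 1 + 1) a z - connectionDeriv₂ a z)
    (fun z hz => (hasDerivAt_tricomiIntegral a ha hz).sub (hasDerivAt_connection ha h2a hz))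
    (fun z hz => ?_) (fun z hz => ?_) ?_ ?_ hz
  · have h := (hasDerivAt_tricomiIntegral a (by linarith : 0 < a + 1) hz).neg
    rw [neg_neg] at h
    exact h.sub (hasDerivAt_connectionDeriv ha h2a hz)
  · linear_combination tricomiIntegral_ode ha hz - connection_ode ha h2a hz
  · have h1 := tendsto_rpow_mul_tricomiIntegral (p := a + 1) (q := a) ha1.le (by linarith)
    rw [show a + 1 + a - 1 = 2 * a by ring] at h1
    have h2 := (((tendsto_rpow_nhdsGT_zero (by linarith : 0 < 2 * a)).mul tM₁).neg.add
      ((tN.const_mul (1 - 2 * a)).sub (tz.mul tN₁))).div_const (Real.Gamma (1 - a))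
    have h3 := h1.neg.sub h2
    have hval : -Real.Gamma (2 * a) - (-(0 * series (a + 1) (2 * a + 1) 0) +
        ((1 - 2 * a) * series (1 - a) (2 - 2 * a) 0 -
          0 * series (1 - a + 1) (2 - 2 * a + 1) 0)) / Real.Gamma (1 - a) = 0 := by
      have hg := Real.Gamma_add_one hc
      rw [sub_add_cancel] at hg
      rw [series_zero (1 - a), show 1 - (2 - 2 * a) = 2 * a - 1 by ring, hg]
      field_simp
      ring
    rw [hval] at h3
    refine h3.congr' ?_
    filter_upwards [self_mem_nhdsWithin] with z (hz : 0 < z)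
    have e : z ^ (-2 * a) * z ^ (2 * a) = 1 := by
      rw [← Real.rpow_add hz]; simp
    unfold connectionDeriv
    linear_combination (((1 - 2 * a) * series (1 - a) (2 - 2 * a) z -
      z * series (1 - a + 1) (2 - 2 * a + 1) z) / Real.Gamma (1 - a)) * e
  · have h1 := (tendsto_tricomiIntegral (p := a) (q := a - 1) ha (by linarith)).const_mul (a - 1)
    have h2 := ((tM.const_mul (2 * a - 1)).sub ((tz.mul tM₁).add
      ((tendsto_rpow_nhdsGT_zero (by linarith : 0 < 2 - 2 * a)).mul tN₁))).div_const
        (Real.Gamma (1 - a))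
    have h3 := h1.sub h2
    have hval : (a - 1) * (Real.Gamma a * Real.Gamma (1 - a - (a - 1)) /
        Real.Gamma (1 - (a - 1))) - ((2 * a - 1) * series a (2 * a) 0 -
        (0 * series (a + 1) (2 * a + 1) 0 + 0 * series (1 - a + 1) (2 - 2 * a + 1) 0)) /
          Real.Gamma (1 - a) = 0 := by
      have g1 := Real.Gamma_add_one (s := 1 - a) (by linarith)
      have g2 := Real.Gamma_add_one (s := 1 - 2 * a) (fun h => hc (by linarith))
      have h1a : 1 - a ≠ 0 := by linarith
      rw [series_zero a, show 1 - a - (a - 1) = 1 - 2 * a + 1 by ring,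
        show 1 - (a - 1) = 1 - a + 1 by ring, g1, g2]
      field_simp
      ring
    rw [hval] at h3
    refine h3.congr' ?_
    filter_upwards [self_mem_nhdsWithin] with z (hz : 0 < z)
    have e1 : z ^ (1 - 2 * a) = z ^ (-2 * a) * z := by
      rw [← Real.rpow_add_one hz.ne']; ring_nf
    have e2 : z ^ (2 - 2 * a) = z ^ (-2 * a) * z * z := by
      rw [← e1, ← Real.rpow_add_one hz.ne']; ring_nf
    unfold connection connectionDeriv
    rw [e1, e2]
    linear_combination (-1 : ℝ) * tricomiIntegral_sub_one ha hz

lemma series_add_contiguous {a b : ℝ} (ha : ∀ n : ℕ, a + 1 + n ≠ 0)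
    (hb : ∀ n : ℕ, b + 1 + n ≠ 0) (z : ℝ) :
    series (a + 1 + 1) (b + 1 + 1) z + series (a + 1) (b + 1) z =
      (a - b) * series (a + 1) (b + 1 + 1) z := by
  have h1 := hasSum_series (add_one_ne ha) (add_one_ne hb) z
  have h2 := hasSum_series ha hb z
  have h3 := (hasSum_series ha (add_one_ne hb) z).mul_left (a - b)
  refine (h1.add h2).unique (h3.congr_fun fun n => ?_)
  have g1 := Real.Gamma_add_one (ha n)
  have g2 := Real.Gamma_add_one (s := 1 - (b + 1 + 1) - n)
    (fun h => hb n (by linarith))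
  rw [show a + 1 + (n : ℝ) + 1 = a + 1 + 1 + n by ring] at g1
  rw [show 1 - (b + 1 + 1) - (n : ℝ) + 1 = 1 - (b + 1) - n by ring] at g2
  unfold coeff
  rw [g1, g2]
  ring

lemma coeff_sub {a b : ℝ} {n : ℕ} (ha : a - 1 + n ≠ 0) (hb : 1 - b - n ≠ 0)
    (hb' : 1 - b - n + 1 ≠ 0) :
    (a - 1 + n) * coeff (a - 1) (b - 2) n =
      (1 - b - n + 1) * (1 - b - n) * coeff a b n := by
  have g1 := Real.Gamma_add_one ha
  have g2 := Real.Gamma_add_one hb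
  have g3 := Real.Gamma_add_one hb'
  rw [show a - 1 + (n : ℝ) + 1 = a + n by ring] at g1
  rw [show 1 - b - (n : ℝ) + 1 + 1 = 1 - (b - 2) - n by ring, g2] at g3
  unfold coeff
  rw [g1, g3]
  ring

lemma series_sub_contiguous {a : ℝ} (h2a : ∀ m : ℤ, 2 * a ≠ m) (z : ℝ) :
    series (a - 1) (2 * a - 2) z =
      (2 * (2 * a - 1) - z) * series a (2 * a) z - 2 * z * series (a + 1) (2 * a + 1) z := by
  have ha : ∀ n : ℕ, a + n ≠ 0 := fun n h => h2a (-(2 * n)) (by push_cast; linarith)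
  have hb : ∀ n : ℕ, 2 * a + n ≠ 0 := fun n h => h2a (-n) (by push_cast; linarith)
  have ha' : ∀ n : ℕ, a - 1 + n ≠ 0 := fun n h => h2a (2 - 2 * n) (by push_cast; linarith)
  have hb' : ∀ n : ℕ, 2 * a - 2 + n ≠ 0 := fun n h => h2a (2 - n) (by push_cast; linarith)
  have hrec : ∀ n : ℕ, (a - 1 + n) * coeff (a - 1) (2 * a - 2) n =
      (1 - 2 * a - n + 1) * (1 - 2 * a - n) * coeff a (2 * a) n := fun n =>
    coeff_sub (ha' n) (fun h => h2a (1 - n) (by push_cast; linarith))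
      (fun h => h2a (2 - n) (by push_cast; linarith))
  have h0 := hasSum_series ha hb z
  have h1 := hasSum_series (add_one_ne ha) (add_one_ne hb) z
  have k0 := mul_hasSum_pow (d := fun n => (2 * (2 * a - 1) + 2 * n) * coeff a (2 * a) n -
      coeff (a - 1) (2 * a - 2) n) h0
    (by
      have h := hrec 0
      have hne := ha' 0
      simp only [Nat.cast_zero] at h hne ⊢
      apply mul_left_cancel₀ hne
      linear_combination -h)
    (fun n => by
      have h := hrec (n + 1)
      have hne := ha' (n + 1)
      have hs := coeff_succ (ha n) (hb n)
      apply mul_left_cancel₀ hne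
      push_cast at h ⊢
      linear_combination hs - h)
  have k1 := mul_hasSum_pow (d := fun n => -(n * coeff a (2 * a) n)) h1 (by simp)
    (fun n => by push_cast; rw [coeff_succ_shift]; ring)
  have key := ((h0.mul_left (2 * (2 * a - 1))).sub k0).sub (k1.mul_left 2)
  rw [(hasSum_series ha' hb' z).unique (key.congr_fun fun n => by ring)]
  ring

lemma connection_add_one {a : ℝ} (ha : 0 < a) (h2a : ∀ m : ℤ, 2 * a ≠ m) {z : ℝ} (hz : 0 < z) :
    connection (a + 1) z = connectionDeriv₂ a z - connectionDeriv a z := by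
  have h2a' : ∀ m : ℤ, 2 * (1 - a) ≠ m := fun m h => h2a (2 - m) (by push_cast; linarith)
  have ha' : ∀ n : ℕ, 1 - a + n ≠ 0 := fun n h => h2a (2 + 2 * n) (by push_cast; linarith)
  have hb' : ∀ n : ℕ, 2 - 2 * a + n ≠ 0 := fun n h => h2a (2 + n) (by push_cast; linarith)
  have c1 := series_add_contiguous (a := a) (b := 2 * a) (fun n => by positivity)
    (fun n => by positivity) z
  have c2 := series_sub_contiguous h2a' z
  have o2 := series_ode ha' hb' z
  have e1 : z ^ (-2 * a) = z ^ (-2 * a - 1) * z := by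
    rw [← Real.rpow_add_one hz.ne']; ring_nf
  have hg := Real.Gamma_add_one (s := -a) (by linarith)
  have hΓ : Real.Gamma (-a) ≠ 0 := Real.Gamma_ne_zero fun m h =>
    h2a (2 * m) (by push_cast; linarith)
  rw [show 1 - a - 1 = -a by ring, show 2 * (1 - a) - 2 = -2 * a by ring,
    show 2 * (1 - a) = 2 - 2 * a by ring] at c2
  rw [show 2 * a + 1 + 1 = 2 * (a + 1) by ring] at c1
  unfold connection connectionDeriv connectionDeriv₂
  rw [show 1 - (a + 1) = -a by ring, show 2 - 2 * (a + 1) = -2 * a by ring,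
    show 1 - 2 * (a + 1) = -2 * a - 1 by ring, show 1 - a = -a + 1 by ring, hg, e1,
    show -a + 1 = 1 - a by ring, show 2 * a + 1 + 1 = 2 * (a + 1) by ring]
  rw [← sub_div, div_eq_div_iff hΓ (mul_ne_zero (by linarith) hΓ)]
  linear_combination Real.Gamma (-a) *
    (-c1 - a * z ^ (-2 * a - 1) * c2 - z ^ (-2 * a - 1) * z * o2)

lemma tricomiIntegral_eq_connection_of_lt (n : ℕ) : ∀ {a : ℝ}, 0 < a → a < n + 1 →
    (∀ m : ℤ, 2 * a ≠ m) → ∀ {z : ℝ}, 0 < z → tricomiIntegral a a z = connection a z := by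
  induction n with
  | zero =>
    intro a ha ha1 h2a z hz
    exact tricomiIntegral_eq_connection_of_lt_one ha (by simpa using ha1) h2a hz
  | succ n ih =>
    intro a ha ha1 h2a z hz
    rcases lt_trichotomy a 1 with h | h | h
    · exact tricomiIntegral_eq_connection_of_lt_one ha h h2a hz
    · exact absurd (by rw [h]; norm_num) (h2a 2)
    obtain ⟨a, rfl⟩ : ∃ c, a = c + 1 := ⟨a - 1, by ring⟩
    have ha : 0 < a := by linarith
    have h2a : ∀ m : ℤ, 2 * a ≠ m := fun m h => h2a (m + 2) (by push_cast; linarith)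
    have ih := @ih a ha (by push_cast at ha1; linarith) h2a
    have hd : ∀ {z : ℝ}, 0 < z → -tricomiIntegral (a + 1) a z = connectionDeriv a z := by
      intro z hz
      refine (hasDerivAt_tricomiIntegral a ha hz).unique
        ((hasDerivAt_connection ha h2a hz).congr_of_eventuallyEq ?_)
      filter_upwards [Ioi_mem_nhds hz] with y hy using ih hy
    have hd₂ : tricomiIntegral (a + 1 + 1) a z = connectionDeriv₂ a z := by
      have h := (hasDerivAt_tricomiIntegral a (by linarith : 0 < a + 1) hz).neg
      rw [neg_neg] at h
      refine h.unique ((hasDerivAt_connectionDeriv ha h2a hz).congr_of_eventuallyEq ?_)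
      filter_upwards [Ioi_mem_nhds hz] with y hy using hd hy
    rw [tricomiIntegral_add_one_right a (by linarith : 0 < a + 1) hz, connection_add_one ha h2a hz,
      ← hd₂, ← hd hz]
    ring

/-- The connection formula for Tricomi's function with parameters `(a, 2 * a)`. -/
theorem tricomiIntegral_eq_connection {a : ℝ} (ha : 0 < a) (h2a : ∀ m : ℤ, 2 * a ≠ m) {z : ℝ}
    (hz : 0 < z) : tricomiIntegral a a z = connection a z := by
  obtain ⟨n, hn⟩ := exists_nat_gt a
  exact tricomiIntegral_eq_connection_of_lt n ha (by linarith) h2a hz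

/-- The defining integral of `besselK`, expressed through Tricomi's integral. -/
lemma integral_exp_mul_sq_sub_one_rpow (ν x : ℝ) :
    ∫ t in Ioi (1 : ℝ), Real.exp (-x * t) * (t ^ 2 - 1) ^ (ν - 1 / 2) =
      Real.exp (-x) * 2 ^ (2 * ν) * tricomiIntegral (ν + 1 / 2) (ν + 1 / 2) (2 * x) := by
  have h1 : ∫ t in Ioi (1 : ℝ), Real.exp (-x * t) * (t ^ 2 - 1) ^ (ν - 1 / 2) =
      ∫ s in Ioi (0 : ℝ), Real.exp (-x * (s + 1)) * ((s + 1) ^ 2 - 1) ^ (ν - 1 / 2) := by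
    have := (measurePreserving_add_right (volume : Measure ℝ) 1).setIntegral_preimage_emb
      (measurableEmbedding_addRight 1)
      (fun t : ℝ => Real.exp (-x * t) * (t ^ 2 - 1) ^ (ν - 1 / 2)) (Ioi 1)
    rw [← this]
    simp
  have h2 := integral_comp_mul_left_Ioi'
    (fun s : ℝ => Real.exp (-x * (s + 1)) * ((s + 1) ^ 2 - 1) ^ (ν - 1 / 2)) 0 two_pos
  rw [mul_zero] at h2
  rw [h1, ← h2, tricomiIntegral, smul_eq_mul, ← integral_const_mul, ← integral_const_mul]
  refine setIntegral_congr_fun measurableSet_Ioi fun u (hu : 0 < u) => ?_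
  have e1 : (2 * u + 1) ^ 2 - 1 = 2 ^ (2 : ℝ) * (u * (1 + u)) := by
    rw [Real.rpow_two]; ring
  have e2 : (2 : ℝ) ^ (2 * ν) = 2 * (2 ^ (2 : ℝ)) ^ (ν - 1 / 2) := by
    rw [← Real.rpow_mul two_pos.le, show 2 * ν = 2 * (ν - 1 / 2) + 1 by ring,
      Real.rpow_add_one two_ne_zero, mul_comm]
  have e3 : Real.exp (-x * (2 * u + 1)) = Real.exp (-x) * Real.exp (-(2 * x) * u) := by
    rw [← Real.exp_add]; ring_nf
  have e4 : ν + 1 / 2 - 1 = ν - 1 / 2 := by ring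
  simp only [e1, e3, e4]
  rw [Real.mul_rpow (by positivity) (by positivity), Real.mul_rpow hu.le (by positivity), e2]
  ring

end Kummer

/-- For ν > 0 with 2ν not an integer and x > 0, K_ν(x) equals the sum of two
exponentially weighted power series, both absolutely convergent. -/
theorem besselK_eq_two_series (ν x : ℝ) (hν : 0 < ν) (h2ν : ∀ m : ℤ, 2 * ν ≠ (m : ℝ))
    (hx : 0 < x) :
    Summable (fun n : ℕ =>
      |Real.Gamma (ν + 1/2 + n) * Real.Gamma (-2*ν - n) * (-2*x)^n / n.factorial|) ∧
    Summable (fun n : ℕ =>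
      |Real.Gamma (-ν + 1/2 + n) * Real.Gamma (2*ν - n) * (-2*x)^n / n.factorial|) ∧
    besselK ν x =
      (Real.cos (ν * Real.pi) * Real.exp (-x) / Real.sqrt Real.pi) *
        (2 ^ ν * x ^ ν *
            (∑' n : ℕ,
              Real.Gamma (ν + 1/2 + n) * Real.Gamma (-2*ν - n) * (-2*x)^n / n.factorial) +
         2 ^ (-ν) * x ^ (-ν) *
            (∑' n : ℕ,
              Real.Gamma (-ν + 1/2 + n) * Real.Gamma (2*ν - n) * (-2*x)^n / n.factorial)) := by
  have h2a : ∀ m : ℤ, 2 * (ν + 1 / 2) ≠ m := fun m h => h2ν (m - 1) (by push_cast; linarith)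
  have ha : ∀ n : ℕ, ν + 1 / 2 + n ≠ 0 := fun n => by positivity
  have hb : ∀ n : ℕ, 2 * (ν + 1 / 2) + n ≠ 0 := fun n => by positivity
  have ha' : ∀ n : ℕ, 1 - (ν + 1 / 2) + n ≠ 0 := fun n h =>
    h2a (2 + 2 * n) (by push_cast; linarith)
  have hb' : ∀ n : ℕ, 2 - 2 * (ν + 1 / 2) + n ≠ 0 := fun n h =>
    h2a (2 + n) (by push_cast; linarith)
  have t1 : ∀ n : ℕ,
      Real.Gamma (ν + 1/2 + n) * Real.Gamma (-2*ν - n) * (-2*x)^n / n.factorial =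
        Kummer.coeff (ν + 1 / 2) (2 * (ν + 1 / 2)) n * (2 * x) ^ n := fun n => by
    rw [Kummer.coeff, show 1 - 2 * (ν + 1 / 2) - (n : ℝ) = -2 * ν - n by ring,
      show -2 * x = -1 * (2 * x) by ring, mul_pow]
    ring
  have t2 : ∀ n : ℕ,
      Real.Gamma (-ν + 1/2 + n) * Real.Gamma (2*ν - n) * (-2*x)^n / n.factorial =
        Kummer.coeff (1 - (ν + 1 / 2)) (2 - 2 * (ν + 1 / 2)) n * (2 * x) ^ n := fun n => by
    rw [Kummer.coeff, show 1 - (2 - 2 * (ν + 1 / 2)) - (n : ℝ) = 2 * ν - n by ring,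
      show 1 - (ν + 1 / 2) + (n : ℝ) = -ν + 1 / 2 + n by ring,
      show -2 * x = -1 * (2 * x) by ring, mul_pow]
    ring
  simp only [t1, t2]
  refine ⟨(Kummer.summable_coeff ha hb _).abs, (Kummer.summable_coeff ha' hb' _).abs, ?_⟩
  change _ = _ * (_ * Kummer.series _ _ (2 * x) + _ * Kummer.series _ _ (2 * x))
  rw [besselK, Kummer.integral_exp_mul_sq_sub_one_rpow,
    Kummer.tricomiIntegral_eq_connection (by positivity) h2a (by positivity), Kummer.connection]
  have hrefl := Real.Gamma_mul_Gamma_one_sub (ν + 1 / 2)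
  rw [show Real.pi * (ν + 1 / 2) = ν * Real.pi + Real.pi / 2 by ring,
    Real.sin_add_pi_div_two] at hrefl
  have hΓ : Real.Gamma (ν + 1 / 2) ≠ 0 := (Real.Gamma_pos_of_pos (by positivity)).ne'
  have hΓ' : Real.Gamma (1 - (ν + 1 / 2)) ≠ 0 := Real.Gamma_ne_zero fun m h =>
    h2a (2 + 2 * m) (by push_cast; linarith)
  have hcos : Real.cos (ν * Real.pi) ≠ 0 := by
    intro h
    rw [h, div_zero] at hrefl
    exact mul_ne_zero hΓ hΓ' hrefl
  have hpi : Real.sqrt Real.pi ≠ 0 := by positivity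
  have hsq : Real.sqrt Real.pi * Real.sqrt Real.pi = Real.pi :=
    Real.mul_self_sqrt Real.pi_pos.le
  have hconst : Real.cos (ν * Real.pi) / Real.sqrt Real.pi = Real.sqrt Real.pi /
      (Real.Gamma (ν + 1 / 2) * Real.Gamma (1 - (ν + 1 / 2))) := by
    rw [hrefl, div_div_eq_mul_div, div_eq_div_iff hpi Real.pi_ne_zero]
    linear_combination -Real.cos (ν * Real.pi) * hsq
  have e1 : (x / 2) ^ ν * 2 ^ (2 * ν) = 2 ^ ν * x ^ ν := by
    rw [Real.div_rpow hx.le two_pos.le, two_mul, Real.rpow_add two_pos]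
    field_simp
  have e2 : 2 ^ ν * x ^ ν * (2 * x) ^ (1 - 2 * (ν + 1 / 2)) = 2 ^ (-ν) * x ^ (-ν) := by
    rw [← Real.mul_rpow two_pos.le hx.le, ← Real.mul_rpow two_pos.le hx.le,
      ← Real.rpow_add (by positivity)]
    ring_nf
  rw [mul_div_right_comm, hconst, ← e2, ← e1]
  field_simp
end

section
/- Let ν > −1/2 be a real number. Then, as x → ∞, K_ν(x) − √(π/(2x)) e^{−x} [ 1 + (4ν² − 1)/(8x) + (16ν⁴ − 40ν² + 9)/(128 x²) ] = O( e^{−x} x^{−7/2} ). -/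
open Filter Asymptotics

open MeasureTheory Set Real in
/-- Integrating a bound on the derivative of the form `C * u ^ n * exp (L * u)`. -/
theorem abs_le_mul_pow_mul_exp_of_hasDerivAt {f f' : ℝ → ℝ} {C L : ℝ} {n : ℕ} (hC : 0 ≤ C)
    (hL : 0 ≤ L) (hf0 : f 0 = 0) (hf : ∀ u, 0 ≤ u → HasDerivAt f (f' u) u)
    (hb : ∀ u, 0 ≤ u → |f' u| ≤ C * u ^ n * exp (L * u)) {u : ℝ} (hu : 0 ≤ u) :
    |f u| ≤ C * u ^ (n + 1) * exp (L * u) := by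
  have h := norm_image_sub_le_of_norm_deriv_le_segment' (a := 0) (b := u)
    (C := C * u ^ n * exp (L * u)) (fun v hv => (hf v hv.1).hasDerivWithinAt)
    (fun v hv => (hb v hv.1).trans (by have := hv.1; have := hv.2.le; gcongr)) u ⟨hu, le_rfl⟩
  rw [hf0, sub_zero, sub_zero, norm_eq_abs] at h
  exact h.trans_eq (by ring)

open Real in
theorem one_add_rpow_le_exp {b L u : ℝ} (hL : |b| ≤ L) (hu : 0 ≤ u) :
    (1 + u) ^ b ≤ exp (L * u) := by
  have h1 : 0 < 1 + u := by linarith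
  calc (1 + u) ^ b ≤ (1 + u) ^ L :=
        rpow_le_rpow_of_exponent_le (by linarith) ((le_abs_self b).trans hL)
    _ ≤ (exp u) ^ L :=
        rpow_le_rpow h1.le (by linarith [add_one_le_exp u]) ((abs_nonneg b).trans hL)
    _ = exp (L * u) := by rw [← exp_mul, mul_comm]

theorem hasDerivAt_one_add_rpow (b : ℝ) {u : ℝ} (hu : 0 ≤ u) :
    HasDerivAt (fun u : ℝ => (1 + u) ^ b) (b * (1 + u) ^ (b - 1)) u := by
  simpa using ((hasDerivAt_id u).const_add 1).rpow_const (p := b)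
    (Or.inl (by simp only [id]; linarith))

open Real in
/-- Second-order Taylor expansion of `(1 + u) ^ a` on the whole half-line. -/
theorem exists_abs_one_add_rpow_sub_le (a : ℝ) : ∃ C L : ℝ, 0 ≤ C ∧ 0 ≤ L ∧ ∀ u, 0 ≤ u →
    |(1 + u) ^ a - (1 + a * u + a * (a - 1) / 2 * u ^ 2)| ≤ C * u ^ 3 * exp (L * u) := by
  have hL : 0 ≤ |a - 3| := abs_nonneg _
  have h1 : ∀ u, 0 ≤ u → |(1 + u) ^ (a - 2) - 1| ≤ |a - 2| * u ^ 1 * exp (|a - 3| * u) := by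
    intro u hu
    refine abs_le_mul_pow_mul_exp_of_hasDerivAt (n := 0) (f := fun u => (1 + u) ^ (a - 2) - 1)
      (abs_nonneg _) hL (by simp)
      (fun v hv => (hasDerivAt_one_add_rpow (a - 2) hv).sub_const 1) (fun v hv => ?_) hu
    rw [abs_mul, pow_zero, mul_one, abs_of_nonneg (by positivity : 0 ≤ (1 + v) ^ (a - 2 - 1))]
    gcongr
    exact one_add_rpow_le_exp (by ring_nf; rfl) hv
  have h2 : ∀ u, 0 ≤ u → |(1 + u) ^ (a - 1) - 1 - (a - 1) * u| ≤
      |a - 1| * |a - 2| * u ^ 2 * exp (|a - 3| * u) := by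
    intro u hu
    refine abs_le_mul_pow_mul_exp_of_hasDerivAt (n := 1)
      (f := fun u => (1 + u) ^ (a - 1) - 1 - (a - 1) * u) (by positivity) hL (by simp)
      (fun v hv => ((hasDerivAt_one_add_rpow (a - 1) hv).sub_const 1).sub
        ((hasDerivAt_id v).const_mul (a - 1))) (fun v hv => ?_) hu
    rw [← mul_sub, abs_mul, mul_assoc, mul_assoc, show a - 1 - 1 = a - 2 by ring,
      ← mul_assoc |a - 2|]
    gcongr
    exact h1 v hv
  refine ⟨|a| * (|a - 1| * |a - 2|), |a - 3|, by positivity, hL, fun u hu => ?_⟩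
  refine abs_le_mul_pow_mul_exp_of_hasDerivAt (n := 2)
    (f := fun u => (1 + u) ^ a - (1 + a * u + a * (a - 1) / 2 * u ^ 2)) (by positivity) hL (by simp)
    (fun v hv => (hasDerivAt_one_add_rpow a hv).sub
      ((((hasDerivAt_id v).const_mul a).const_add 1).add
        (((hasDerivAt_id v).pow 2).const_mul (a * (a - 1) / 2)))) (fun v hv => ?_) hu
  calc _ = |a * ((1 + v) ^ (a - 1) - 1 - (a - 1) * v)| := by
        congr 1; simp only [id]; push_cast; ring
    _ ≤ |a| * (|a - 1| * |a - 2| * v ^ 2 * exp (|a - 3| * v)) := by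
        rw [abs_mul]; gcongr; exact h2 v hv
    _ = _ := by ring

open MeasureTheory Set Real in
theorem integrableOn_rpow_mul_exp_neg_mul_Ioi {s y : ℝ} (hs : -1 < s) (hy : 0 < y) :
    IntegrableOn (fun u : ℝ => u ^ s * exp (-(y * u))) (Ioi 0) := by
  simpa using integrableOn_rpow_mul_exp_neg_mul_rpow hs one_pos hy

open MeasureTheory Set Real in
theorem integral_rpow_mul_exp_neg_mul_Ioi_eq {s y : ℝ} (hs : -1 < s) (hy : 0 < y) :
    ∫ u in Ioi (0 : ℝ), u ^ s * exp (-(y * u)) = (1 / y) ^ (s + 1) * Gamma (s + 1) := by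
  simpa using integral_rpow_mul_exp_neg_mul_Ioi (a := s + 1) (by linarith) hy

open MeasureTheory Set Real in
/-- Three-term Watson lemma with an explicit remainder bound. -/
theorem abs_laplace_sub_le {a C L y c₀ c₁ c₂ : ℝ} {f : ℝ → ℝ} (ha : -1 < a)
    (hy : 0 < y) (hLy : 2 * L ≤ y) (hfm : Measurable f)
    (hf : ∀ u, 0 ≤ u → |f u - (c₀ + c₁ * u + c₂ * u ^ 2)| ≤ C * u ^ 3 * exp (L * u)) :
    |(∫ u in Ioi (0 : ℝ), u ^ a * exp (-(y * u)) * f u) -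
      (c₀ * ((1 / y) ^ (a + 1) * Gamma (a + 1)) + c₁ * ((1 / y) ^ (a + 2) * Gamma (a + 2)) +
        c₂ * ((1 / y) ^ (a + 3) * Gamma (a + 3)))| ≤
      C * ((1 / (y / 2)) ^ (a + 4) * Gamma (a + 4)) := by
  set w : ℝ → ℝ → ℝ := fun s u => u ^ s * exp (-(y * u)) with hw
  set R : ℝ → ℝ := fun u => u ^ a * exp (-(y * u)) * (f u - (c₀ + c₁ * u + c₂ * u ^ 2)) with hR
  have i0 := integrableOn_rpow_mul_exp_neg_mul_Ioi ha hy
  have i1 := integrableOn_rpow_mul_exp_neg_mul_Ioi (s := a + 1) (by linarith) hy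
  have i2 := integrableOn_rpow_mul_exp_neg_mul_Ioi (s := a + 2) (by linarith) hy
  have i3 := integrableOn_rpow_mul_exp_neg_mul_Ioi (s := a + 3) (y := y / 2) (by linarith)
    (by linarith)
  have e0 : ∫ u in Ioi (0 : ℝ), w a u = _ := integral_rpow_mul_exp_neg_mul_Ioi_eq ha hy
  have e1 : ∫ u in Ioi (0 : ℝ), w (a + 1) u = _ :=
    integral_rpow_mul_exp_neg_mul_Ioi_eq (s := a + 1) (by linarith) hy
  have e2 : ∫ u in Ioi (0 : ℝ), w (a + 2) u = _ :=
    integral_rpow_mul_exp_neg_mul_Ioi_eq (s := a + 2) (by linarith) hy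
  have e3 := integral_rpow_mul_exp_neg_mul_Ioi_eq (s := a + 3) (y := y / 2) (by linarith)
    (by linarith)
  rw [show a + 1 + 1 = a + 2 by ring] at e1
  rw [show a + 2 + 1 = a + 3 by ring] at e2
  rw [show a + 3 + 1 = a + 4 by ring] at e3
  have hRb : ∀ᵐ u ∂volume.restrict (Ioi (0 : ℝ)),
      ‖R u‖ ≤ C * (u ^ (a + 3) * exp (-(y / 2 * u))) := by
    filter_upwards [ae_restrict_mem measurableSet_Ioi] with u hu
    have hu : 0 < u := hu
    have hC : 0 ≤ C * u ^ 3 * exp (L * u) := (abs_nonneg _).trans (hf u hu.le)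
    have hC' : 0 ≤ C := by
      by_contra! hneg
      have : 0 < u ^ 3 * exp (L * u) := by positivity
      nlinarith
    calc ‖R u‖ = u ^ a * exp (-(y * u)) * |f u - (c₀ + c₁ * u + c₂ * u ^ 2)| := by
          rw [hR, norm_eq_abs, abs_mul, abs_of_nonneg (by positivity)]
      _ ≤ u ^ a * exp (-(y * u)) * (C * u ^ 3 * exp (L * u)) := by gcongr; exact hf u hu.le
      _ = C * (u ^ (a + 3) * exp (-(y * u) + L * u)) := by
          rw [exp_add, rpow_add hu, show (3 : ℝ) = (3 : ℕ) by norm_num, rpow_natCast]; ring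
      _ ≤ C * (u ^ (a + 3) * exp (-(y / 2 * u))) := by
          gcongr; nlinarith
  have hRi : IntegrableOn R (Ioi 0) :=
    (i3.const_mul C).mono' (Measurable.aestronglyMeasurable (by fun_prop)) hRb
  have hsplit : ∫ u in Ioi (0 : ℝ), u ^ a * exp (-(y * u)) * f u =
      ∫ u in Ioi (0 : ℝ), (c₀ * w a u + c₁ * w (a + 1) u + c₂ * w (a + 2) u) + R u := by
    refine setIntegral_congr_fun measurableSet_Ioi fun u hu => ?_
    have hu : 0 < u := hu
    simp only [hw, hR]
    rw [rpow_add hu, rpow_add hu, rpow_one, rpow_two]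
    ring
  have j0 : IntegrableOn (fun u => c₀ * w a u) (Ioi 0) := i0.const_mul c₀
  have j1 : IntegrableOn (fun u => c₁ * w (a + 1) u) (Ioi 0) := i1.const_mul c₁
  have j2 : IntegrableOn (fun u => c₂ * w (a + 2) u) (Ioi 0) := i2.const_mul c₂
  have j01 : IntegrableOn (fun u => c₀ * w a u + c₁ * w (a + 1) u) (Ioi 0) := j0.add j1
  have j012 : IntegrableOn (fun u => c₀ * w a u + c₁ * w (a + 1) u + c₂ * w (a + 2) u) (Ioi 0) :=
    j01.add j2
  rw [hsplit, integral_add j012 hRi, integral_add j01 j2, integral_add j0 j1,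
    integral_const_mul, integral_const_mul, integral_const_mul, e0, e1, e2, add_sub_cancel_left,
    ← e3, ← integral_const_mul, ← norm_eq_abs]
  exact norm_integral_le_of_norm_le (i3.const_mul C) hRb

open MeasureTheory Set Real in
theorem integral_Ioi_one_eq_two_mul_integral_Ioi_zero (g : ℝ → ℝ) :
    ∫ t in Ioi (1 : ℝ), g t = 2 * ∫ u in Ioi (0 : ℝ), g (1 + 2 * u) := by
  rw [integral_comp_mul_left_Ioi (fun s => g (1 + s)) 0 two_pos, mul_zero, smul_eq_mul,
    mul_inv_cancel_left₀ two_ne_zero, ← integral_indicator measurableSet_Ioi,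
    ← integral_indicator measurableSet_Ioi,
    ← integral_add_left_eq_self ((Ioi (1 : ℝ)).indicator g) 1]
  congr 1
  ext s
  simp [indicator]

open MeasureTheory Set Real in
theorem besselK_eq_laplace (ν x : ℝ) :
    besselK ν x = (√π / Gamma (ν + 1 / 2)) * (x / 2) ^ ν * (2 * 4 ^ (ν - 1 / 2) * exp (-x)) *
      ∫ u in Ioi (0 : ℝ), u ^ (ν - 1 / 2) * exp (-(2 * x * u)) * (1 + u) ^ (ν - 1 / 2) := by
  have h : ∫ u in Ioi (0 : ℝ),
      exp (-x * (1 + 2 * u)) * ((1 + 2 * u) ^ 2 - 1) ^ (ν - 1 / 2) =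
      4 ^ (ν - 1 / 2) * exp (-x) *
        ∫ u in Ioi (0 : ℝ), u ^ (ν - 1 / 2) * exp (-(2 * x * u)) * (1 + u) ^ (ν - 1 / 2) := by
    rw [← integral_const_mul]
    refine setIntegral_congr_fun measurableSet_Ioi fun u hu => ?_
    have hu : 0 < u := hu
    rw [show (1 + 2 * u) ^ 2 - 1 = 4 * (u * (1 + u)) by ring,
      mul_rpow (by norm_num) (by positivity), mul_rpow hu.le (by positivity),
      show -x * (1 + 2 * u) = -x + -(2 * x * u) by ring, exp_add]
    ring
  rw [besselK, integral_Ioi_one_eq_two_mul_integral_Ioi_zero, h]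
  ring

open Real in
theorem rpow_prefactor_eq {x : ℝ} (ν : ℝ) (hx : 0 < x) :
    √π * (x / 2) ^ ν * (2 * 4 ^ (ν - 1 / 2)) * (1 / (2 * x)) ^ (ν + 1 / 2) = √(π / (2 * x)) := by
  have h4 : (4 : ℝ) ^ (ν - 1 / 2) = 2 ^ (2 * ν - 1) := by
    rw [show (4 : ℝ) = 2 ^ (2 : ℝ) by norm_num, ← rpow_mul (by norm_num)]; ring_nf
  have h2 : (0 : ℝ) < 2 := two_pos
  have hx2 : (x / 2) ^ ν = x ^ ν * 2 ^ (-ν) := by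
    rw [div_rpow hx.le h2.le, rpow_neg h2.le, div_eq_mul_inv]
  have hinv : (1 / (2 * x)) ^ (ν + 1 / 2) = 2 ^ (-(ν + 1 / 2)) * x ^ (-(ν + 1 / 2)) := by
    rw [← mul_rpow h2.le hx.le, rpow_neg (by positivity), one_div (2 * x),
      inv_rpow (by positivity)]
  have hsqrt : √(π / (2 * x)) = √π * (2 ^ (-(1 / 2) : ℝ) * x ^ (-(1 / 2) : ℝ)) := by
    rw [← mul_rpow h2.le hx.le, rpow_neg (by positivity), ← sqrt_eq_rpow, sqrt_div pi_pos.le,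
      div_eq_mul_inv]
  rw [h4, hx2, hinv, hsqrt]
  calc _ = √π * ((2 : ℝ) ^ (-ν) * 2 ^ (1 : ℝ) * 2 ^ (2 * ν - 1) * 2 ^ (-(ν + 1 / 2))) *
        (x ^ ν * x ^ (-(ν + 1 / 2))) := by rw [rpow_one]; ring
    _ = _ := by
      rw [← rpow_add h2, ← rpow_add h2, ← rpow_add h2, ← rpow_add hx]
      ring_nf

/-- For ν > −1/2, as x → ∞,
K_ν(x) − √(π/(2x)) e^{−x} [1 + (4ν² − 1)/(8x) + (16ν⁴ − 40ν² + 9)/(128x²)]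
is O(e^{−x} x^{−7/2}). -/
theorem besselK_asymptotic_three_terms (ν : ℝ) (hν : -1/2 < ν) :
    (fun x : ℝ => besselK ν x -
        Real.sqrt (Real.pi / (2*x)) * Real.exp (-x) *
          (1 + (4*ν^2 - 1)/(8*x) + (16*ν^4 - 40*ν^2 + 9)/(128*x^2)))
      =O[atTop] (fun x : ℝ => Real.exp (-x) * x ^ (-(7:ℝ)/2)) := by
  obtain ⟨C, L, hC, hL, hTaylor⟩ := exists_abs_one_add_rpow_sub_le (ν - 1 / 2)
  have hΓ : 0 < Real.Gamma (ν + 1 / 2) := Real.Gamma_pos_of_pos (by linarith)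
  refine IsBigO.of_bound (Real.sqrt Real.pi / Real.Gamma (ν + 1 / 2) * (1 / 2) ^ ν *
    (2 * 4 ^ (ν - 1 / 2)) * (C * Real.Gamma (ν + 7 / 2))) ?_
  filter_upwards [eventually_ge_atTop L, eventually_gt_atTop 0] with x hLx hx
  have hW := abs_laplace_sub_le (a := ν - 1 / 2) (y := 2 * x) (by linarith) (by linarith)
    (by linarith) (by fun_prop) hTaylor
  set P : ℝ := (Real.sqrt Real.pi / Real.Gamma (ν + 1 / 2)) * (x / 2) ^ ν *
    (2 * 4 ^ (ν - 1 / 2) * Real.exp (-x)) with hP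
  have hP0 : 0 ≤ P := by positivity
  have hG1 : Real.Gamma (ν + 3 / 2) = (ν + 1 / 2) * Real.Gamma (ν + 1 / 2) := by
    rw [← Real.Gamma_add_one (by linarith)]; ring_nf
  have hG2 : Real.Gamma (ν + 5 / 2) = (ν + 3 / 2) * ((ν + 1 / 2) * Real.Gamma (ν + 1 / 2)) := by
    rw [← hG1, ← Real.Gamma_add_one (by linarith)]; ring_nf
  have hy : 0 < 1 / (2 * x) := by positivity
  have hmain : Real.sqrt (Real.pi / (2*x)) * Real.exp (-x) *
          (1 + (4*ν^2 - 1)/(8*x) + (16*ν^4 - 40*ν^2 + 9)/(128*x^2)) =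
      P * (1 * ((1 / (2 * x)) ^ (ν - 1 / 2 + 1) * Real.Gamma (ν - 1 / 2 + 1)) +
        (ν - 1 / 2) * ((1 / (2 * x)) ^ (ν - 1 / 2 + 2) * Real.Gamma (ν - 1 / 2 + 2)) +
        (ν - 1 / 2) * (ν - 1 / 2 - 1) / 2 *
          ((1 / (2 * x)) ^ (ν - 1 / 2 + 3) * Real.Gamma (ν - 1 / 2 + 3))) := by
    rw [show ν - 1 / 2 + 1 = ν + 1 / 2 by ring, show ν - 1 / 2 + 2 = ν + 3 / 2 by ring,
      show ν - 1 / 2 + 3 = ν + 5 / 2 by ring, hG1, hG2,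
      show ν + 3 / 2 = ν + 1 / 2 + 1 by ring, show ν + 5 / 2 = ν + 1 / 2 + 2 by ring,
      Real.rpow_add hy (ν + 1 / 2) 1, Real.rpow_add hy (ν + 1 / 2) 2, Real.rpow_one, Real.rpow_two,
      ← rpow_prefactor_eq ν hx, hP]
    generalize Real.Gamma (ν + 1 / 2) = G at hΓ ⊢
    field_simp
    ring
  rw [besselK_eq_laplace, ← hP, hmain, ← mul_sub, Real.norm_eq_abs, abs_mul, abs_of_nonneg hP0,
    Real.norm_of_nonneg (by positivity)]
  refine (mul_le_mul_of_nonneg_left hW hP0).trans_eq ?_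
  have hxpow : x ^ ν * (1 / x) ^ (ν + 7 / 2) = x ^ (-(7 : ℝ) / 2) := by
    rw [one_div, Real.inv_rpow hx.le, ← Real.rpow_neg hx.le, ← Real.rpow_add hx]
    ring_nf
  rw [hP, show 2 * x / 2 = x by ring, show ν - 1 / 2 + 4 = ν + 7 / 2 by ring, ← hxpow,
    show x / 2 = x * (1 / 2) by ring, Real.mul_rpow hx.le (by norm_num)]
  ring
end

section
/- Let ν > −1/2 be a real number. Then K_ν(x) · e^{x} · √(2x/π) tends to 1 as x → ∞. -/
open Filter

open MeasureTheory Set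

/-- Watson's lemma for the integrand `u ^ a * (1 + u / (2 x)) ^ a`. -/
lemma tendsto_integral_exp_neg_mul_rpow_mul_one_add_div {a : ℝ} (ha : -1 < a) :
    Tendsto (fun x : ℝ => ∫ u in Ioi (0 : ℝ), Real.exp (-u) * u ^ a * (1 + u / (2 * x)) ^ a)
      atTop (nhds (Real.Gamma (a + 1))) := by
  have hG : Real.Gamma (a + 1) = ∫ u in Ioi (0 : ℝ), Real.exp (-u) * u ^ a := by
    rw [Real.Gamma_eq_integral (by linarith)]
    simp
  rw [hG]
  refine tendsto_integral_filter_of_dominated_convergence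
    (fun u => u ^ a * Real.exp (-(1 / 2) * u)) (.of_forall fun x => ?_) ?_ ?_ ?_
  · exact Measurable.aestronglyMeasurable (by fun_prop)
  · filter_upwards [eventually_ge_atTop |a|, eventually_gt_atTop 0] with x hx hx0
    refine (ae_restrict_iff' measurableSet_Ioi).2 (.of_forall fun u (hu : 0 < u) => ?_)
    have h0 : 0 < u / (2 * x) := by positivity
    have hpow : (1 + u / (2 * x)) ^ a ≤ Real.exp (u / 2) := calc
      (1 + u / (2 * x)) ^ a ≤ (1 + u / (2 * x)) ^ |a| :=
        Real.rpow_le_rpow_of_exponent_le (by linarith) (le_abs_self a)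
      _ ≤ Real.exp (u / (2 * x)) ^ |a| := by
        refine Real.rpow_le_rpow (by positivity) ?_ (abs_nonneg a)
        linarith [Real.add_one_le_exp (u / (2 * x))]
      _ = Real.exp (u / (2 * x) * |a|) := (Real.exp_mul _ _).symm
      _ ≤ Real.exp (u / 2) := by
        refine Real.exp_le_exp.2 ?_
        calc u / (2 * x) * |a| ≤ u / (2 * x) * x := by gcongr
          _ = u / 2 := by field_simp
    rw [Real.norm_of_nonneg (by positivity)]
    calc Real.exp (-u) * u ^ a * (1 + u / (2 * x)) ^ a
        ≤ Real.exp (-u) * u ^ a * Real.exp (u / 2) := by gcongr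
      _ = u ^ a * (Real.exp (-u) * Real.exp (u / 2)) := by ring
      _ = u ^ a * Real.exp (-(1 / 2) * u) := by
        rw [← Real.exp_add]
        ring_nf
  · simpa [IntegrableOn] using
      integrableOn_rpow_mul_exp_neg_mul_rpow ha one_pos (half_pos (one_pos (α := ℝ)))
  · refine (ae_restrict_iff' measurableSet_Ioi).2 (.of_forall fun u _ => ?_)
    have h : Tendsto (fun x : ℝ => 1 + u / (2 * x)) atTop (nhds 1) := by
      simpa using tendsto_const_nhds.add
        ((tendsto_id.const_mul_atTop (two_pos (α := ℝ))).const_div_atTop u)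
    simpa using (h.rpow_const (p := a) (.inl one_ne_zero)).const_mul (Real.exp (-u) * u ^ a)

lemma integral_exp_neg_mul_mul_sq_sub_one_rpow {a x : ℝ} (hx : 0 < x) :
    ∫ t in Ioi (1 : ℝ), Real.exp (-x * t) * (t ^ 2 - 1) ^ a =
      Real.exp (-x) * 2 ^ a * x ^ (-(a + 1)) *
        ∫ u in Ioi (0 : ℝ), Real.exp (-u) * u ^ a * (1 + u / (2 * x)) ^ a := by
  have hshift : ∫ t in Ioi (1 : ℝ), Real.exp (-x * t) * (t ^ 2 - 1) ^ a =
      ∫ s in Ioi (0 : ℝ), Real.exp (-x * (s + 1)) * ((s + 1) ^ 2 - 1) ^ a := by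
    have := (measurePreserving_add_right volume (1 : ℝ)).setIntegral_preimage_emb
      (measurableEmbedding_addRight 1)
      (fun t : ℝ => Real.exp (-x * t) * (t ^ 2 - 1) ^ a) (Ioi 1)
    simpa using this.symm
  have hscale := integral_comp_mul_left_Ioi
    (fun u : ℝ => Real.exp (-u) * u ^ a * (1 + u / (2 * x)) ^ a) 0 hx
  rw [mul_zero, smul_eq_mul, inv_mul_eq_div, eq_div_iff hx.ne'] at hscale
  rw [hshift, ← hscale, ← integral_mul_const, ← integral_const_mul]
  refine setIntegral_congr_fun measurableSet_Ioi fun s (hs : 0 < s) => ?_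
  have hsq : (s + 1) ^ 2 - 1 = 2 * s * (1 + x * s / (2 * x)) := by
    field_simp
    ring
  have hexp : Real.exp (-x * (s + 1)) = Real.exp (-x) * Real.exp (-(x * s)) := by
    rw [← Real.exp_add]
    ring_nf
  have hxpow : x ^ (-(a + 1)) * x ^ a * x = 1 := by
    rw [← Real.rpow_add hx, ← Real.rpow_add_one hx.ne']
    simp
  rw [hsq, hexp, Real.mul_rpow (by positivity) (by positivity),
    Real.mul_rpow two_pos.le hs.le, Real.mul_rpow hx.le hs.le]
  linear_combination (-(Real.exp (-x) * Real.exp (-(x * s)) * 2 ^ a * s ^ a *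
    (1 + x * s / (2 * x)) ^ a)) * hxpow

/-- For ν > −1/2, K_ν(x) · e^{x} · √(2x/π) tends to 1 as x → ∞. -/
theorem besselK_leading_asymptotic (ν : ℝ) (hν : -1/2 < ν) :
    Tendsto (fun x : ℝ => besselK ν x * Real.exp x * Real.sqrt (2*x/Real.pi))
      atTop (nhds 1) := by
  have hΓ : 0 < Real.Gamma (ν + 1 / 2) := Real.Gamma_pos_of_pos (by linarith)
  have hlim := (tendsto_integral_exp_neg_mul_rpow_mul_one_add_div
    (a := ν - 1 / 2) (by linarith)).div_const (Real.Gamma (ν + 1 / 2))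
  rw [show ν - 1 / 2 + 1 = ν + 1 / 2 by ring, div_self hΓ.ne'] at hlim
  refine hlim.congr' ?_
  filter_upwards [eventually_gt_atTop 0] with x hx
  have hpi : √Real.pi ≠ 0 := (Real.sqrt_pos.2 Real.pi_pos).ne'
  have hexp : Real.exp (-x) * Real.exp x = 1 := by
    rw [← Real.exp_add]
    simp
  have hxpow : x ^ ν * x ^ (-(ν - 1 / 2 + 1)) * √x = 1 := by
    rw [Real.sqrt_eq_rpow, ← Real.rpow_add hx, ← Real.rpow_add hx]
    ring_nf
    simp
  have h2pow : (2 : ℝ) ^ (ν - 1 / 2) * √2 = 2 ^ ν := by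
    rw [Real.sqrt_eq_rpow, ← Real.rpow_add two_pos]
    ring_nf
  rw [besselK, integral_exp_neg_mul_mul_sq_sub_one_rpow hx, Real.div_rpow hx.le two_pos.le,
    Real.sqrt_div (by positivity), Real.sqrt_mul two_pos.le, ← h2pow]
  generalize (∫ u in Ioi (0 : ℝ),
    Real.exp (-u) * u ^ (ν - 1 / 2) * (1 + u / (2 * x)) ^ (ν - 1 / 2)) = J
  have h2 : (2 : ℝ) ^ (ν - 1 / 2) ≠ 0 := (Real.rpow_pos_of_pos two_pos _).ne'
  have hs2 : √(2 : ℝ) ≠ 0 := by positivity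
  calc J / Real.Gamma (ν + 1 / 2)
      = J / Real.Gamma (ν + 1 / 2) * (x ^ ν * x ^ (-(ν - 1 / 2 + 1)) * √x) *
          (Real.exp (-x) * Real.exp x) := by rw [hxpow, hexp]; ring
    _ = _ := by
      generalize x ^ (-(ν - 1 / 2 + 1)) = y
      generalize (2 : ℝ) ^ (ν - 1 / 2) = z at *
      generalize Real.exp (-x) = e at *
      field_simp
end

section
/- Let ν be a real number with −1/2 < ν and ν not an integer, and let x > 0. Then ∫_x^∞ K_ν(t) dt = (x/2)^{1−ν} Γ(ν − 1) Σ_{n≥0} ( (1/2 − ν/2)_n / ( (1 − ν)_n (3/2 − ν/2)_n n! ) ) (x²/4)^n + (x/2)^{1+ν} Γ(−ν − 1) Σ_{n≥0} ( (1/2 + ν/2)_n / ( (1 + ν)_n (3/2 + ν/2)_n n! ) ) (x²/4)^n + Γ(1/2 + ν/2) Γ(1/2 − ν/2) / 2, where both series converge absolutely for every x > 0 and (a)_n denotes the rising factorial (Pochhammer symbol). -/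
/-- The rising factorial (Pochhammer symbol) (a)_n = a(a+1)⋯(a+n−1). -/
def risingFactorial (a : ℝ) : ℕ → ℝ
  | 0 => 1
  | n + 1 => risingFactorial a n * (a + n)

open Real Set Filter Topology MeasureTheory

lemma hasDerivAt_tsum_mul_pow {a b : ℕ → ℝ} (ha : ∀ r : ℝ, 0 < r → Summable fun n => |a n| * r ^ n)
    (hb : ∀ n : ℕ, b n = (n + 1) * a (n + 1)) (z : ℝ) :
    HasDerivAt (fun z => ∑' n, a n * z ^ n) (∑' n, b n * z ^ n) z := by
  set R : ℝ := |z| + 1 with hR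
  have hR1 : 1 ≤ R := by have := abs_nonneg z; linarith
  have hu : Summable fun n => |a n| * (2 * R) ^ n := ha _ (by linarith)
  have hbound : ∀ n : ℕ, ∀ y ∈ Metric.ball (0 : ℝ) R,
      ‖a n * (n * y ^ (n - 1))‖ ≤ |a n| * (2 * R) ^ n := by
    intro n y hy
    have hy' : |y| ≤ R := by simpa using (mem_ball_zero_iff.mp hy).le
    rw [Real.norm_eq_abs, abs_mul, abs_mul, abs_pow, mul_pow, Nat.abs_cast]
    gcongr
    · exact_mod_cast Nat.lt_two_pow_self.le
    · calc |y| ^ (n - 1) ≤ R ^ (n - 1) := by gcongr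
        _ ≤ R ^ n := pow_le_pow_right₀ hR1 (Nat.sub_le n 1)
  have hz : z ∈ Metric.ball (0 : ℝ) R := by simp [hR]
  have h := hasDerivAt_tsum_of_isPreconnected (g := fun n z => a n * z ^ n)
    (g' := fun n y => a n * (n * y ^ (n - 1))) hu Metric.isOpen_ball
    (convex_ball (0 : ℝ) R).isPreconnected
    (fun n y _ => (hasDerivAt_pow n y).const_mul (a n)) hbound hz
    (by
      refine Summable.of_norm_bounded hu fun n => ?_
      rw [Real.norm_eq_abs, abs_mul, abs_pow]
      gcongr
      linarith) hz
  refine h.congr_deriv ?_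
  rw [Summable.tsum_eq_zero_add (Summable.of_norm_bounded hu fun n => hbound n z hz)]
  simp only [CharP.cast_eq_zero, zero_mul, mul_zero, zero_add]
  refine tsum_congr fun n => ?_
  rw [hb]
  push_cast
  ring

lemma risingFactorial_ne_zero {c : ℝ} (hc : ∀ m : ℕ, c + m ≠ 0) (n : ℕ) :
    risingFactorial c n ≠ 0 := by
  induction n with
  | zero => simp [risingFactorial]
  | succ n ih => exact mul_ne_zero ih (hc n)

lemma risingFactorial_pos {c : ℝ} (hc : 0 < c) (n : ℕ) : 0 < risingFactorial c n := by
  induction n with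
  | zero => simp [risingFactorial]
  | succ n ih => exact mul_pos ih (by positivity)

lemma mul_risingFactorial_add_one (c : ℝ) (n : ℕ) :
    c * risingFactorial (c + 1) n = risingFactorial c n * (c + n) := by
  induction n with
  | zero => simp [risingFactorial]
  | succ n ih =>
    simp only [risingFactorial]
    rw [← mul_assoc, ih]
    push_cast
    ring

/-- The confluent hypergeometric limit function `₀F₁(; c; z)`. -/
noncomputable def hyperZeroOne (c z : ℝ) : ℝ :=
  ∑' n : ℕ, 1 / (risingFactorial c n * n.factorial) * z ^ n

lemma summable_hyperZeroOne {c : ℝ} (hc : ∀ m : ℕ, c + m ≠ 0) (r : ℝ) (hr : 0 < r) :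
    Summable fun n : ℕ => |1 / (risingFactorial c n * n.factorial)| * r ^ n := by
  have hne := risingFactorial_ne_zero hc
  refine summable_of_ratio_test_tendsto_lt_one zero_lt_one
    (Eventually.of_forall fun n => ?_) ?_
  · have := hne n
    positivity
  · have hlim : Tendsto (fun n : ℕ => r * (|c + n|⁻¹ * ((n : ℝ) + 1)⁻¹)) atTop (𝓝 (r * (0 * 0))) := by
      refine Tendsto.const_mul _ (Tendsto.mul ?_ ?_)
      · exact (tendsto_abs_atTop_atTop.comp
          (tendsto_atTop_add_const_left _ _ tendsto_natCast_atTop_atTop)).inv_tendsto_atTop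
      · exact (tendsto_atTop_add_const_right _ _ tendsto_natCast_atTop_atTop).inv_tendsto_atTop
    rw [mul_zero, mul_zero] at hlim
    refine hlim.congr fun n => ?_
    have h1 := abs_ne_zero.mpr (hne n)
    have h2 := abs_ne_zero.mpr (hc n)
    simp only [risingFactorial, Real.norm_eq_abs, abs_mul, abs_div, abs_one, abs_abs, abs_pow,
      abs_of_pos hr, Nat.abs_cast, Nat.factorial_succ, Nat.cast_mul, Nat.cast_add, Nat.cast_one,
      abs_of_nonneg (by positivity : (0 : ℝ) ≤ n + 1)]
    field_simp
    ring

lemma hasDerivAt_hyperZeroOne {c : ℝ} (hc : ∀ m : ℕ, c + m ≠ 0) (z : ℝ) :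
    HasDerivAt (hyperZeroOne c) (hyperZeroOne (c + 1) z / c) z := by
  have hc0 : c ≠ 0 := by simpa using hc 0
  refine (hasDerivAt_tsum_mul_pow (summable_hyperZeroOne hc)
    (b := fun n => 1 / (risingFactorial (c + 1) n * n.factorial) / c) ?_ z).congr_deriv ?_
  rotate_left
  · rw [hyperZeroOne, ← tsum_div_const]
    exact tsum_congr fun n => by ring
  · intro n
    have h1 := risingFactorial_ne_zero hc n
    have h2 := hc n
    rw [div_div, mul_right_comm, mul_comm _ c, mul_risingFactorial_add_one]
    simp only [risingFactorial, Nat.factorial_succ]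
    push_cast
    field_simp

lemma hyperZeroOne_zero (c : ℝ) : hyperZeroOne c 0 = 1 := by
  rw [hyperZeroOne, tsum_eq_single 0 (fun n hn => by simp [hn])]
  simp [risingFactorial]

lemma hyperZeroOne_eq {c : ℝ} (hc : ∀ m : ℕ, c + m ≠ 0) (z : ℝ) (hz : 0 < z) :
    hyperZeroOne c z = hyperZeroOne (c + 1) z + z / (c * (c + 1)) * hyperZeroOne (c + 2) z := by
  have hc1 : ∀ m : ℕ, c + 1 + m ≠ 0 := fun m => by
    have := hc (m + 1); push_cast at this; rwa [add_assoc, add_comm 1]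
  have hc2 : ∀ m : ℕ, c + 2 + m ≠ 0 := fun m => by
    have := hc (m + 2); push_cast at this; rwa [add_assoc, add_comm 2]
  have hs : ∀ d : ℝ, (∀ m : ℕ, d + m ≠ 0) →
      Summable fun n : ℕ => 1 / (risingFactorial d n * n.factorial) * z ^ n := fun d hd =>
    Summable.of_norm_bounded (summable_hyperZeroOne hd z hz) fun n => by
      rw [norm_mul, norm_pow, norm_of_nonneg hz.le, Real.norm_eq_abs]
  have hc0 : c ≠ 0 := by simpa using hc 0
  have hc10 : c + 1 ≠ 0 := by simpa using hc 1
  rw [hyperZeroOne, hyperZeroOne, hyperZeroOne, (hs c hc).tsum_eq_zero_add,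
    (hs _ hc1).tsum_eq_zero_add, ← tsum_mul_left, add_assoc, ← Summable.tsum_add
    ((summable_nat_add_iff 1).mpr (hs _ hc1)) ((hs _ hc2).mul_left _)]
  congr 1
  refine tsum_congr fun n => ?_
  have h1 := risingFactorial_ne_zero hc n
  have h2 := risingFactorial_ne_zero hc1 n
  have h3 := risingFactorial_ne_zero hc2 n
  have h4 := hc n
  have h5 := hc1 n
  have e1 := mul_risingFactorial_add_one c n
  have e2 := mul_risingFactorial_add_one (c + 1) n
  rw [show c + 1 + 1 = c + 2 by ring] at e2
  have e1' : risingFactorial c n = c * risingFactorial (c + 1) n / (c + n) := by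
    rw [e1]; field_simp
  have e2' : risingFactorial (c + 2) n = risingFactorial (c + 1) n * (c + 1 + n) / (c + 1) := by
    rw [← e2]; field_simp
  simp only [risingFactorial, Nat.factorial_succ]
  rw [e1', e2']
  push_cast
  field_simp
  ring

lemma hasDerivAt_rpow_mul_hyperZeroOne {c : ℝ} (hc : ∀ m : ℕ, c + m ≠ 0) (z : ℝ) (hz : 0 < z) :
    HasDerivAt (fun z => z ^ c * hyperZeroOne (c + 1) z) (c * z ^ (c - 1) * hyperZeroOne c z) z := by
  have hc1 : ∀ m : ℕ, c + 1 + m ≠ 0 := fun m => by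
    have := hc (m + 1); push_cast at this; rwa [add_assoc, add_comm 1]
  have hc0 : c ≠ 0 := by simpa using hc 0
  have hc10 : c + 1 ≠ 0 := by simpa using hc 1
  refine ((Real.hasDerivAt_rpow_const (p := c) (Or.inl hz.ne')).fun_mul
    (hasDerivAt_hyperZeroOne hc1 z)).congr_deriv ?_
  rw [hyperZeroOne_eq hc z hz, show c + 1 + 1 = c + 2 by ring, Real.rpow_sub_one hz.ne']
  field_simp

/-- The hypergeometric function `₁F₂(1/2 + ν/2; 1 + ν, 3/2 + ν/2; z)`. -/
noncomputable def hyperOneTwo (ν z : ℝ) : ℝ :=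
  ∑' n : ℕ, risingFactorial (1/2 + ν/2) n /
    (risingFactorial (1 + ν) n * risingFactorial (3/2 + ν/2) n * n.factorial) * z ^ n

lemma hyperOneTwo_coeff {ν : ℝ} (hν : ∀ m : ℕ, 1 + ν + m ≠ 0) (n : ℕ) :
    risingFactorial (1/2 + ν/2) n /
      (risingFactorial (1 + ν) n * risingFactorial (3/2 + ν/2) n * n.factorial) =
    (1 + ν) / (1 + ν + 2 * n) * (1 / (risingFactorial (1 + ν) n * n.factorial)) := by
  have h1 : ∀ m : ℕ, 1/2 + ν/2 + m ≠ 0 := fun m h => hν (2 * m) (by push_cast; linarith)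
  have h10 : 1/2 + ν/2 ≠ 0 := by simpa using h1 0
  have h2 := risingFactorial_ne_zero h1 n
  have h3 := risingFactorial_ne_zero hν n
  have h4 : 1 + ν + 2 * n ≠ 0 := by simpa using hν (2 * n)
  have e := mul_risingFactorial_add_one (1/2 + ν/2) n
  rw [show 1/2 + ν/2 + 1 = 3/2 + ν/2 by ring] at e
  have e' : risingFactorial (3/2 + ν/2) n =
      risingFactorial (1/2 + ν/2) n * (1/2 + ν/2 + n) / (1/2 + ν/2) := by
    rw [← e, mul_div_cancel_left₀ _ h10]
  have h5 := h1 n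
  have h6 : 1 + ν ≠ 0 := by simpa using hν 0
  rw [e', show 1/2 + ν/2 + (n : ℝ) = (1 + ν + 2 * n) / 2 by ring,
    show 1/2 + ν/2 = (1 + ν) / 2 by ring]
  rw [show 1/2 + ν/2 = (1 + ν) / 2 by ring] at h2
  field_simp

lemma summable_hyperOneTwo {ν : ℝ} (hν : ∀ m : ℕ, 1 + ν + m ≠ 0) (r : ℝ) (hr : 0 < r) :
    Summable fun n : ℕ => |risingFactorial (1/2 + ν/2) n /
      (risingFactorial (1 + ν) n * risingFactorial (3/2 + ν/2) n * n.factorial)| * r ^ n := by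
  refine summable_of_isBigO_nat (summable_hyperZeroOne hν r hr) ?_
  have hlim : Tendsto (fun n : ℕ => |(1 + ν) / (1 + ν + 2 * n)|) atTop (𝓝 |0|) :=
    (Tendsto.div_atTop tendsto_const_nhds (tendsto_atTop_add_const_left _ _
      (tendsto_natCast_atTop_atTop.const_mul_atTop two_pos))).abs
  have := (hlim.isBigO_one ℝ).mul (Asymptotics.isBigO_refl
    (fun n : ℕ => |1 / (risingFactorial (1 + ν) n * n.factorial)| * r ^ n) atTop)
  simp only [hyperOneTwo_coeff hν, abs_mul]
  simpa only [one_mul, mul_assoc] using this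

lemma hasDerivAt_rpow_mul_hyperOneTwo {ν : ℝ} (hν : ∀ m : ℕ, 1 + ν + m ≠ 0) (y : ℝ) (hy : 0 < y) :
    HasDerivAt (fun y => y ^ (1 + ν) * hyperOneTwo ν (y ^ 2))
      ((1 + ν) * y ^ ν * hyperZeroOne (1 + ν) (y ^ 2)) y := by
  set a : ℕ → ℝ := fun n => risingFactorial (1/2 + ν/2) n /
    (risingFactorial (1 + ν) n * risingFactorial (3/2 + ν/2) n * n.factorial) with ha
  have hs : Summable fun n => a n * (y ^ 2) ^ n :=
    Summable.of_norm_bounded (summable_hyperOneTwo hν (y ^ 2) (by positivity)) fun n => by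
      rw [norm_mul, norm_pow, norm_of_nonneg (sq_nonneg y), Real.norm_eq_abs]
  have hs' : Summable fun n : ℕ => n * a n * (y ^ 2) ^ n := by
    refine Summable.of_norm_bounded
      (summable_hyperOneTwo hν (2 * y ^ 2) (by positivity)) fun n => ?_
    rw [norm_mul, norm_mul, norm_pow, norm_of_nonneg (sq_nonneg y), Real.norm_eq_abs,
      Real.norm_eq_abs, Nat.abs_cast, mul_comm (n : ℝ), mul_assoc, mul_pow 2]
    gcongr
    exact_mod_cast Nat.lt_two_pow_self.le
  have hd := hasDerivAt_tsum_mul_pow (a := a) (summable_hyperOneTwo hν)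
    (b := fun n => (n + 1) * a (n + 1)) (fun n => rfl) (y ^ 2)
  have hd' := (Real.hasDerivAt_rpow_const (p := 1 + ν) (Or.inl hy.ne')).fun_mul
    (HasDerivAt.comp (h := fun x : ℝ => x ^ 2) y hd (hasDerivAt_pow 2 y))
  have hshift : y ^ 2 * ∑' n : ℕ, ((n : ℝ) + 1) * a (n + 1) * (y ^ 2) ^ n =
      ∑' n : ℕ, n * a n * (y ^ 2) ^ n := by
    rw [hs'.tsum_eq_zero_add, ← tsum_mul_left]
    simp only [CharP.cast_eq_zero, zero_mul, zero_add]
    refine tsum_congr fun n => ?_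
    push_cast
    ring
  have hcomb : (1 + ν) * hyperOneTwo ν (y ^ 2) + 2 * ∑' n : ℕ, n * a n * (y ^ 2) ^ n =
      (1 + ν) * hyperZeroOne (1 + ν) (y ^ 2) := by
    rw [hyperOneTwo, hyperZeroOne, ← tsum_mul_left, ← tsum_mul_left, ← tsum_mul_left,
      ← Summable.tsum_add (hs.mul_left _) (hs'.mul_left _)]
    refine tsum_congr fun n => ?_
    simp only [ha, hyperOneTwo_coeff hν]
    have h4 : 1 + ν + 2 * n ≠ 0 := by simpa using hν (2 * n)
    field_simp
  refine hd'.congr_deriv ?_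
  rw [mul_right_comm (1 + ν) (y ^ ν), ← hcomb, ← hshift, add_sub_cancel_left, Real.rpow_add hy, Real.rpow_one]
  simp only [Function.comp_apply, hyperOneTwo, ha]
  push_cast
  ring

lemma hyperOneTwo_contiguous {μ : ℝ} (hμ : ∀ m : ℕ, μ + m ≠ 0) (z : ℝ) (hz : 0 < z) :
    hyperOneTwo (μ - 1) z + z / ((μ + 1) * (μ + 2)) * hyperOneTwo (μ + 1) z =
      hyperZeroOne (1 + μ) z := by
  have h1 : ∀ m : ℕ, 1 + μ + m ≠ 0 := fun m h => hμ (m + 1) (by push_cast; linarith)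
  have h2 : ∀ m : ℕ, 1 + (μ + 1) + m ≠ 0 := fun m h => hμ (m + 2) (by push_cast; linarith)
  have h3 : ∀ m : ℕ, 1 + (μ - 1) + m ≠ 0 := fun m h => hμ m (by linarith)
  have hs : ∀ ν : ℝ, (∀ m : ℕ, 1 + ν + m ≠ 0) → Summable fun n : ℕ =>
      risingFactorial (1/2 + ν/2) n /
      (risingFactorial (1 + ν) n * risingFactorial (3/2 + ν/2) n * n.factorial) * z ^ n :=
    fun ν hν => Summable.of_norm_bounded (summable_hyperOneTwo hν z hz) fun n => by
      rw [norm_mul, norm_pow, norm_of_nonneg hz.le, Real.norm_eq_abs]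
  have hs0 : Summable fun n : ℕ => 1 / (risingFactorial (1 + μ) n * n.factorial) * z ^ n :=
    Summable.of_norm_bounded (summable_hyperZeroOne h1 z hz) fun n => by
      rw [norm_mul, norm_pow, norm_of_nonneg hz.le, Real.norm_eq_abs]
  have hμ0 : μ ≠ 0 := by simpa using hμ 0
  have hμ1 : μ + 1 ≠ 0 := by simpa using hμ 1
  have hμ2 : μ + 2 ≠ 0 := by simpa using hμ 2
  rw [hyperOneTwo, hyperOneTwo, hyperZeroOne, (hs _ h3).tsum_eq_zero_add, hs0.tsum_eq_zero_add,
    ← tsum_mul_left, add_assoc, ← Summable.tsum_add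
    ((summable_nat_add_iff 1).mpr (hs _ h3)) ((hs _ h2).mul_left _)]
  congr 1
  · simp [risingFactorial]
  refine tsum_congr fun n => ?_
  rw [hyperOneTwo_coeff h2, hyperOneTwo_coeff h3, show 1 + (μ - 1) = μ by ring,
    show 1 + (μ + 1) = μ + 1 + 1 by ring, add_comm 1 μ]
  have g1 := risingFactorial_ne_zero hμ n
  have hμ' : ∀ m : ℕ, μ + 1 + m ≠ 0 := by simpa only [add_comm 1 μ] using h1
  have g2 := risingFactorial_ne_zero hμ' n
  have g4 := hμ n
  have g5 := hμ' n
  have g6 : μ + 2 * (n + 1) ≠ 0 := by have := hμ (2 * (n + 1)); push_cast at this; exact this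
  have e1 := mul_risingFactorial_add_one μ n
  have e2 := mul_risingFactorial_add_one (μ + 1) n
  have e1' : risingFactorial μ n = μ * risingFactorial (μ + 1) n / (μ + n) := by
    rw [e1]; field_simp
  have e2' : risingFactorial (μ + 1 + 1) n = risingFactorial (μ + 1) n * (μ + 1 + n) / (μ + 1) := by
    rw [← e2]; field_simp
  simp only [risingFactorial, Nat.factorial_succ]
  rw [e1', e2']
  push_cast
  rw [show μ + 1 + 1 + 2 * (n : ℝ) = μ + 2 * (n + 1) by ring, show μ + 1 + 1 = μ + 2 by ring]
  field_simp
  ring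

/-- The integral `∫₀^∞ t^(-ν-1) exp(-t - z/t) dt`, which equals `2 z^(-ν/2) K_ν(2√z)`. -/
noncomputable def besselIntegral (ν z : ℝ) : ℝ :=
  ∫ t in Ioi (0 : ℝ), t ^ (-ν - 1) * exp (-t - z / t)

lemma rpow_mul_exp_le (a : ℝ) (m : ℕ) {t z : ℝ} (ht : 0 < t) (hz : 0 < z) :
    t ^ a * exp (-t - z / t) ≤ m.factorial / z ^ m * (exp (-t) * t ^ (a + m)) := by
  have h := Real.pow_div_factorial_le_exp (z / t) (by positivity) m
  rw [div_pow, div_div, div_le_iff₀ (by positivity)] at h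
  rw [sub_eq_add_neg, exp_add, exp_neg (z / t), Real.rpow_add_natCast ht.ne']
  rw [show t ^ a * (exp (-t) * (exp (z / t))⁻¹) = t ^ a * exp (-t) * (exp (z / t))⁻¹ by ring,
    show m.factorial / z ^ m * (exp (-t) * (t ^ a * t ^ m)) =
      t ^ a * exp (-t) * (m.factorial / z ^ m * t ^ m) by ring]
  gcongr
  rw [inv_le_iff_one_le_mul₀ (exp_pos _), div_mul_eq_mul_div, div_mul_eq_mul_div,
    one_le_div (by positivity)]
  linarith

lemma integrableOn_exp_mul_rpow {a : ℝ} (ha : -1 < a) :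
    IntegrableOn (fun t => exp (-t) * t ^ a) (Ioi (0 : ℝ)) := by
  simpa using Real.GammaIntegral_convergent (s := a + 1) (by linarith)

lemma integrableOn_rpow_mul_exp (a : ℝ) {z : ℝ} (hz : 0 < z) :
    IntegrableOn (fun t => t ^ a * exp (-t - z / t)) (Ioi (0 : ℝ)) := by
  obtain ⟨m, hm⟩ := exists_nat_gt (-1 - a)
  refine Integrable.mono' ((integrableOn_exp_mul_rpow (a := a + m) (by linarith)).const_mul
    (m.factorial / z ^ m)) (by fun_prop) ?_
  filter_upwards [ae_restrict_mem measurableSet_Ioi] with t ht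
  have ht : 0 < t := ht
  rw [norm_of_nonneg (by positivity)]
  exact rpow_mul_exp_le a m ht hz

lemma besselIntegral_nonneg (ν z : ℝ) : 0 ≤ besselIntegral ν z :=
  setIntegral_nonneg measurableSet_Ioi fun t ht => by
    have ht : 0 < t := ht
    positivity

lemma besselIntegral_le (ν : ℝ) (m : ℕ) (hm : ν < m) {z : ℝ} (hz : 0 < z) :
    besselIntegral ν z ≤ m.factorial / z ^ m * Gamma (m - ν) := by
  rw [Real.Gamma_eq_integral (by linarith), ← integral_const_mul]
  have hi := Real.GammaIntegral_convergent (s := m - ν) (by linarith)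
  refine setIntegral_mono_on (integrableOn_rpow_mul_exp _ hz) (hi.const_mul _)
    measurableSet_Ioi fun t ht => ?_
  have h := rpow_mul_exp_le (-ν - 1) m ht hz
  rwa [show -ν - 1 + (m : ℝ) = m - ν - 1 by ring] at h

lemma hasDerivAt_besselIntegral (ν : ℝ) {z : ℝ} (hz : 0 < z) :
    HasDerivAt (besselIntegral ν) (-besselIntegral (ν + 1) z) z := by
  have h := hasDerivAt_integral_of_dominated_loc_of_deriv_le (μ := volume.restrict (Ioi (0 : ℝ)))
    (F := fun z t => t ^ (-ν - 1) * exp (-t - z / t))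
    (F' := fun z t => -(t ^ (-(ν + 1) - 1) * exp (-t - z / t)))
    (bound := fun t => t ^ (-(ν + 1) - 1) * exp (-t - (z / 2) / t))
    (s := Ioi (z / 2)) (Ioi_mem_nhds (by linarith : z / 2 < z))
    (Eventually.of_forall fun y => by fun_prop) (integrableOn_rpow_mul_exp _ hz) (by fun_prop)
    ?_ (integrableOn_rpow_mul_exp _ (by linarith)) ?_
  · have h2 := h.2
    rw [integral_neg] at h2
    exact h2
  · filter_upwards [ae_restrict_mem measurableSet_Ioi] with t ht y hy
    have ht : 0 < t := ht
    have hy : z / 2 < y := hy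
    rw [norm_neg, norm_of_nonneg (by positivity)]
    gcongr
  · filter_upwards [ae_restrict_mem measurableSet_Ioi] with t ht y hy
    have ht : 0 < t := ht
    refine ((((hasDerivAt_id y).div_const t).const_sub (-t)).exp.const_mul _).congr_deriv ?_
    rw [show -(ν + 1) - 1 = -ν - 1 - 1 by ring, Real.rpow_sub_one ht.ne' (-ν - 1)]
    simp only [id]
    ring

lemma besselIntegral_neg (ν : ℝ) {z : ℝ} (hz : 0 < z) :
    besselIntegral (-ν) z = z ^ ν * besselIntegral ν z := by
  have h1 := integral_comp_rpow_Ioi (fun t => t ^ (-ν - 1) * exp (-t - z / t))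
    (p := -1) (by norm_num)
  have h2 := integral_comp_mul_left_Ioi (fun t => t ^ (ν - 1) * exp (-t - z / t)) 0 hz
  rw [mul_zero] at h2
  rw [besselIntegral, besselIntegral, ← h1, neg_neg,
    show ∫ t in Ioi (0 : ℝ), t ^ (ν - 1) * exp (-t - z / t) =
      z * (z⁻¹ • ∫ t in Ioi (0 : ℝ), t ^ (ν - 1) * exp (-t - z / t)) by
      rw [smul_eq_mul, mul_inv_cancel_left₀ hz.ne'], ← h2, ← integral_const_mul,
    ← integral_const_mul]
  refine setIntegral_congr_fun measurableSet_Ioi fun t ht => ?_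
  have ht : 0 < t := ht
  have e1 : -(z * t) - z / (z * t) = -t ^ (-1 : ℝ) - z / t ^ (-1 : ℝ) := by
    rw [Real.rpow_neg_one]
    field_simp
    ring
  simp only [smul_eq_mul, abs_neg, abs_one, one_mul]
  rw [e1, Real.mul_rpow hz.le ht.le, ← Real.rpow_mul ht.le, Real.rpow_sub_one hz.ne']
  have e2 : t ^ (ν - 1) = t ^ (-1 - 1 : ℝ) * t ^ (-1 * (-ν - 1)) := by
    rw [← Real.rpow_add ht]
    congr 1
    ring
  rw [e2]
  field_simp

lemma tendsto_besselIntegral_zero {ν : ℝ} (hν : ν < 0) :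
    Tendsto (besselIntegral ν) (𝓝[>] 0) (𝓝 (Gamma (-ν))) := by
  rw [Real.Gamma_eq_integral (by linarith)]
  refine tendsto_integral_filter_of_dominated_convergence (fun t => exp (-t) * t ^ (-ν - 1))
    (Eventually.of_forall fun y => by fun_prop) ?_
    (Real.GammaIntegral_convergent (by linarith)) ?_
  · filter_upwards [self_mem_nhdsWithin] with z hz
    have hz : 0 < z := hz
    filter_upwards [ae_restrict_mem measurableSet_Ioi] with t ht
    have ht : 0 < t := ht
    rw [norm_of_nonneg (by positivity), mul_comm]
    gcongr
    linarith [div_pos hz ht]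
  · filter_upwards with t
    have : ContinuousAt (fun z => t ^ (-ν - 1) * exp (-t - z / t)) 0 := by fun_prop
    refine (this.tendsto.mono_left nhdsWithin_le_nhds).congr' ?_ |>.trans (by simp [mul_comm])
    rfl

/-- The combination of `₀F₁` series that represents `besselIntegral` at noninteger order. -/
noncomputable def besselSeries (ν z : ℝ) : ℝ :=
  Gamma (-ν) * hyperZeroOne (1 + ν) z + Gamma ν * z ^ (-ν) * hyperZeroOne (1 - ν) z

lemma besselSeries_neg (ν : ℝ) {z : ℝ} (hz : 0 < z) :
    besselSeries (-ν) z = z ^ ν * besselSeries ν z := by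
  have : z ^ ν * z ^ (-ν) = 1 := by rw [← Real.rpow_add hz]; simp
  simp only [besselSeries, neg_neg, ← sub_eq_add_neg, sub_neg_eq_add]
  linear_combination (-Gamma ν * hyperZeroOne (1 - ν) z) * this

lemma hasDerivAt_besselSeries {ν : ℝ} (hν : ∀ m : ℤ, ν ≠ m) {z : ℝ} (hz : 0 < z) :
    HasDerivAt (besselSeries ν) (-besselSeries (ν + 1) z) z := by
  have h1 : ∀ m : ℕ, 1 + ν + m ≠ 0 := fun m h => hν (-1 - m) (by push_cast; linarith)
  have h2 : ∀ m : ℕ, -ν + m ≠ 0 := fun m h => hν m (by push_cast; linarith)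
  have h0 : ν ≠ 0 := by simpa using hν 0
  have h10 : 1 + ν ≠ 0 := by simpa using h1 0
  refine (((hasDerivAt_hyperZeroOne h1 z).const_mul (Gamma (-ν))).add
    ((hasDerivAt_rpow_mul_hyperZeroOne h2 z hz).const_mul (Gamma ν))).congr_deriv ?_
    |>.congr_of_eventuallyEq ?_
  · have g1 : Gamma (-ν) = (-ν - 1) * Gamma (-ν - 1) := by
      rw [← Real.Gamma_add_one (by intro h; apply h10; linarith)]; simp
    rw [besselSeries, Real.Gamma_add_one h0, g1, show -(ν + 1) = -ν - 1 by ring,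
      show 1 + (ν + 1) = 1 + ν + 1 by ring, show 1 - (ν + 1) = -ν by ring]
    field_simp
    ring
  · filter_upwards with y
    simp only [besselSeries, Pi.add_apply]
    rw [show -ν + 1 = 1 - ν by ring]
    ring

lemma tendsto_hyperZeroOne_zero {c : ℝ} (hc : ∀ m : ℕ, c + m ≠ 0) :
    Tendsto (hyperZeroOne c) (𝓝[>] 0) (𝓝 1) := by
  have := (hasDerivAt_hyperZeroOne hc 0).continuousAt.tendsto
  rw [hyperZeroOne_zero] at this
  exact this.mono_left nhdsWithin_le_nhds

lemma tendsto_rpow_nhdsGT_zero {a : ℝ} (ha : 0 < a) :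
    Tendsto (fun z : ℝ => z ^ a) (𝓝[>] 0) (𝓝 0) := by
  have := (Real.continuousAt_rpow_const 0 a (Or.inr ha.le)).tendsto
  rw [Real.zero_rpow ha.ne'] at this
  exact this.mono_left nhdsWithin_le_nhds

lemma tendsto_besselSeries_zero {ν : ℝ} (hν : ∀ m : ℤ, ν ≠ m) (h : ν < 0) :
    Tendsto (besselSeries ν) (𝓝[>] 0) (𝓝 (Gamma (-ν))) := by
  have h1 : ∀ m : ℕ, 1 + ν + m ≠ 0 := fun m h => hν (-1 - m) (by push_cast; linarith)
  have h2 : ∀ m : ℕ, 1 - ν + m ≠ 0 := fun m h => hν (1 + m) (by push_cast; linarith)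
  have := ((tendsto_hyperZeroOne_zero h1).const_mul (Gamma (-ν))).add
    (((tendsto_rpow_nhdsGT_zero (neg_pos.mpr h)).const_mul (Gamma ν)).mul
      (tendsto_hyperZeroOne_zero h2))
  simp only [mul_one, mul_zero, add_zero] at this
  exact this

lemma eq_of_hasDerivAt_zero_of_tendsto {f : ℝ → ℝ} {l : ℝ}
    (hf : ∀ z, 0 < z → HasDerivAt f 0 z) (hl : Tendsto f (𝓝[>] 0) (𝓝 l)) (z : ℝ) (hz : 0 < z) :
    f z = l := by
  obtain ⟨a, ha⟩ := isOpen_Ioi.exists_is_const_of_deriv_eq_zero (f := f) (s := Ioi (0 : ℝ))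
    isPreconnected_Ioi (fun z hz => (hf z hz).differentiableAt.differentiableWithinAt)
    (fun z hz => (hf z hz).deriv)
  have : Tendsto f (𝓝[>] 0) (𝓝 a) :=
    tendsto_const_nhds.congr' (by filter_upwards [self_mem_nhdsWithin] with y hy using (ha y hy).symm)
  rw [ha z hz, tendsto_nhds_unique hl this]

lemma hyperZeroOne_pos {c z : ℝ} (hc : 0 < c) (hz : 0 < z) : 0 < hyperZeroOne c z := by
  have hc' : ∀ m : ℕ, c + m ≠ 0 := fun m => by positivity
  have hs : Summable fun n : ℕ => 1 / (risingFactorial c n * n.factorial) * z ^ n :=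
    Summable.of_norm_bounded (summable_hyperZeroOne hc' z hz) fun n => by
      rw [norm_mul, norm_pow, norm_of_nonneg hz.le, Real.norm_eq_abs]
  have hp : ∀ n : ℕ, 0 < 1 / (risingFactorial c n * n.factorial) * z ^ n := fun n => by
    have := risingFactorial_pos hc n
    positivity
  exact hs.tsum_pos (fun n => (hp n).le) 0 (hp 0)

lemma besselIntegral_eq_besselSeries_of_mem_Ioo {ν : ℝ} (h : ν ∈ Ioo (-1 : ℝ) 0) {z : ℝ}
    (hz : 0 < z) : besselIntegral ν z = besselSeries ν z := by
  obtain ⟨hl, hr⟩ := h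
  have hint : ∀ m : ℤ, ν ≠ m := fun m hm => by
    rw [hm] at hl hr
    norm_cast at hl hr
    omega
  have hint' : ∀ m : ℤ, -ν - 1 ≠ m := fun m hm => hint (-1 - m) (by push_cast; linarith)
  have hc : ∀ m : ℕ, 1 + ν + m ≠ 0 := fun m h => hint (-1 - m) (by push_cast; linarith)
  have hc1 : ∀ m : ℕ, 1 + ν + 1 + m ≠ 0 := fun m h => hint (-2 - m) (by push_cast; linarith)
  have hc0 : 1 + ν ≠ 0 := by linarith
  set f := hyperZeroOne (1 + ν)
  set f' : ℝ → ℝ := fun z => hyperZeroOne (1 + ν + 1) z / (1 + ν)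
  set D : ℝ → ℝ := fun z => besselIntegral ν z - besselSeries ν z with hD
  set D' : ℝ → ℝ := fun z => besselIntegral (ν + 1) z - besselSeries (ν + 1) z with hD'
  set E : ℝ → ℝ := fun z => besselIntegral (-ν - 1) z - besselSeries (-ν - 1) z with hE
  set h : ℝ → ℝ := fun z => z ^ (1 + ν) * f' z with hh
  have hf : ∀ z, HasDerivAt f (f' z) z := hasDerivAt_hyperZeroOne hc
  have hDd : ∀ z, 0 < z → HasDerivAt D (-D' z) z := fun z hz =>
    ((hasDerivAt_besselIntegral ν hz).fun_sub (hasDerivAt_besselSeries hint hz)).congr_deriv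
      (by simp only [hD']; ring)
  have hED : ∀ z, 0 < z → E z = z ^ (1 + ν) * D' z := fun z hz => by
    simp only [hE, hD']
    rw [show -ν - 1 = -(ν + 1) by ring, besselIntegral_neg _ hz, besselSeries_neg _ hz,
      add_comm 1 ν]
    ring
  have hEd : ∀ z, 0 < z → HasDerivAt E (-(z ^ ν * D z)) z := fun z hz =>
    ((hasDerivAt_besselIntegral (-ν - 1) hz).fun_sub
      (hasDerivAt_besselSeries hint' hz)).congr_deriv (by
      rw [sub_add_cancel, besselIntegral_neg _ hz, besselSeries_neg _ hz]
      simp only [hD]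
      ring)
  have hhd : ∀ z, 0 < z → HasDerivAt h (z ^ ν * f z) z := fun z hz => by
    refine ((hasDerivAt_rpow_mul_hyperZeroOne hc z hz).div_const (1 + ν)).congr_deriv ?_
      |>.congr_of_eventuallyEq ?_
    · rw [add_sub_cancel_left]
      field_simp
      rfl
    · filter_upwards with y
      simp only [hh, f']
      ring
  have hD0 : Tendsto D (𝓝[>] 0) (𝓝 0) := by
    simpa using (tendsto_besselIntegral_zero hr).sub (tendsto_besselSeries_zero hint hr)
  have hE0 : Tendsto E (𝓝[>] 0) (𝓝 0) := by
    simpa using (tendsto_besselIntegral_zero (ν := -ν - 1) (by linarith)).sub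
      (tendsto_besselSeries_zero hint' (by linarith))
  have hf0 : Tendsto f (𝓝[>] 0) (𝓝 1) := tendsto_hyperZeroOne_zero hc
  have hh0 : Tendsto h (𝓝[>] 0) (𝓝 0) := by
    simpa using (tendsto_rpow_nhdsGT_zero (by linarith : 0 < 1 + ν)).mul
      ((tendsto_hyperZeroOne_zero hc1).div_const (1 + ν))
  have hW : ∀ z, 0 < z → E z * f z + D z * h z = 0 := by
    refine eq_of_hasDerivAt_zero_of_tendsto (f := fun z => E z * f z + D z * h z)
      (fun z hz => ?_) (by simpa using (hE0.mul hf0).add (hD0.mul hh0))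
    refine (((hEd z hz).fun_mul (hf z)).fun_add ((hDd z hz).fun_mul (hhd z hz))).congr_deriv ?_
    rw [hED z hz]
    simp only [hh]
    ring
  have hfpos : ∀ z, 0 < z → 0 < f z := fun z hz => hyperZeroOne_pos (by linarith) hz
  have hQ : D z / f z = 0 := by
    refine eq_of_hasDerivAt_zero_of_tendsto (f := fun z => D z / f z)
      (fun z hz => ?_) (by
        have h := hD0.div hf0 one_ne_zero
        rwa [zero_div] at h) z hz
    refine ((hDd z hz).fun_div (hf z) (hfpos z hz).ne').congr_deriv ?_
    rw [div_eq_zero_iff]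
    left
    have h1 := hW z hz
    rw [hED z hz] at h1
    simp only [hh] at h1
    have h2 : z ^ (1 + ν) ≠ 0 := (Real.rpow_pos_of_pos hz _).ne'
    apply mul_left_cancel₀ h2
    linear_combination -h1
  have h3 : D z = 0 := by
    rcases div_eq_zero_iff.mp hQ with h | h
    · exact h
    · exact absurd h (hfpos z hz).ne'
  exact sub_eq_zero.mp h3

lemma besselIntegral_eq_besselSeries {ν : ℝ} (hν : -1 < ν) (hint : ∀ m : ℤ, ν ≠ m) {z : ℝ}
    (hz : 0 < z) : besselIntegral ν z = besselSeries ν z := by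
  have key : ∀ n : ℕ, ∀ μ : ℝ, μ ∈ Ioo (-1 : ℝ) 0 → ∀ z, 0 < z →
      besselIntegral (μ + n) z = besselSeries (μ + n) z := by
    intro n μ hμ
    induction n with
    | zero => intro z hz; simpa using besselIntegral_eq_besselSeries_of_mem_Ioo hμ hz
    | succ n ih =>
      intro z hz
      have hint : ∀ m : ℤ, μ + n ≠ m := fun m hm => by
        have hl := hμ.1
        have hr := hμ.2
        rw [show μ = ((m - n : ℤ) : ℝ) by push_cast; linarith] at hl hr
        norm_cast at hl hr
        omega
      have h1 := hasDerivAt_besselIntegral (μ + n) hz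
      have h2 := (hasDerivAt_besselSeries hint hz).congr_of_eventuallyEq
        (f₁ := besselIntegral (μ + n)) (by
          filter_upwards [Ioi_mem_nhds hz] with y hy using ih y hy)
      push_cast
      rw [← add_assoc]
      exact neg_injective (h1.unique h2)
  have hfl : -1 ≤ ⌊ν⌋ := Int.le_floor.mpr (by push_cast; exact hν.le)
  obtain ⟨n, hn⟩ := Int.eq_ofNat_of_zero_le (by omega : 0 ≤ ⌊ν⌋ + 1)
  have hn' : (n : ℝ) = ⌊ν⌋ + 1 := by exact_mod_cast hn.symm
  have h1 := key n (ν - n) ⟨?_, ?_⟩ z hz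
  · simpa using h1
  · have := lt_of_le_of_ne (Int.floor_le ν) (hint ⌊ν⌋).symm
    linarith
  · have := Int.lt_floor_add_one ν
    linarith

lemma integral_integral_eq_of_nonneg {f : ℝ → ℝ → ℝ} {g : ℝ → ℝ} {A B : Set ℝ}
    (hA : MeasurableSet A) (hB : MeasurableSet B) (hf : Measurable (Function.uncurry f))
    (h0 : ∀ t ∈ A, ∀ s ∈ B, 0 ≤ f t s) (hi : ∀ s ∈ B, IntegrableOn (fun t => f t s) A)
    (hg : ∀ s ∈ B, ∫ t in A, f t s = g s) (hgi : IntegrableOn g B) :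
    IntegrableOn (fun t => ∫ s in B, f t s) A ∧
      ∫ t in A, ∫ s in B, f t s = ∫ s in B, g s := by
  have hprod : Integrable (Function.uncurry f) ((volume.restrict A).prod (volume.restrict B)) := by
    rw [integrable_prod_iff' hf.aestronglyMeasurable]
    constructor
    · filter_upwards [ae_restrict_mem hB] with s hs using hi s hs
    · refine hgi.congr ?_
      filter_upwards [ae_restrict_mem hB] with s hs
      rw [← hg s hs]
      refine setIntegral_congr_fun hA fun t ht => ?_
      exact (norm_of_nonneg (h0 t ht s hs)).symm
  refine ⟨hprod.integral_prod_left, ?_⟩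
  rw [integral_integral_swap hprod]
  exact setIntegral_congr_fun hB hg

lemma exp_neg_two_mul_sqrt {z : ℝ} (hz : 0 < z) :
    exp (-(2 * √z)) = √z / √π * besselIntegral (1 / 2) z := by
  have hsymm : ∀ z : ℝ, 0 < z →
      besselIntegral (-(1 / 2)) z = √z * besselIntegral (1 / 2) z := fun z hz => by
    rw [besselIntegral_neg _ hz, Real.sqrt_eq_rpow]
  have h : besselIntegral (-(1 / 2)) z * exp (2 * √z) = √π := by
    refine eq_of_hasDerivAt_zero_of_tendsto
      (f := fun z => besselIntegral (-(1 / 2)) z * exp (2 * √z)) (fun z hz => ?_) ?_ z hz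
    · refine ((hasDerivAt_besselIntegral _ hz).fun_mul
        ((Real.hasDerivAt_sqrt hz.ne').const_mul 2).exp).congr_deriv ?_
      have := Real.sqrt_pos.mpr hz
      rw [show -(1 / 2 : ℝ) + 1 = 1 / 2 by norm_num, hsymm z hz]
      field_simp
      ring
    · have h1 := tendsto_besselIntegral_zero (ν := -(1 / 2)) (by norm_num)
      rw [neg_neg, Real.Gamma_one_half_eq] at h1
      have h2 : Tendsto (fun z => exp (2 * √z)) (𝓝[>] 0) (𝓝 1) := by
        have : ContinuousAt (fun z => exp (2 * √z)) 0 := by fun_prop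
        have := this.tendsto.mono_left (nhdsWithin_le_nhds (s := Ioi 0))
        simpa using this
      simpa using h1.mul h2
  rw [hsymm z hz] at h
  have hpi := Real.sqrt_pos.mpr Real.pi_pos
  rw [exp_neg, div_mul_eq_mul_div, eq_div_iff hpi.ne', ← h]
  have := exp_pos (2 * √z)
  field_simp

lemma image_sq_sub_one_Ioi : (fun t : ℝ => t ^ 2 - 1) '' Ioi 1 = Ioi 0 := by
  ext u
  simp only [mem_image, mem_Ioi]
  constructor
  · rintro ⟨t, ht, rfl⟩
    nlinarith
  · intro hu
    exact ⟨√(u + 1), Real.lt_sqrt_of_sq_lt (by linarith), by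
      rw [Real.sq_sqrt (by linarith)]; ring⟩

lemma integral_mul_rpow_sq_sub_one_mul_exp {p b : ℝ} (hp : 0 < p) (hb : 0 < b) :
    ∫ t in Ioi (1 : ℝ), t * (t ^ 2 - 1) ^ (p - 1) * exp (-(b * t ^ 2)) =
      exp (-b) * (1 / b) ^ p * Gamma p / 2 := by
  have h := integral_image_eq_integral_abs_deriv_smul (s := Ioi (1 : ℝ))
    (f := fun t => t ^ 2 - 1) (f' := fun t => 2 * t) measurableSet_Ioi
    (fun t _ => (((hasDerivAt_pow 2 t).sub_const 1).congr_deriv (by simp)).hasDerivWithinAt)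
    (fun a ha c hc h => by
      have ha : 1 < a := ha
      have hc : 1 < c := hc
      have h : a ^ 2 - 1 = c ^ 2 - 1 := h
      nlinarith) (fun u => u ^ (p - 1) * exp (-(b * u)))
  rw [image_sq_sub_one_Ioi, Real.integral_rpow_mul_exp_neg_mul_Ioi hp hb] at h
  rw [mul_assoc, h, ← integral_const_mul, ← integral_div]
  refine setIntegral_congr_fun measurableSet_Ioi fun t ht => ?_
  have ht : 1 < t := ht
  have he : exp (-(b * t ^ 2)) = exp (-b) * exp (-(b * (t ^ 2 - 1))) := by
    rw [← exp_add]
    congr 1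
    ring
  simp only [smul_eq_mul]
  rw [he, abs_of_pos (by linarith)]
  ring

/-- The function `K_ν(x)`, defined for every real order `ν` through `besselIntegral`. -/
noncomputable def macdonald (ν x : ℝ) : ℝ :=
  (x / 2) ^ ν * besselIntegral ν ((x / 2) ^ 2) / 2

lemma besselK_eq_macdonald {ν x : ℝ} (hν : -1/2 < ν) (hx : 0 < x) :
    besselK ν x = macdonald ν x := by
  set y := x / 2 with hy
  have hy0 : 0 < y := by positivity
  have hp : 0 < ν + 1 / 2 := by linarith
  have hpi := Real.sqrt_pos.mpr Real.pi_pos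
  have hG := Real.Gamma_pos_of_pos hp
  have hval : ∀ s ∈ Ioi (0 : ℝ), ∫ t in Ioi (1 : ℝ),
      y / √π * t * (t ^ 2 - 1) ^ (ν - 1/2) * (s ^ (-(1 / 2 : ℝ) - 1) * exp (-s - (y * t) ^ 2 / s)) =
      y ^ (-2 * ν) * Gamma (ν + 1/2) / (2 * √π) * (s ^ (ν - 1) * exp (-s - y ^ 2 / s)) := by
    intro s hs
    have hs : 0 < s := hs
    have h := integral_mul_rpow_sq_sub_one_mul_exp hp (b := y ^ 2 / s) (by positivity)
    have e1 : ∀ t : ℝ, y / √π * t * (t ^ 2 - 1) ^ (ν - 1/2) *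
        (s ^ (-(1 / 2 : ℝ) - 1) * exp (-s - (y * t) ^ 2 / s)) =
        y / √π * s ^ (-(1 / 2 : ℝ) - 1) * exp (-s) *
          (t * (t ^ 2 - 1) ^ (ν + 1/2 - 1) * exp (-(y ^ 2 / s * t ^ 2))) := fun t => by
      rw [show -s - (y * t) ^ 2 / s = -s + -(y ^ 2 / s * t ^ 2) by ring, exp_add,
        show ν + 1/2 - 1 = ν - 1/2 by ring]
      ring
    simp_rw [e1]
    rw [integral_const_mul, h, sub_eq_add_neg (-s), exp_add, one_div_div,
      Real.div_rpow hs.le (by positivity), ← Real.rpow_natCast, ← Real.rpow_mul hy0.le]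
    have e2 : s ^ (ν - 1) = s ^ (-(1 / 2 : ℝ) - 1) * s ^ (ν + 1 / 2) := by
      rw [← Real.rpow_add hs]
      congr 1
      ring
    have e3 : y = y ^ (-2 * ν) * y ^ (((2 : ℕ) : ℝ) * (ν + 1 / 2)) := by
      rw [← Real.rpow_add hy0]
      conv_lhs => rw [← Real.rpow_one y]
      congr 1
      push_cast
      ring
    rw [e2]
    have := Real.rpow_pos_of_pos hy0 (((2 : ℕ) : ℝ) * (ν + 1 / 2))
    conv_lhs => rw [show y / √π = y ^ (-2 * ν) * y ^ (((2 : ℕ) : ℝ) * (ν + 1 / 2)) / √π by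
      rw [← e3]]
    field_simp
  have hswap := integral_integral_eq_of_nonneg
    (f := fun t s => y / √π * t * (t ^ 2 - 1) ^ (ν - 1/2) *
      (s ^ (-(1 / 2 : ℝ) - 1) * exp (-s - (y * t) ^ 2 / s)))
    (g := fun s => y ^ (-2 * ν) * Gamma (ν + 1/2) / (2 * √π) *
      (s ^ (ν - 1) * exp (-s - y ^ 2 / s)))
    (measurableSet_Ioi (a := (1 : ℝ))) (measurableSet_Ioi (a := (0 : ℝ)))
    (by fun_prop) ?_ ?_ hval ((integrableOn_rpow_mul_exp _ (by positivity)).const_mul _)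
  · have hker : ∀ t ∈ Ioi (1 : ℝ), exp (-x * t) * (t ^ 2 - 1) ^ (ν - 1/2) =
        ∫ s in Ioi (0 : ℝ), y / √π * t * (t ^ 2 - 1) ^ (ν - 1/2) *
          (s ^ (-(1 / 2 : ℝ) - 1) * exp (-s - (y * t) ^ 2 / s)) := by
      intro t ht
      have ht : 0 < t := zero_lt_one.trans ht
      have h := exp_neg_two_mul_sqrt (z := (y * t) ^ 2) (by positivity)
      rw [Real.sqrt_sq (by positivity), show -(2 * (y * t)) = -x * t by rw [hy]; ring,
        besselIntegral] at h
      rw [integral_const_mul, h]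
      ring
    have hneg := besselIntegral_neg ν (z := y ^ 2) (by positivity)
    rw [besselIntegral, neg_neg] at hneg
    rw [besselK, setIntegral_congr_fun measurableSet_Ioi hker, hswap.2, integral_const_mul, hneg,
      macdonald, ← hy, ← Real.rpow_natCast, ← Real.rpow_mul hy0.le]
    have e : y ^ (-2 * ν) * y ^ (((2 : ℕ) : ℝ) * ν) = 1 := by
      rw [← Real.rpow_add hy0]
      simp
    calc _ = y ^ ν * besselIntegral ν (y ^ ((2 : ℕ) : ℝ)) / 2 *
          (y ^ (-2 * ν) * y ^ (((2 : ℕ) : ℝ) * ν)) := by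
          generalize Gamma (ν + 1 / 2) = g at hG
          field_simp
      _ = _ := by rw [e, mul_one]
  · intro t ht s hs
    have ht : 1 < t := ht
    have hs : 0 < s := hs
    have : 0 < t ^ 2 - 1 := by nlinarith
    positivity
  · intro s hs
    refine Integrable.of_integral_ne_zero ?_
    rw [hval s hs]
    have hs : 0 < s := hs
    positivity

lemma macdonald_nonneg {ν x : ℝ} (hx : 0 < x) : 0 ≤ macdonald ν x := by
  have := besselIntegral_nonneg ν ((x / 2) ^ 2)
  unfold macdonald
  positivity

lemma integral_macdonald {ν : ℝ} (h1 : -1 < ν) (h2 : ν < 1) :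
    IntegrableOn (macdonald ν) (Ioi 0) ∧
      ∫ x in Ioi 0, macdonald ν x = Gamma (1/2 + ν/2) * Gamma (1/2 - ν/2) / 2 := by
  have hG := Real.Gamma_pos_of_pos (by linarith : 0 < 1/2 + ν/2)
  have hval : ∀ t ∈ Ioi (0 : ℝ), ∫ x in Ioi (0 : ℝ),
      (x / 2) ^ ν / 2 * (t ^ (-ν - 1) * exp (-t - (x / 2) ^ 2 / t)) =
      Gamma (1/2 + ν/2) / 2 * (exp (-t) * t ^ (1/2 - ν/2 - 1)) := by
    intro t ht
    have ht : 0 < t := ht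
    have h := integral_rpow_mul_exp_neg_mul_rpow (p := 2) (q := ν) (b := 1 / (4 * t)) two_pos h1
      (by positivity)
    have e1 : ∀ x ∈ Ioi (0 : ℝ), (x / 2) ^ ν / 2 * (t ^ (-ν - 1) * exp (-t - (x / 2) ^ 2 / t)) =
        t ^ (-ν - 1) * exp (-t) / (2 * 2 ^ ν) *
          (x ^ ν * exp (-(1 / (4 * t)) * x ^ (2 : ℝ))) := fun x hx => by
      have hx : 0 < x := hx
      rw [show -t - (x / 2) ^ 2 / t = -t + -(1 / (4 * t)) * x ^ 2 by field_simp; ring, exp_add,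
        Real.div_rpow hx.le two_pos.le, Real.rpow_two]
      field_simp
    rw [setIntegral_congr_fun measurableSet_Ioi e1, integral_const_mul, h,
      show (ν + 1) / 2 = 1/2 + ν/2 by ring, one_div (4 * t), Real.inv_rpow (by positivity),
      ← Real.rpow_neg (by positivity), show -(-(ν + 1) / 2) = (ν + 1) / 2 by ring,
      Real.mul_rpow (by norm_num) ht.le,
      show (4 : ℝ) = 2 ^ (2 : ℝ) by norm_num, ← Real.rpow_mul two_pos.le,
      show 2 * ((ν + 1) / 2) = ν + 1 by ring, Real.rpow_add_one two_ne_zero]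
    have e2 : t ^ (1/2 - ν/2 - 1) = t ^ (-ν - 1) * t ^ ((ν + 1) / 2) := by
      rw [← Real.rpow_add ht]
      congr 1
      ring
    rw [e2]
    field_simp
  have hgam := Real.GammaIntegral_convergent (s := 1/2 - ν/2) (by linarith)
  have hswap := integral_integral_eq_of_nonneg
    (f := fun x t => (x / 2) ^ ν / 2 * (t ^ (-ν - 1) * exp (-t - (x / 2) ^ 2 / t)))
    (g := fun t => Gamma (1/2 + ν/2) / 2 * (exp (-t) * t ^ (1/2 - ν/2 - 1)))
    (measurableSet_Ioi (a := (0 : ℝ))) (measurableSet_Ioi (a := (0 : ℝ)))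
    (by fun_prop) (fun x hx t ht => ?_) (fun t ht => ?_) hval (hgam.const_mul _)
  · have hm : ∀ x, ∫ t in Ioi (0 : ℝ), (x / 2) ^ ν / 2 *
        (t ^ (-ν - 1) * exp (-t - (x / 2) ^ 2 / t)) = macdonald ν x := fun x => by
      rw [integral_const_mul, macdonald, besselIntegral]
      ring
    simp only [hm] at hswap
    refine ⟨hswap.1, ?_⟩
    rw [hswap.2, integral_const_mul, Real.Gamma_eq_integral (by linarith : 0 < 1/2 - ν/2)]
    ring
  · have hx : 0 < x := hx
    have ht : 0 < t := ht
    positivity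
  · refine Integrable.of_integral_ne_zero ?_
    rw [hval t ht]
    have ht : 0 < t := ht
    positivity

lemma hasDerivAt_macdonald (ν : ℝ) {x : ℝ} (hx : 0 < x) :
    HasDerivAt (macdonald ν) (-(macdonald (ν + 1) x + macdonald (ν - 1) x) / 2) x := by
  have hy : 0 < x / 2 := by positivity
  have hz : 0 < (x / 2) ^ 2 := by positivity
  have hrec : ∀ z : ℝ, 0 < z →
      besselIntegral (ν - 1) z = z * besselIntegral (ν + 1) z - ν * besselIntegral ν z := by
    intro z hz
    have h1 := hasDerivAt_besselIntegral (-ν) hz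
    have h2 := ((Real.hasDerivAt_rpow_const (p := ν) (Or.inl hz.ne')).fun_mul
      (hasDerivAt_besselIntegral ν hz)).congr_of_eventuallyEq (f₁ := besselIntegral (-ν)) (by
        filter_upwards [Ioi_mem_nhds hz] with y hy using besselIntegral_neg ν hy)
    have h3 := h1.unique h2
    rw [show -ν + 1 = -(ν - 1) by ring, besselIntegral_neg _ hz, Real.rpow_sub_one hz.ne'] at h3
    have hp := (Real.rpow_pos_of_pos hz ν).ne'
    field_simp at h3
    linarith
  have hd2 : HasDerivAt (fun x : ℝ => x / 2) (1 / 2) x := (hasDerivAt_id x).div_const 2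
  have hd := ((hd2.rpow_const (p := ν) (Or.inl hy.ne')).fun_mul
    (HasDerivAt.comp (h := fun x : ℝ => (x / 2) ^ 2) x (hasDerivAt_besselIntegral ν hz)
      (hd2.pow 2))).div_const 2
  refine hd.congr_deriv ?_
  simp only [macdonald, Function.comp_apply]
  rw [hrec _ hz, Real.rpow_add_one hy.ne', Real.rpow_sub_one hy.ne']
  push_cast
  field_simp
  ring

lemma tendsto_macdonald_atTop (ν : ℝ) : Tendsto (macdonald ν) atTop (𝓝 0) := by
  obtain ⟨m, hm⟩ := exists_nat_gt |ν|
  have h1 : ν < m := (le_abs_self ν).trans_lt hm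
  have h2 : 0 < 2 * m - ν := by have := abs_nonneg ν; linarith
  have hlim : Tendsto (fun x : ℝ => (x / 2) ^ (-(2 * m - ν)) * (m.factorial * Gamma (m - ν) / 2))
      atTop (𝓝 0) := by
    simpa using ((tendsto_rpow_neg_atTop h2).comp
      (tendsto_id.atTop_div_const two_pos)).mul_const (m.factorial * Gamma (m - ν) / 2)
  refine squeeze_zero' ?_ ?_ hlim
  · filter_upwards [eventually_gt_atTop 0] with x hx using macdonald_nonneg hx
  · filter_upwards [eventually_gt_atTop 0] with x hx
    have hy : 0 < x / 2 := by positivity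
    have h := besselIntegral_le ν m h1 (z := (x / 2) ^ 2) (by positivity)
    calc macdonald ν x ≤ (x / 2) ^ ν *
          (m.factorial / ((x / 2) ^ 2) ^ m * Gamma (m - ν)) / 2 := by
          unfold macdonald
          gcongr
      _ = _ := by
        rw [show -(2 * m - ν) = ν - (2 * m : ℕ) by push_cast; ring, Real.rpow_sub hy,
          Real.rpow_natCast, pow_mul]
        field_simp

/-- The series part of the primitive of `-K_ν`. -/
noncomputable def macdonaldPrimitive (ν x : ℝ) : ℝ :=
  (x/2) ^ (1 - ν) * Gamma (ν - 1) * hyperOneTwo (-ν) ((x/2) ^ 2) +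
    (x/2) ^ (1 + ν) * Gamma (-ν - 1) * hyperOneTwo ν ((x/2) ^ 2)

lemma hasDerivAt_macdonaldPrimitive {ν : ℝ} (hν : -1 < ν) (hint : ∀ m : ℤ, ν ≠ m) {x : ℝ}
    (hx : 0 < x) : HasDerivAt (macdonaldPrimitive ν) (-macdonald ν x) x := by
  have hy : 0 < x / 2 := by positivity
  have h1 : ∀ m : ℕ, 1 + ν + m ≠ 0 := fun m h => hint (-1 - m) (by push_cast; linarith)
  have h2 : ∀ m : ℕ, 1 + -ν + m ≠ 0 := fun m h => hint (1 + m) (by push_cast; linarith)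
  have hd2 : HasDerivAt (fun x : ℝ => x / 2) (1 / 2) x := (hasDerivAt_id x).div_const 2
  have d1 := (HasDerivAt.comp (h := fun x : ℝ => x / 2) x
    (hasDerivAt_rpow_mul_hyperOneTwo h1 (x / 2) hy) hd2).const_mul (Gamma (-ν - 1))
  have d2 := (HasDerivAt.comp (h := fun x : ℝ => x / 2) x
    (hasDerivAt_rpow_mul_hyperOneTwo h2 (x / 2) hy) hd2).const_mul (Gamma (ν - 1))
  refine ((d2.fun_add d1).congr_deriv ?_).congr_of_eventuallyEq ?_
  · have g1 : Gamma (-ν) = (-ν - 1) * Gamma (-ν - 1) := by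
      rw [← Real.Gamma_add_one (by intro h; linarith)]; simp
    have g2 : Gamma ν = (ν - 1) * Gamma (ν - 1) := by
      rw [← Real.Gamma_add_one (by intro h; exact hint 1 (by push_cast; linarith))]; simp
    have e : (x / 2) ^ (-ν) = (x / 2) ^ ν * ((x / 2) ^ 2) ^ (-ν) := by
      rw [← Real.rpow_natCast, ← Real.rpow_mul hy.le, ← Real.rpow_add hy]
      congr 1
      push_cast
      ring
    rw [macdonald, besselIntegral_eq_besselSeries hν hint (by positivity), besselSeries, g1, g2, e,
      ← sub_eq_add_neg]
    ring
  · filter_upwards with y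
    simp only [macdonaldPrimitive, Function.comp_apply, ← sub_eq_add_neg]
    ring

lemma tendsto_macdonaldPrimitive_zero {ν : ℝ} (hint : ∀ m : ℤ, ν ≠ m) (hl : -1 < ν) (hr : ν < 1) :
    Tendsto (macdonaldPrimitive ν) (𝓝[>] 0) (𝓝 0) := by
  have h1 : ∀ m : ℕ, 1 + ν + m ≠ 0 := fun m h => hint (-1 - m) (by push_cast; linarith)
  have h2 : ∀ m : ℕ, 1 + -ν + m ≠ 0 := fun m h => hint (1 + m) (by push_cast; linarith)
  have hS : ∀ μ : ℝ, (∀ m : ℕ, 1 + μ + m ≠ 0) → ContinuousAt (hyperOneTwo μ) ((0 / 2) ^ 2) :=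
    fun μ hμ => (hasDerivAt_tsum_mul_pow (summable_hyperOneTwo hμ) (fun _ => rfl) _).continuousAt
  have hsq : ContinuousAt (fun x : ℝ => (x / 2) ^ 2) 0 := by fun_prop
  have c1 := ContinuousAt.comp (f := fun x : ℝ => (x / 2) ^ 2) (hS _ h1) hsq
  have c2 := ContinuousAt.comp (f := fun x : ℝ => (x / 2) ^ 2) (hS _ h2) hsq
  have hr : ∀ a : ℝ, 0 < a → ContinuousAt (fun x : ℝ => (x / 2) ^ a) 0 := fun a ha =>
    ContinuousAt.rpow_const (by fun_prop) (Or.inr ha.le)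
  have hc := ((((hr (1 - ν) (by linarith)).mul_const (Gamma (ν - 1))).mul c2).add
    (((hr (1 + ν) (by linarith)).mul_const (Gamma (-ν - 1))).mul c1)).tendsto.mono_left
      (nhdsWithin_le_nhds (s := Ioi 0))
  have n1 : 1 - ν ≠ 0 := by linarith
  have n2 : 1 + ν ≠ 0 := by linarith
  have h0 : macdonaldPrimitive ν 0 = 0 := by
    simp [macdonaldPrimitive, Real.zero_rpow n1, Real.zero_rpow n2]
  have h : Tendsto (macdonaldPrimitive ν) (𝓝[>] 0) (𝓝 (macdonaldPrimitive ν 0)) := hc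
  rwa [h0] at h

lemma integral_Ioi_macdonald_of_mem_Ioo {ν : ℝ} (hint : ∀ m : ℤ, ν ≠ m) (hl : -1 < ν) (hr : ν < 1)
    {x : ℝ} (hx : 0 < x) : IntegrableOn (macdonald ν) (Ioi x) ∧ ∫ t in Ioi x, macdonald ν t =
      macdonaldPrimitive ν x + Gamma (1/2 + ν/2) * Gamma (1/2 - ν/2) / 2 := by
  obtain ⟨hi, hval⟩ := integral_macdonald hl hr
  have hix : IntegrableOn (macdonald ν) (Ioi x) := hi.mono_set (Ioi_subset_Ioi hx.le)
  refine ⟨hix, ?_⟩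
  have hic : IntegrableOn (macdonald ν) (Ioc 0 x) := hi.mono_set Ioc_subset_Ioi_self
  have hftc := intervalIntegral.integral_eq_sub_of_hasDerivAt_of_tendsto hx
    (f := fun t => -macdonaldPrimitive ν t) (f' := macdonald ν)
    (fun t ht => ((hasDerivAt_macdonaldPrimitive hl hint ht.1).fun_neg).congr_deriv (neg_neg _))
    ((intervalIntegrable_iff_integrableOn_Ioc_of_le hx.le).mpr hic)
    (tendsto_macdonaldPrimitive_zero hint hl hr).neg
    ((hasDerivAt_macdonaldPrimitive hl hint hx).continuousAt.neg.tendsto.mono_left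
      nhdsWithin_le_nhds)
  rw [intervalIntegral.integral_of_le hx.le] at hftc
  have hsplit := setIntegral_union (Ioc_disjoint_Ioi le_rfl) measurableSet_Ioi hic hix
  rw [Ioc_union_Ioi_eq_Ioi hx.le, hval, hftc, Pi.neg_apply] at hsplit
  linarith

lemma macdonaldPrimitive_add {ν : ℝ} (hν : -1 < ν) (hint : ∀ m : ℤ, ν ≠ m) {x : ℝ} (hx : 0 < x) :
    macdonaldPrimitive (ν + 1) x + macdonaldPrimitive (ν - 1) x = 2 * macdonald ν x := by
  have hy : 0 < x / 2 := by positivity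
  have hz : 0 < (x / 2) ^ 2 := by positivity
  have h1 : ∀ m : ℕ, ν + m ≠ 0 := fun m h => hint (-m) (by push_cast; linarith)
  have h2 : ∀ m : ℕ, -ν + m ≠ 0 := fun m h => hint m (by push_cast; linarith)
  have n1 : ν ≠ 1 := by exact_mod_cast hint 1
  have n2 : ν ≠ 2 := by exact_mod_cast hint 2
  have n3 : ν ≠ -2 := by exact_mod_cast hint (-2)
  have n4 : ν ≠ -1 := by exact_mod_cast hint (-1)
  have g : ∀ μ : ℝ, μ ≠ -1 → μ ≠ -2 → Gamma (-μ) = (μ + 1) * (μ + 2) * Gamma (-μ - 2) := by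
    intro μ h1 h2
    have e1 := Real.Gamma_add_one (s := -μ - 2) (by intro h; apply h2; linarith)
    have e2 := Real.Gamma_add_one (s := -μ - 2 + 1) (by intro h; apply h1; linarith)
    rw [show -μ - 2 + 1 + 1 = -μ by ring, e1] at e2
    rw [e2]
    ring
  have g1 := g ν n4 n3
  have g2 := g (-ν) (fun h => n1 (by linarith)) (fun h => n2 (by linarith))
  have c1 := hyperOneTwo_contiguous h1 _ hz
  have c2 := hyperOneTwo_contiguous h2 _ hz
  have e : (x / 2) ^ (-ν) = (x / 2) ^ ν * ((x / 2) ^ 2) ^ (-ν) := by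
    rw [← Real.rpow_natCast, ← Real.rpow_mul hy.le, ← Real.rpow_add hy]
    congr 1
    push_cast
    ring
  rw [macdonald, besselIntegral_eq_besselSeries hν hint hz, besselSeries, sub_eq_add_neg 1 ν,
    ← c1, ← c2, macdonaldPrimitive, macdonaldPrimitive]
  rw [show 1 - (ν + 1) = -ν by ring, show ν + 1 - 1 = ν by ring, show 1 + (ν + 1) = ν + 2 by ring,
    show 1 - (ν - 1) = -ν + 2 by ring, show 1 + (ν - 1) = ν by ring,
    show -(ν + 1) - 1 = -ν - 2 by ring, show ν - 1 - 1 = ν - 2 by ring,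
    show -(ν - 1) - 1 = -ν by ring, show -(ν + 1) = -ν - 1 by ring,
    show -(ν - 1) = -ν + 1 by ring, Real.rpow_add hy, Real.rpow_add hy, Real.rpow_two, e]
  rw [neg_neg] at g2
  rw [g1, g2]
  have m1 : ν + 1 ≠ 0 := fun h => n4 (by linarith)
  have m2 : ν + 2 ≠ 0 := fun h => n3 (by linarith)
  have m3 : -ν + 1 ≠ 0 := fun h => n1 (by linarith)
  have m4 : -ν + 2 ≠ 0 := fun h => n2 (by linarith)
  field_simp
  ring

lemma integral_Ioi_macdonald {ν : ℝ} (hν : -1 < ν) (hint : ∀ m : ℤ, ν ≠ m) {x : ℝ} (hx : 0 < x) :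
    ∫ t in Ioi x, macdonald ν t =
      macdonaldPrimitive ν x + Gamma (1/2 + ν/2) * Gamma (1/2 - ν/2) / 2 := by
  have key : ∀ n : ℕ, ∀ μ : ℝ, (∀ m : ℤ, μ ≠ m) → -1 < μ → μ < 1 →
      IntegrableOn (macdonald (μ + 2 * n)) (Ioi x) ∧ ∫ t in Ioi x, macdonald (μ + 2 * n) t =
      macdonaldPrimitive (μ + 2 * n) x +
        Gamma (1/2 + (μ + 2 * n)/2) * Gamma (1/2 - (μ + 2 * n)/2) / 2 := by
    intro n μ hμ hl hr
    induction n with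
    | zero => simpa using integral_Ioi_macdonald_of_mem_Ioo hμ hl hr hx
    | succ n ih =>
      set ρ : ℝ := μ + 2 * n + 1 with hρ
      have hρint : ∀ m : ℤ, ρ ≠ m := fun m h => hμ (m - 2 * n - 1) (by push_cast; linarith)
      have hn : (0 : ℝ) ≤ n := n.cast_nonneg
      rw [show μ + 2 * (n : ℝ) = ρ - 1 by rw [hρ]; ring] at ih
      rw [show μ + 2 * ((n + 1 : ℕ) : ℝ) = ρ + 1 by rw [hρ]; push_cast; ring]
      obtain ⟨ih1, ih2⟩ := ih
      have hd : ∀ t ∈ Ici x, HasDerivAt (fun t => 2 * macdonald ρ t)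
          (-(macdonald (ρ + 1) t + macdonald (ρ - 1) t)) t := fun t ht =>
        ((hasDerivAt_macdonald ρ (hx.trans_le ht)).const_mul 2).congr_deriv (by ring)
      have hneg : ∀ t ∈ Ioi x, -(macdonald (ρ + 1) t + macdonald (ρ - 1) t) ≤ 0 := fun t ht => by
        have h1 := macdonald_nonneg (ν := ρ + 1) (hx.trans ht)
        have h2 := macdonald_nonneg (ν := ρ - 1) (hx.trans ht)
        linarith
      have hlim : Tendsto (fun t => 2 * macdonald ρ t) atTop (𝓝 0) := by
        simpa using (tendsto_macdonald_atTop ρ).const_mul 2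
      have hsum := (integrableOn_Ioi_deriv_of_nonpos' hd hneg hlim).neg
      have hval := integral_Ioi_of_hasDerivAt_of_nonpos' hd hneg hlim
      have hi : IntegrableOn (macdonald (ρ + 1)) (Ioi x) := by
        refine (hsum.sub ih1).congr ?_
        filter_upwards with t
        simp
      refine ⟨hi, ?_⟩
      rw [integral_neg, integral_add hi ih1, ih2] at hval
      have hG := macdonaldPrimitive_add (by linarith : -1 < ρ) hρint hx
      have g1 := Real.Gamma_add_one (s := ρ / 2) (by
        intro h; exact hρint 0 (by push_cast; linarith))
      have g2 := Real.Gamma_add_one (s := -ρ / 2) (by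
        intro h; exact hρint 0 (by push_cast; linarith))
      rw [show 1/2 + (ρ - 1)/2 = ρ / 2 by ring, show 1/2 - (ρ - 1)/2 = -ρ / 2 + 1 by ring,
        g2] at hval
      rw [show 1/2 + (ρ + 1)/2 = ρ / 2 + 1 by ring, show 1/2 - (ρ + 1)/2 = -ρ / 2 by ring, g1]
      linarith
  have hfl : 0 ≤ ⌊(ν + 1) / 2⌋ := Int.floor_nonneg.mpr (by linarith)
  obtain ⟨n, hn⟩ := Int.eq_ofNat_of_zero_le hfl
  have hn' : ((⌊(ν + 1) / 2⌋ : ℤ) : ℝ) = n := by rw [hn]; rfl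
  have h1 := Int.floor_le ((ν + 1) / 2)
  have h2 := Int.lt_floor_add_one ((ν + 1) / 2)
  rw [hn'] at h1 h2
  have h3 : ν ≠ 2 * n - 1 := by exact_mod_cast hint (2 * n - 1)
  have h4 : 2 * (n : ℝ) - 1 < ν := lt_of_le_of_ne (by linarith) h3.symm
  have h := (key n (ν - 2 * n) (fun m h => hint (m + 2 * n) (by push_cast; linarith))
    (by linarith) (by linarith)).2
  simpa using h

/-- For −1/2 < ν with ν not an integer and x > 0, the tail integral
∫_x^∞ K_ν(t) dt equals the stated combination of two hypergeometric series (both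
absolutely convergent) plus the constant Γ(1/2 + ν/2) Γ(1/2 − ν/2) / 2. -/
theorem integral_besselK_eq (ν x : ℝ) (hν : -1/2 < ν) (hint : ∀ m : ℤ, ν ≠ (m : ℝ))
    (hx : 0 < x) :
    Summable (fun n : ℕ =>
      |risingFactorial (1/2 - ν/2) n /
        (risingFactorial (1 - ν) n * risingFactorial (3/2 - ν/2) n * n.factorial) *
          (x^2/4)^n|) ∧
    Summable (fun n : ℕ =>
      |risingFactorial (1/2 + ν/2) n /
        (risingFactorial (1 + ν) n * risingFactorial (3/2 + ν/2) n * n.factorial) *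
          (x^2/4)^n|) ∧
    (∫ t in Set.Ioi x, besselK ν t) =
      (x/2) ^ (1 - ν) * Real.Gamma (ν - 1) *
        (∑' n : ℕ, risingFactorial (1/2 - ν/2) n /
          (risingFactorial (1 - ν) n * risingFactorial (3/2 - ν/2) n * n.factorial) *
            (x^2/4)^n) +
      (x/2) ^ (1 + ν) * Real.Gamma (-ν - 1) *
        (∑' n : ℕ, risingFactorial (1/2 + ν/2) n /
          (risingFactorial (1 + ν) n * risingFactorial (3/2 + ν/2) n * n.factorial) *
            (x^2/4)^n) +
      Real.Gamma (1/2 + ν/2) * Real.Gamma (1/2 - ν/2) / 2 := by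
  have h1 : ∀ m : ℕ, 1 + ν + m ≠ 0 := fun m h => hint (-1 - m) (by push_cast; linarith)
  have h2 : ∀ m : ℕ, 1 + -ν + m ≠ 0 := fun m h => hint (1 + m) (by push_cast; linarith)
  have hz : 0 < x ^ 2 / 4 := by positivity
  have s1 := summable_hyperOneTwo h1 _ hz
  have s2 := summable_hyperOneTwo h2 _ hz
  have hint' := integral_Ioi_macdonald (by linarith : -1 < ν) hint hx
  simp only [neg_div, ← sub_eq_add_neg] at s2
  refine ⟨?_, ?_, ?_⟩
  · simpa only [abs_mul, abs_pow, abs_of_pos hz] using s2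
  · simpa only [abs_mul, abs_pow, abs_of_pos hz] using s1
  · rw [setIntegral_congr_fun measurableSet_Ioi
      (fun t ht => besselK_eq_macdonald hν (hx.trans ht)), hint', macdonaldPrimitive,
      show (x / 2) ^ 2 = x ^ 2 / 4 by ring]
    simp only [hyperOneTwo, neg_div, ← sub_eq_add_neg]
end
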